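/- Fix b > 0 and let the kernel K additionally satisfy the vanishing-moment condition ∫z^j K(z)dz = 0 for j = 1,…,m_b. Then for any 0 < β ≤ b, any L > 0, any r ≥ 1 and any t ∈ [−1/2,1/2]², the data-driven estimator F̂_{(θ̂,ĥ)} satisfies sup_{F∈𝔽₂(β,L)} (E_F|F̂_{(θ̂,ĥ)}(t) − F(t)|^r)^{1/r} ≤ κ₁·ψ_n(β,L), where ψ_n(β,L) = L^{1/(2β+1)}·[n^{−1}ln(n)]^{β/(2β+1)} and κ₁ is a constant independent of n. -/

import Mathlib

open MeasureTheory Real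

noncomputable section

namespace SingleIndex

/-- Inner product of two points of `ℝ²`. -/
def dot2 (a b : Fin 2 → ℝ) : ℝ := a 0 * b 0 + a 1 * b 1

/-- The unit circle `S¹ ⊂ ℝ²`. -/
def S1 : Set (Fin 2 → ℝ) := {θ | θ 0 ^ 2 + θ 1 ^ 2 = 1}

/-- The Hölder ball `F(β₀, M)`: functions with `‖f‖_∞ + Hölder seminorm ≤ M`. -/
def HolderBall (β₀ M : ℝ) : Set (ℝ → ℝ) :=
  {f | ∃ A B : ℝ, A + B ≤ M ∧ (∀ y, |f y| ≤ A) ∧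
    ∀ y₁ y₂ : ℝ, |f y₁ - f y₂| ≤ B * |y₁ - y₂| ^ β₀}

/-- Assumption 4 on the kernel `K`. -/
structure KernelHyp (K : ℝ → ℝ) (Q : ℝ) : Prop where
  supp : ∀ u : ℝ, u ∉ Set.Icc (-(1/2) : ℝ) (1/2) → K u = 0
  norm_one : ∫ u : ℝ, K u = 1
  symm : ∀ u : ℝ, K (-u) = K u
  lip : ∀ u v : ℝ, |K u - K v| ≤ Q * |u - v|

/-- `‖K‖_∞`. -/
def Ksup (K : ℝ → ℝ) : ℝ := ⨆ u : ℝ, |K u|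

/-- `‖K‖₁`. -/
def K1 (K : ℝ → ℝ) : ℝ := ∫ u : ℝ, |K u|

/-- The monotone approximation error `Δ_{K,f}(h,z)`. -/
def Delta (K f : ℝ → ℝ) (h z : ℝ) : ℝ :=
  sSup {v | ∃ δ : ℝ, 0 < δ ∧ δ ≤ h ∧
    v = |δ⁻¹ * ∫ u : ℝ, K ((u - z) / δ) * (f u - f z)|}

/-- The Hardy–Littlewood maximal function `Δ*_{K,f}(h,y)` of `Δ_{K,f}(h,·)`. -/
def DeltaStar (K f : ℝ → ℝ) (h y : ℝ) : ℝ :=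
  sSup {v | ∃ a : ℝ, 0 < a ∧
    v = (2 * a)⁻¹ * ∫ z in Set.Icc (y - a) (y + a), Delta K f h z}

/-- `h_min = n⁻¹ ln^{1+2/ω}(n)`. -/
def hmin (ω : ℝ) (n : ℕ) : ℝ := (n : ℝ)⁻¹ * Real.log n ^ ((1 : ℝ) + 2 / ω)

/-- `𝔥 = √(n⁻¹ ln^{1+1/ω}(n))`. -/
def frakh (ω : ℝ) (n : ℕ) : ℝ := Real.sqrt ((n : ℝ)⁻¹ * Real.log n ^ ((1 : ℝ) + 1 / ω))

/-- The oracle bandwidth `h*_{K,f}(y)`. -/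
def hstar (K f : ℝ → ℝ) (ω : ℝ) (n : ℕ) (y : ℝ) : ℝ :=
  sSup {h | h ∈ Set.Icc (hmin ω n) 1 ∧
    Real.sqrt (n * h) * DeltaStar K f h y ≤ Ksup K * Real.sqrt (Real.log n)}

/-- The minimal sample size `n₀`. -/
def n0 (β₀ M ω : ℝ) : ℕ :=
  sInf {m : ℕ | 1 ≤ m ∧ ∀ n : ℕ, m ≤ n →
    max M 1 * max (frakh ω n ^ β₀) (Real.log n ^ ((1 : ℝ) / ω) * hmin ω n ^ β₀) ≤ 1}

/-- The noise class `𝔓` (Assumption 1): symmetric densities with the prescribed tail bound. -/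
def NoiseClass (Υ Ωc ω : ℝ) : Set (ℝ → ℝ) :=
  {p | (∀ y, 0 ≤ p y) ∧ (∫ y : ℝ, p y = 1) ∧ (∀ y, p (-y) = p y) ∧
    ∀ x : ℝ, 0 ≤ x → ∫ y in Set.Ici x, p y ≤ Υ * Real.exp (-Ωc * x ^ ω)}

/-- Assumption 2 on the design density `g`: a density bounded below by `gl` on `[-3,3]²`. -/
def DesignOK (g : (Fin 2 → ℝ) → ℝ) (gl : ℝ) : Prop :=
  (∀ x, 0 ≤ g x) ∧ (∫ x : Fin 2 → ℝ, g x = 1) ∧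
    ∀ x ∈ Set.Icc (fun _ : Fin 2 => (-3 : ℝ)) (fun _ : Fin 2 => (3 : ℝ)), gl ≤ g x

/-- Two-dimensional product kernel `K(u,v) = K(u)K(v)`. -/
def K2 (K : ℝ → ℝ) (v : Fin 2 → ℝ) : ℝ := K (v 0) * K (v 1)

/-- The matrix `E_{(θ,h)}`. -/
def Emat (θ : Fin 2 → ℝ) (h : ℝ) : Matrix (Fin 2) (Fin 2) ℝ :=
  !![θ 0 / h, θ 1 / h; -θ 1, θ 0]

/-- The matrix `Ē_{(θ,h)(ν,h)}`. -/
def Ebar (θ ν : Fin 2 → ℝ) (h : ℝ) : Matrix (Fin 2) (Fin 2) ℝ :=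
  !![(θ 0 + ν 0) / (2 * h * (1 + |dot2 ν θ|)), (θ 1 + ν 1) / (2 * h * (1 + |dot2 ν θ|));
     -((θ 1 + ν 1) / (2 * (1 + |dot2 ν θ|))), (θ 0 + ν 0) / (2 * (1 + |dot2 ν θ|))]

/-- The matrix `E_{(θ,h)(ν,h)}` with the sign convention. -/
def Epair (θ ν : Fin 2 → ℝ) (h : ℝ) : Matrix (Fin 2) (Fin 2) ℝ :=
  if 0 ≤ dot2 ν θ then Ebar θ ν h else Ebar (-θ) ν h

/-- Generic kernel estimator associated with a matrix `E`, as a function of the data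
`d : Fin n → (ℝ² × ℝ)`, `X_i = (d i).1`, `Y_i = (d i).2`. -/
def estM (K : ℝ → ℝ) (g : (Fin 2 → ℝ) → ℝ) (n : ℕ)
    (E : Matrix (Fin 2) (Fin 2) ℝ) (t : Fin 2 → ℝ)
    (d : Fin n → (Fin 2 → ℝ) × ℝ) : ℝ :=
  (E.det / n) * ∑ i : Fin n, K2 K (E.mulVec ((d i).1 - t)) * (d i).2 / g ((d i).1)

/-- Joint law of a single observation `(X_i, Y_i)` where `Y_i = F(X_i) + ε_i`:
density `g(x) p(y - F(x))` w.r.t. Lebesgue measure on `ℝ² × ℝ`. -/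
def jointLaw (g : (Fin 2 → ℝ) → ℝ) (p : ℝ → ℝ) (F : (Fin 2 → ℝ) → ℝ) :
    Measure ((Fin 2 → ℝ) × ℝ) :=
  volume.withDensity fun z => ENNReal.ofReal (g z.1 * p (z.2 - F z.1))

/-- Law `P_F^{(n)}` of the i.i.d. sample `(X_1,Y_1),…,(X_n,Y_n)`. -/
def dataLaw (n : ℕ) (g : (Fin 2 → ℝ) → ℝ) (p : ℝ → ℝ) (F : (Fin 2 → ℝ) → ℝ) :
    Measure (Fin n → (Fin 2 → ℝ) × ℝ) :=
  Measure.pi fun _ => jointLaw g p F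

end SingleIndex
namespace SingleIndex

/-- Parameters of the model and of the procedure. -/
structure Pars where
  /-- the univariate kernel -/
  K : ℝ → ℝ
  /-- Lipschitz constant of the kernel -/
  Q : ℝ
  /-- the design density -/
  g : (Fin 2 → ℝ) → ℝ
  /-- lower bound of `g` on `[-3,3]²` -/
  gl : ℝ
  /-- tail constant of the noise class -/
  Υ : ℝ
  /-- tail exponent constant `Ω` of the noise class -/
  Ωc : ℝ
  /-- tail power `ω` of the noise class -/
  ω : ℝ
  /-- order of the risk -/
  r : ℝ

/-- `σ² = sup_{p ∈ 𝔓} ∫ x² p(x) dx`. -/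
def sigma2 (P : Pars) : ℝ :=
  sSup {v | ∃ p ∈ NoiseClass P.Υ P.Ωc P.ω, v = ∫ x : ℝ, x ^ 2 * p x}

/-- `τ = (Ω⁻¹(4r+1) ln n)^{1/ω}`. -/
def tauf (P : Pars) (n : ℕ) : ℝ := (P.Ωc⁻¹ * (4 * P.r + 1) * Real.log n) ^ ((1 : ℝ) / P.ω)

/-- The quantity `c₁(n)`. -/
def c1f (P : Pars) (n : ℕ) : ℝ :=
  730 * Real.log (16 * (n : ℝ) ^ 2 * P.gl ^ (-(1/2) : ℝ) * (12 * P.Q + Real.sqrt 2))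
    + 8 * P.r * Real.log n + 394

/-- The quantity `c₂(n)`. -/
def c2f (P : Pars) (n : ℕ) : ℝ :=
  730 * Real.log (16 * (n : ℝ) ^ 2 * tauf P n * P.gl ^ (-(1/2) : ℝ) * (12 * P.Q + Real.sqrt 2))
    + 8 * P.r * Real.log n + 394

/-- The quantity `c₃(n)`. -/
def c3f (P : Pars) (n : ℕ) : ℝ :=
  365 * Real.log (5 * (n : ℝ) ^ 2 * P.Q * P.gl ^ (-(1/2) : ℝ)) + 8 * P.r * Real.log n + 197

/-- The quantity `c₄(n)`. -/
def c4f (P : Pars) (n : ℕ) : ℝ :=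
  365 * Real.log (5 * (n : ℝ) ^ 2 * tauf P n * P.Q * P.gl ^ (-(1/2) : ℝ))
    + 8 * P.r * Real.log n + 197

/-- The constant `C₁(n)`. -/
def C1f (P : Pars) (n : ℕ) : ℝ :=
  2 * Real.sqrt 2 * P.gl ^ (-(1/2) : ℝ) * Ksup P.K ^ 2 * Real.sqrt (c1f P n)
    + 8 / 3 * c1f P n * Real.log n ^ (-((2 + P.ω) / (2 * P.ω))) * P.gl⁻¹ * Ksup P.K ^ 2

/-- The constant `C₂(n)`. -/
def C2f (P : Pars) (n : ℕ) : ℝ :=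
  2 * Real.sqrt 2 * max (Real.sqrt (sigma2 P)) 1 * P.gl ^ (-(1/2) : ℝ) * Ksup P.K ^ 2
      * Real.sqrt (c2f P n)
    + 8 / 3 * c2f P n * Real.log n ^ (-(1/2) : ℝ) * P.gl⁻¹ * Ksup P.K ^ 2
      * (P.Ωc⁻¹ * (4 * P.r + 1)) ^ ((1 : ℝ) / P.ω)

/-- The constant `C₃(n)`. -/
def C3f (P : Pars) (n : ℕ) : ℝ :=
  2 * Real.sqrt 2 * P.gl ^ (-(1/2) : ℝ) * Ksup P.K ^ 2 * Real.sqrt (c3f P n)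
    + 8 / 3 * P.gl⁻¹ * Ksup P.K ^ 2 * c3f P n * ((n : ℝ) * frakh P.ω n ^ 2) ^ (-(1/2) : ℝ)

/-- The constant `C₄(n)`. -/
def C4f (P : Pars) (n : ℕ) : ℝ :=
  2 * Real.sqrt 2 * max (Real.sqrt (sigma2 P)) 1 * P.gl ^ (-(1/2) : ℝ) * Ksup P.K ^ 2
      * Real.sqrt (c4f P n)
    + 8 / 3 * tauf P n * c4f P n * ((n : ℝ) * frakh P.ω n ^ 2) ^ (-(1/2) : ℝ)
      * P.gl⁻¹ * Ksup P.K ^ 2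

/-- The constant `C₅(n)`. -/
def C5f (P : Pars) (n : ℕ) : ℝ :=
  K1 P.K ^ 2 + ((n : ℝ) * frakh P.ω n ^ 2) ^ (-(1/2) : ℝ) * C4f P n + 1 / 2

/-- `n₁`: the minimal sample size linked to `(n𝔥²)^{-1/2} C₃(n) ≤ 1/2`. -/
def n1 (P : Pars) : ℕ :=
  sInf {m : ℕ | 1 ≤ m ∧ ∀ n : ℕ, m ≤ n →
    ((n : ℝ) * frakh P.ω n ^ 2) ^ (-(1/2) : ℝ) * C3f P n ≤ 1 / 2}

/-- The auxiliary estimator `F̂(v)` with bandwidth `𝔥`. -/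
def FhatAux (P : Pars) (n : ℕ) (d : Fin n → (Fin 2 → ℝ) × ℝ) (v : Fin 2 → ℝ) : ℝ :=
  (n : ℝ)⁻¹ * ∑ i : Fin n, (P.g ((d i).1))⁻¹ * (frakh P.ω n) ^ (-2 : ℤ) *
    P.K (((d i).1 0 - v 0) / frakh P.ω n) * P.K (((d i).1 1 - v 1) / frakh P.ω n) * (d i).2

/-- `F̂_∞ = 2 sup_{v ∈ [-5/2,5/2]²} |F̂(v)| + 2C₅(n)`. -/
def FhatInf (P : Pars) (n : ℕ) (d : Fin n → (Fin 2 → ℝ) × ℝ) : ℝ :=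
  2 * sSup {w | ∃ v ∈ Set.Icc (fun _ : Fin 2 => -(5/2 : ℝ)) (fun _ : Fin 2 => (5/2 : ℝ)),
      w = |FhatAux P n d v|}
    + 2 * C5f P n

/-- The random threshold `TH(η)`. -/
def TH (P : Pars) (n : ℕ) (d : Fin n → (Fin 2 → ℝ) × ℝ) (η : ℝ) : ℝ :=
  2 * (Ksup P.K ^ 2 * Real.sqrt (Real.log n) + FhatInf P n d * C1f P n + C2f P n)
    * (η * n) ^ (-(1/2) : ℝ)

/-- The dyadic bandwidth grid `H_n = {2^{-k} : k ∈ ℕ} ∩ [h_min/2, 1]`. -/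
def Hgrid (ω : ℝ) (n : ℕ) : Set ℝ :=
  {h | (∃ k : ℕ, h = (2 : ℝ) ^ (-(k : ℤ))) ∧ hmin ω n / 2 ≤ h ∧ h ≤ 1}

/-- The quantity `R^{(1)}_t(θ,h)`. -/
def R1 (P : Pars) (n : ℕ) (t : Fin 2 → ℝ) (θ : Fin 2 → ℝ) (h : ℝ)
    (d : Fin n → (Fin 2 → ℝ) × ℝ) : ℝ :=
  sSup {v | ∃ η ∈ Hgrid P.ω n, η ≤ h ∧
    v = max (sSup {w | ∃ ν ∈ S1,
          w = |estM P.K P.g n (Epair θ ν η) t d - estM P.K P.g n (Emat ν η) t d|}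
        - TH P n d η) 0}

/-- The quantity `R^{(2)}_t(h)`. -/
def R2 (P : Pars) (n : ℕ) (t : Fin 2 → ℝ) (h : ℝ)
    (d : Fin n → (Fin 2 → ℝ) × ℝ) : ℝ :=
  sSup {v | ∃ η ∈ Hgrid P.ω n, η ≤ h ∧
    v = max (sSup {w | ∃ θ ∈ S1,
          w = |estM P.K P.g n (Emat θ h) t d - estM P.K P.g n (Emat θ η) t d|}
        - TH P n d η) 0}

/-- `(θ̂, ĥ)`, as a function of the data, is a solution of the minimization problem
(2.5) defining the selection rule at the point `t`. -/
def IsSelector (P : Pars) (n : ℕ) (t : Fin 2 → ℝ)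
    (sel : (Fin n → (Fin 2 → ℝ) × ℝ) → (Fin 2 → ℝ) × ℝ) : Prop :=
  ∀ d, (sel d).1 ∈ S1 ∧ (sel d).2 ∈ Hgrid P.ω n ∧
    ∀ θ ∈ S1, ∀ h ∈ Hgrid P.ω n,
      R1 P n t (sel d).1 (sel d).2 d + R2 P n t (sel d).2 d + TH P n d (sel d).2
        ≤ R1 P n t θ h d + R2 P n t h d + TH P n d h

/-- The selected estimator `F̂_{(θ̂,ĥ)}(t)` as a function of the data. -/
def selEst (P : Pars) (n : ℕ) (t : Fin 2 → ℝ)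
    (sel : (Fin n → (Fin 2 → ℝ) × ℝ) → (Fin 2 → ℝ) × ℝ)
    (d : Fin n → (Fin 2 → ℝ) × ℝ) : ℝ :=
  estM P.K P.g n (Emat (sel d).1 (sel d).2) t d

end SingleIndex
namespace SingleIndex

/-- `m_a`: the largest integer strictly smaller than `a` (for `a > 0`). -/
def mInt (a : ℝ) : ℕ := ⌈a⌉₊ - 1

/-- The Hölder class `H(β,L)`. -/
def HolderClass (β L : ℝ) : Set (ℝ → ℝ) :=
  {f | ContDiff ℝ (mInt β) f ∧
    (∀ m : ℕ, m ≤ mInt β → ∀ y : ℝ, |iteratedDeriv m f y| ≤ L) ∧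
    ∀ u h : ℝ, 0 < h →
      |iteratedDeriv (mInt β) f (u + h) - iteratedDeriv (mInt β) f u|
        ≤ L * h ^ (β - mInt β)}

/-- Assumption 7: vanishing moments `∫ z^j K(z) dz = 0`, `j = 1,…,m`. -/
def VanishingMoments (K : ℝ → ℝ) (m : ℕ) : Prop :=
  ∀ j : ℕ, 1 ≤ j → j ≤ m → ∫ z : ℝ, z ^ j * K z = 0

end SingleIndex

namespace SingleIndex

/-- Exponential moment bound for a bounded variable. -/
lemma integral_exp_mul_le {Ω : Type*} [MeasurableSpace Ω] (μ : Measure Ω) [IsProbabilityMeasure μ]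
    {Z : Ω → ℝ} (hZ : AEMeasurable Z μ) {M v s : ℝ} (hs : 0 ≤ s)
    (hsM : s * M ≤ 1) (hb : ∀ ω, |Z ω| ≤ M) (hvar : ∫ ω, Z ω ^ 2 ∂μ ≤ v) :
    ∫ ω, exp (s * Z ω) ∂μ ≤ exp (s * ∫ ω, Z ω ∂μ + s ^ 2 * v) := by
  have hZi : Integrable Z μ := Integrable.of_bound hZ.aestronglyMeasurable M
    (Filter.Eventually.of_forall hb)
  have hZ2 : Integrable (fun ω => Z ω ^ 2) μ :=
    Integrable.of_bound (hZ.pow_const 2).aestronglyMeasurable (M ^ 2)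
      (Filter.Eventually.of_forall fun ω => by
        rw [Real.norm_eq_abs, abs_pow]; exact pow_le_pow_left₀ (abs_nonneg _) (hb ω) 2)
  have hle : ∀ ω, exp (s * Z ω) ≤ 1 + s * Z ω + s ^ 2 * Z ω ^ 2 := by
    intro ω
    have h1 : |s * Z ω| ≤ 1 := by
      rw [abs_mul, abs_of_nonneg hs]
      exact (mul_le_mul_of_nonneg_left (hb ω) hs).trans hsM
    have := (abs_le.1 (Real.abs_exp_sub_one_sub_id_le h1)).2
    rw [mul_pow] at this
    linarith
  have hi1 : Integrable (fun ω => 1 + s * Z ω) μ := (integrable_const _).add (hZi.const_mul s)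
  have hi2 : Integrable (fun ω => s ^ 2 * Z ω ^ 2) μ := hZ2.const_mul _
  calc ∫ ω, exp (s * Z ω) ∂μ
      ≤ ∫ ω, (1 + s * Z ω + s ^ 2 * Z ω ^ 2) ∂μ :=
        integral_mono_of_nonneg (Filter.Eventually.of_forall fun ω => (exp_pos _).le)
          (hi1.add hi2) (Filter.Eventually.of_forall hle)
    _ = 1 + s * ∫ ω, Z ω ∂μ + s ^ 2 * ∫ ω, Z ω ^ 2 ∂μ := by
        rw [integral_add hi1 hi2, integral_add (integrable_const _) (hZi.const_mul s),
          integral_const_mul, integral_const_mul]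
        simp
    _ ≤ 1 + (s * ∫ ω, Z ω ∂μ + s ^ 2 * v) := by
        have := mul_le_mul_of_nonneg_left hvar (sq_nonneg s)
        linarith
    _ ≤ _ := by
        have := Real.add_one_le_exp (s * ∫ ω, Z ω ∂μ + s ^ 2 * v)
        linarith

/-- The exponent in Bernstein's inequality can be tuned to reach the level `c`. -/
lemma exists_bernstein_exponent {M v c n : ℝ} (hM : 0 < M) (hv : 0 ≤ v) (hc : 0 < c)
    (hn : 0 < n) :
    ∃ s : ℝ, 0 ≤ s ∧ s * M ≤ 1 ∧
      c ≤ n * s * (2 * √(v * c / n) + M * c / n) - n * s ^ 2 * v := by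
  set y := √(v * c / n) with hy
  have hy0 : 0 ≤ y := Real.sqrt_nonneg _
  have hy2 : y ^ 2 = v * c / n := Real.sq_sqrt (by positivity)
  have hy2' : n * y ^ 2 = v * c := by rw [hy2]; field_simp
  by_cases h : n * v ≤ c * M ^ 2
  · refine ⟨M⁻¹, by positivity, by rw [inv_mul_cancel₀ hM.ne'], ?_⟩
    have h1 : n * y ≤ c * M := by
      refine abs_le_of_sq_le_sq' ?_ (by positivity) |>.2
      calc (n * y) ^ 2 = n * (n * y ^ 2) := by ring
        _ = c * (n * v) := by rw [hy2']; ring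
        _ ≤ c * (c * M ^ 2) := by gcongr
        _ = _ := by ring
    have h2 : v ≤ M * y := by
      have : v * c ≤ (M * y) * c := by
        rw [← hy2']; nlinarith
      exact le_of_mul_le_mul_right this hc
    have e : n * M⁻¹ * (2 * y + M * c / n) - n * M⁻¹ ^ 2 * v
        = c + n * (M⁻¹ ^ 2) * (2 * (M * y) - v) := by field_simp; ring
    rw [e]
    have : 0 ≤ n * (M⁻¹ ^ 2) * (2 * (M * y) - v) := by
      apply mul_nonneg (by positivity)
      have : 0 ≤ M * y := by positivity
      linarith
    linarith
  · push Not at h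
    have hv0 : 0 < v := by
      by_contra hcon
      have : v = 0 := le_antisymm (not_lt.1 hcon) hv
      rw [this] at h
      have : 0 < c * M ^ 2 := by positivity
      linarith
    have hy0 : 0 < y := Real.sqrt_pos.2 (by positivity)
    refine ⟨y / v, by positivity, ?_, ?_⟩
    · rw [div_mul_eq_mul_div, div_le_one hv0]
      refine abs_le_of_sq_le_sq' ?_ hv0.le |>.2
      have : n * (y * M) ^ 2 ≤ n * v ^ 2 := by
        calc n * (y * M) ^ 2 = (n * y ^ 2) * M ^ 2 := by ring
          _ = v * (c * M ^ 2) := by rw [hy2']; ring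
          _ ≤ v * (n * v) := by gcongr
          _ = _ := by ring
      exact le_of_mul_le_mul_left this hn
    · have e : n * (y / v) * (2 * y + M * c / n) - n * (y / v) ^ 2 * v
          = (n * y ^ 2) / v + y / v * (M * c) := by field_simp; ring
      rw [e, hy2']
      have : v * c / v = c := by field_simp
      rw [this]
      have : 0 ≤ y / v * (M * c) := by positivity
      linarith

lemma bernstein_upper {Ω : Type*} [MeasurableSpace Ω] (μ : Measure Ω) [IsProbabilityMeasure μ]
    {Z : Ω → ℝ} (hZ : AEMeasurable Z μ) {M v c : ℝ} {n : ℕ} (hn : 0 < n) (hM : 0 < M)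
    (hc : 0 < c) (hb : ∀ ω, |Z ω| ≤ M) (hvar : ∫ ω, Z ω ^ 2 ∂μ ≤ v) :
    (Measure.pi fun _ : Fin n => μ) {d | 2 * √(v * c / n) + M * c / n
        ≤ (n : ℝ)⁻¹ * ∑ i, Z (d i) - ∫ ω, Z ω ∂μ} ≤ ENNReal.ofReal (exp (-c)) := by
  have hn' : (0 : ℝ) < n := by exact_mod_cast hn
  have hv : 0 ≤ v := le_trans (integral_nonneg fun _ => sq_nonneg _) hvar
  obtain ⟨s, hs, hsM, hsc⟩ := exists_bernstein_exponent hM hv hc hn'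
  set x := 2 * √(v * c / n) + M * c / n
  set m := ∫ ω, Z ω ∂μ
  set X : (Fin n → Ω) → ℝ := fun d => ∑ i, Z (d i)
  have hprod : (fun d => exp (s * X d)) = fun d : Fin n → Ω => ∏ i, exp (s * Z (d i)) := by
    funext d
    rw [← Real.exp_sum, Finset.mul_sum]
  have hei : Integrable (fun ω => exp (s * Z ω)) μ := by
    refine Integrable.of_bound (hZ.const_mul s).exp.aestronglyMeasurable (exp 1)
      (Filter.Eventually.of_forall fun ω => ?_)
    rw [Real.norm_eq_abs, abs_of_pos (exp_pos _)]
    exact exp_le_exp.2 ((mul_le_mul_of_nonneg_left ((le_abs_self _).trans (hb ω)) hs).trans hsM)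
  have h_integrable : Integrable (fun d => exp (s * X d)) (Measure.pi fun _ : Fin n => μ) := by
    rw [hprod]
    exact Integrable.fintype_prod (f := fun _ : Fin n => fun ω => exp (s * Z ω)) fun _ => hei
  have hmgf : ProbabilityTheory.mgf X (Measure.pi fun _ : Fin n => μ) s
      ≤ exp (n * (s * m + s ^ 2 * v)) := by
    rw [ProbabilityTheory.mgf, hprod, integral_fintype_prod_eq_pow (fun ω => exp (s * Z ω)),
      Fintype.card_fin, Real.exp_nat_mul]
    exact pow_le_pow_left₀ (integral_nonneg fun _ => (exp_pos _).le)
      (integral_exp_mul_le μ hZ hs hsM hb hvar) n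
  have hset : {d : Fin n → Ω | x ≤ (n : ℝ)⁻¹ * ∑ i, Z (d i) - m} = {d | n * (x + m) ≤ X d} := by
    ext d
    simp only [Set.mem_ofPred_eq, X]
    rw [le_sub_iff_add_le, inv_mul_eq_div, le_div_iff₀ hn', mul_comm]
  rw [hset, ← ENNReal.ofReal_toReal (measure_ne_top (Measure.pi fun _ : Fin n => μ) _)]
  apply ENNReal.ofReal_le_ofReal
  refine (ProbabilityTheory.measure_ge_le_exp_mul_mgf (n * (x + m)) hs h_integrable).trans ?_
  calc exp (-s * (n * (x + m))) * ProbabilityTheory.mgf X (Measure.pi fun _ : Fin n => μ) s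
      ≤ exp (-s * (n * (x + m))) * exp (n * (s * m + s ^ 2 * v)) := by gcongr
    _ = exp (-(n * s * x - n * s ^ 2 * v)) := by rw [← Real.exp_add]; ring_nf
    _ ≤ _ := exp_le_exp.2 (neg_le_neg hsc)

/-- Bernstein's inequality for the empirical mean of an i.i.d. sample. -/
lemma bernstein_pi {Ω : Type*} [MeasurableSpace Ω] (μ : Measure Ω) [IsProbabilityMeasure μ]
    {Z : Ω → ℝ} (hZ : AEMeasurable Z μ) {M v c : ℝ} {n : ℕ} (hn : 0 < n) (hM : 0 < M)
    (hc : 0 < c) (hb : ∀ ω, |Z ω| ≤ M) (hvar : ∫ ω, Z ω ^ 2 ∂μ ≤ v) :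
    (Measure.pi fun _ : Fin n => μ) {d | 2 * √(v * c / n) + M * c / n
        ≤ |(n : ℝ)⁻¹ * ∑ i, Z (d i) - ∫ ω, Z ω ∂μ|} ≤ ENNReal.ofReal (2 * exp (-c)) := by
  have h1 := bernstein_upper μ hZ hn hM hc hb hvar
  have h2 := bernstein_upper μ hZ.neg hn hM hc (M := M) (v := v)
    (fun ω => by simpa using hb ω) (by simpa using hvar)
  have hsub : {d : Fin n → Ω | 2 * √(v * c / n) + M * c / n
        ≤ |(n : ℝ)⁻¹ * ∑ i, Z (d i) - ∫ ω, Z ω ∂μ|} ⊆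
      {d | 2 * √(v * c / n) + M * c / n ≤ (n : ℝ)⁻¹ * ∑ i, Z (d i) - ∫ ω, Z ω ∂μ} ∪
      {d | 2 * √(v * c / n) + M * c / n ≤ (n : ℝ)⁻¹ * ∑ i, (-Z) (d i) - ∫ ω, (-Z) ω ∂μ} := by
    intro d hd
    rcases le_abs.1 (Set.mem_ofPred_eq ▸ hd) with h | h
    · exact Or.inl h
    · refine Or.inr ?_
      simp only [Set.mem_ofPred_eq, Pi.neg_apply, Finset.sum_neg_distrib, integral_neg]
      linarith
  calc _ ≤ _ := measure_mono hsub
    _ ≤ _ := measure_union_le _ _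
    _ ≤ _ := add_le_add h1 h2
    _ = _ := by rw [← ENNReal.ofReal_add (exp_pos _).le (exp_pos _).le]; ring_nf

/-- A finite net of a bounded planar set, with points in the set. -/
lemma exists_finset_net (S : Set (Fin 2 → ℝ)) {R δ : ℝ} (hR : 0 ≤ R) (hδ : 0 < δ)
    (hS : ∀ w ∈ S, ∀ i, |w i| ≤ R) :
    ∃ T : Finset (Fin 2 → ℝ), (∀ w ∈ T, w ∈ S) ∧ (T.card : ℝ) ≤ (2 * R / δ + 2) ^ 2 ∧
      ∀ w ∈ S, ∃ w' ∈ T, ∀ i, |w i - w' i| ≤ δ := by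
  classical
  let cell : (Fin 2 → ℝ) → ℤ × ℤ := fun w => (⌊w 0 / δ⌋, ⌊w 1 / δ⌋)
  let I : Finset (ℤ × ℤ) := Finset.Icc ⌊-R / δ⌋ ⌊R / δ⌋ ×ˢ Finset.Icc ⌊-R / δ⌋ ⌊R / δ⌋
  have hI : ∀ w ∈ S, cell w ∈ I := by
    intro w hw
    have hc : ∀ i, ⌊w i / δ⌋ ∈ Finset.Icc ⌊-R / δ⌋ ⌊R / δ⌋ := by
      intro i
      have := abs_le.1 (hS w hw i)
      rw [Finset.mem_Icc]
      exact ⟨Int.floor_le_floor (by gcongr; exact this.1),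
        Int.floor_le_floor (by gcongr; exact this.2)⟩
    exact Finset.mem_product.2 ⟨hc 0, hc 1⟩
  let J : Finset (ℤ × ℤ) := I.filter fun k => ∃ w ∈ S, cell w = k
  have hJ : ∀ k ∈ J, ∃ w ∈ S, cell w = k := fun k hk => (Finset.mem_filter.1 hk).2
  choose! rep hrepS hrep using hJ
  refine ⟨J.image rep, ?_, ?_, ?_⟩
  · intro w hw
    obtain ⟨k, hk, rfl⟩ := Finset.mem_image.1 hw
    exact hrepS k hk
  · have h1 : (J.image rep).card ≤ I.card :=
      Finset.card_image_le.trans (Finset.card_filter_le _ _)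
    have h2 : ((Finset.Icc ⌊-R / δ⌋ ⌊R / δ⌋).card : ℝ) ≤ 2 * R / δ + 2 := by
      rw [Int.card_Icc]
      have hle : ⌊-R / δ⌋ ≤ ⌊R / δ⌋ := Int.floor_le_floor (by gcongr; linarith)
      have : (((⌊R / δ⌋ + 1 - ⌊-R / δ⌋).toNat : ℤ) : ℝ) = (⌊R / δ⌋ + 1 - ⌊-R / δ⌋ : ℤ) := by
        rw [Int.toNat_of_nonneg (by omega)]
      rw [Int.cast_natCast] at this
      rw [this]
      push_cast
      have h3 := Int.floor_le (R / δ)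
      have h4 := (Int.lt_floor_add_one (-R / δ)).le
      have h5 : 2 * R / δ = R / δ - -R / δ := by ring
      rw [h5]; linarith
    calc ((J.image rep).card : ℝ) ≤ (I.card : ℝ) := by exact_mod_cast h1
      _ = ((Finset.Icc ⌊-R / δ⌋ ⌊R / δ⌋).card : ℝ) ^ 2 := by
        simp only [I, Finset.card_product]; push_cast; ring
      _ ≤ _ := by gcongr
  · intro w hw
    have hk : cell w ∈ J := Finset.mem_filter.2 ⟨hI w hw, w, hw, rfl⟩
    refine ⟨rep (cell w), Finset.mem_image_of_mem _ hk, ?_⟩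
    have he := hrep _ hk
    have key : ∀ i, ⌊rep (cell w) i / δ⌋ = ⌊w i / δ⌋ := by
      intro i
      fin_cases i
      · exact congrArg Prod.fst he
      · exact congrArg Prod.snd he
    intro i
    have h1 := Int.abs_sub_lt_one_of_floor_eq_floor (key i)
    rw [← sub_div, abs_div, abs_of_pos hδ, div_lt_one hδ] at h1
    rw [abs_sub_comm]
    exact h1.le

/-- Law of the design. -/
def designLaw (g : (Fin 2 → ℝ) → ℝ) : Measure (Fin 2 → ℝ) :=
  volume.withDensity fun x => ENNReal.ofReal (g x)

/-- Law of the noise. -/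
def noiseLaw (p : ℝ → ℝ) : Measure ℝ := volume.withDensity fun e => ENNReal.ofReal (p e)

lemma isProbabilityMeasure_withDensity_ofReal {α : Type*} [MeasureSpace α] {g : α → ℝ}
    (h0 : ∀ x, 0 ≤ g x) (h1 : ∫ x, g x = 1) :
    IsProbabilityMeasure ((volume : Measure α).withDensity fun x => ENNReal.ofReal (g x)) := by
  have hi : Integrable g := integrable_of_integral_eq_one h1
  constructor
  rw [withDensity_apply _ MeasurableSet.univ, Measure.restrict_univ,
    ← ofReal_integral_eq_lintegral_ofReal hi (Filter.Eventually.of_forall h0), h1,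
    ENNReal.ofReal_one]

/-- The map `(x, e) ↦ (x, F x + e)`. -/
def shear (F : (Fin 2 → ℝ) → ℝ) (hF : Measurable F) :
    ((Fin 2 → ℝ) × ℝ) ≃ᵐ ((Fin 2 → ℝ) × ℝ) where
  toFun z := (z.1, F z.1 + z.2)
  invFun z := (z.1, z.2 - F z.1)
  left_inv z := by simp
  right_inv z := by simp
  measurable_toFun := by
    change Measurable fun z : (Fin 2 → ℝ) × ℝ => (z.1, F z.1 + z.2)
    fun_prop
  measurable_invFun := by
    change Measurable fun z : (Fin 2 → ℝ) × ℝ => (z.1, z.2 - F z.1)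
    fun_prop

lemma measurePreserving_shear (F : (Fin 2 → ℝ) → ℝ) (hF : Measurable F) :
    MeasurePreserving (shear F hF) volume volume := by
  have := MeasurePreserving.skew_product (MeasurePreserving.id (volume : Measure (Fin 2 → ℝ)))
    (μc := (volume : Measure ℝ)) (μd := (volume : Measure ℝ)) (g := fun x e => F x + e)
    (by unfold Function.uncurry; fun_prop)
    (Filter.Eventually.of_forall fun x => (measurePreserving_add_left volume (F x)).map_eq)
  exact this

lemma jointLaw_eq_map {g : (Fin 2 → ℝ) → ℝ} {p : ℝ → ℝ} {F : (Fin 2 → ℝ) → ℝ}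
    (hg0 : ∀ x, 0 ≤ g x) (hg1 : ∫ x, g x = 1) (hp1 : ∫ x, p x = 1) (hF : Measurable F) :
    jointLaw g p F = ((designLaw g).prod (noiseLaw p)).map (shear F hF) := by
  have hgi : Integrable g := integrable_of_integral_eq_one hg1
  have hpi : Integrable p := integrable_of_integral_eq_one hp1
  rw [designLaw, noiseLaw, prod_withDensity₀ hgi.aestronglyMeasurable.aemeasurable.ennreal_ofReal
    hpi.aestronglyMeasurable.aemeasurable.ennreal_ofReal]
  ext s hs
  rw [MeasurableEquiv.map_apply, withDensity_apply _ ((shear F hF).measurable hs), jointLaw,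
    withDensity_apply _ hs, ← lintegral_indicator hs,
    ← lintegral_indicator ((shear F hF).measurable hs),
    ← (measurePreserving_shear F hF).lintegral_comp_emb (shear F hF).measurableEmbedding]
  congr 1
  funext z
  simp only [Set.indicator, Set.mem_preimage]
  have : (shear F hF z).1 = z.1 ∧ (shear F hF z).2 - F (shear F hF z).1 = z.2 := by
    simp [shear]
  rw [this.2, this.1, ENNReal.ofReal_mul (hg0 _)]
  rfl

/-- Facts about the model that hold for one signal and one noise density. -/
structure Model (g : (Fin 2 → ℝ) → ℝ) (p : ℝ → ℝ) (F : (Fin 2 → ℝ) → ℝ) : Prop where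
  g_nonneg : ∀ x, 0 ≤ g x
  g_one : ∫ x, g x = 1
  p_nonneg : ∀ x, 0 ≤ p x
  p_one : ∫ x, p x = 1
  p_symm : ∀ x, p (-x) = p x
  F_meas : Measurable F

variable {g : (Fin 2 → ℝ) → ℝ} {p : ℝ → ℝ} {F : (Fin 2 → ℝ) → ℝ}

lemma Model.design_prob (h : Model g p F) : IsProbabilityMeasure (designLaw g) :=
  isProbabilityMeasure_withDensity_ofReal h.g_nonneg h.g_one

lemma Model.noise_prob (h : Model g p F) : IsProbabilityMeasure (noiseLaw p) :=
  isProbabilityMeasure_withDensity_ofReal h.p_nonneg h.p_one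

lemma Model.joint_eq (h : Model g p F) :
    jointLaw g p F = ((designLaw g).prod (noiseLaw p)).map (shear F h.F_meas) :=
  jointLaw_eq_map h.g_nonneg h.g_one h.p_one h.F_meas

lemma Model.joint_prob (h : Model g p F) : IsProbabilityMeasure (jointLaw g p F) := by
  have := h.design_prob
  have := h.noise_prob
  rw [h.joint_eq]
  exact Measure.isProbabilityMeasure_map (shear F h.F_meas).measurable.aemeasurable

lemma Model.integral_joint (h : Model g p F) (φ : (Fin 2 → ℝ) × ℝ → ℝ) :
    ∫ z, φ z ∂jointLaw g p F
      = ∫ z, φ (z.1, F z.1 + z.2) ∂(designLaw g).prod (noiseLaw p) := by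
  rw [h.joint_eq, integral_map_equiv]
  rfl

lemma Model.lintegral_joint (h : Model g p F) (φ : (Fin 2 → ℝ) × ℝ → ENNReal) :
    ∫⁻ z, φ z ∂jointLaw g p F
      = ∫⁻ z, φ (z.1, F z.1 + z.2) ∂(designLaw g).prod (noiseLaw p) := by
  rw [h.joint_eq, lintegral_map_equiv]
  rfl

lemma Model.integral_design (h : Model g p F) (φ : (Fin 2 → ℝ) → ℝ) :
    ∫ x, φ x ∂designLaw g = ∫ x, g x * φ x := by
  have hgi : Integrable g := integrable_of_integral_eq_one h.g_one
  rw [designLaw, integral_withDensity_eq_integral_toReal_smul₀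
    hgi.aestronglyMeasurable.aemeasurable.ennreal_ofReal
    (Filter.Eventually.of_forall fun _ => ENNReal.ofReal_lt_top)]
  simp only [ENNReal.toReal_ofReal (h.g_nonneg _), smul_eq_mul]

lemma Model.integral_noise (h : Model g p F) (φ : ℝ → ℝ) :
    ∫ x, φ x ∂noiseLaw p = ∫ x, p x * φ x := by
  have hpi : Integrable p := integrable_of_integral_eq_one h.p_one
  rw [noiseLaw, integral_withDensity_eq_integral_toReal_smul₀
    hpi.aestronglyMeasurable.aemeasurable.ennreal_ofReal
    (Filter.Eventually.of_forall fun _ => ENNReal.ofReal_lt_top)]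
  simp only [ENNReal.toReal_ofReal (h.p_nonneg _), smul_eq_mul]

lemma Model.g_aemeasurable (h : Model g p F) : AEMeasurable g (designLaw g) :=
  (integrable_of_integral_eq_one h.g_one).aestronglyMeasurable.aemeasurable.mono_ac
    (withDensity_absolutelyContinuous _ _)

/-- Truncation of the noise at the level `τ`. -/
def trunc (τ e : ℝ) : ℝ := if |e| ≤ τ then e else 0

lemma measurable_trunc (τ : ℝ) : Measurable (trunc τ) :=
  Measurable.ite (measurableSet_le measurable_norm measurable_const) measurable_id
    measurable_const

lemma abs_trunc_le {τ : ℝ} (hτ : 0 ≤ τ) (e : ℝ) : |trunc τ e| ≤ τ := by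
  unfold trunc
  split_ifs with h
  · exact h
  · simpa using hτ

lemma trunc_sq_le (τ e : ℝ) : trunc τ e ^ 2 ≤ e ^ 2 := by
  unfold trunc
  split_ifs with h
  · exact le_rfl
  · simpa using sq_nonneg e

lemma Model.integral_trunc (h : Model g p F) (τ : ℝ) : ∫ e, trunc τ e ∂noiseLaw p = 0 := by
  rw [h.integral_noise]
  have h1 := integral_neg_eq_self (fun e => p e * trunc τ e) volume
  have h2 : ∀ e, p (-e) * trunc τ (-e) = -(p e * trunc τ e) := by
    intro e
    rw [h.p_symm, trunc, trunc, abs_neg]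
    split_ifs <;> simp
  simp only [h2, integral_neg] at h1
  linarith

/-- Weighted truncated observation. -/
def obs (g : (Fin 2 → ℝ) → ℝ) (F : (Fin 2 → ℝ) → ℝ) (τ : ℝ) (φ : (Fin 2 → ℝ) → ℝ)
    (z : (Fin 2 → ℝ) × ℝ) : ℝ :=
  φ z.1 / g z.1 * (F z.1 + trunc τ (z.2 - F z.1))

/-- A weight supported where the design density is bounded below and the signal is bounded
by `B`. -/
structure Weight (g F φ : (Fin 2 → ℝ) → ℝ) (gl B M₀ V₀ : ℝ) : Prop where
  meas : Measurable φ
  bound : ∀ x, |φ x| ≤ M₀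
  support : ∀ x, φ x ≠ 0 → gl ≤ g x ∧ |F x| ≤ B
  integrable_sq : Integrable fun x => φ x ^ 2
  integral_sq : ∫ x, φ x ^ 2 ≤ V₀

variable {φ : (Fin 2 → ℝ) → ℝ} {gl B M₀ V₀ τ : ℝ}

lemma Weight.abs_div_le (w : Weight g F φ gl B M₀ V₀) (hgl : 0 < gl) (x : Fin 2 → ℝ) :
    |φ x / g x| ≤ M₀ / gl := by
  have hM : 0 ≤ M₀ := (abs_nonneg _).trans (w.bound x)
  by_cases hx : φ x = 0
  · simp only [hx, zero_div, abs_zero]; positivity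
  · have h1 := (w.support x hx).1
    rw [abs_div, abs_of_pos (hgl.trans_le h1)]
    exact div_le_div₀ hM (w.bound x) hgl h1

lemma Weight.abs_mul_le (w : Weight g F φ gl B M₀ V₀) (hgl : 0 < gl) (hB : 0 ≤ B)
    (x : Fin 2 → ℝ) : |φ x / g x * F x| ≤ M₀ / gl * B := by
  have hM : 0 ≤ M₀ := (abs_nonneg _).trans (w.bound x)
  by_cases hx : φ x = 0
  · simp only [hx, zero_div, zero_mul, abs_zero]; positivity
  · rw [abs_mul]
    exact mul_le_mul (w.abs_div_le hgl x) (w.support x hx).2 (abs_nonneg _) (by positivity)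

lemma Weight.abs_obs_le (w : Weight g F φ gl B M₀ V₀) (hgl : 0 < gl) (hB : 0 ≤ B) (hτ : 0 ≤ τ)
    (z : (Fin 2 → ℝ) × ℝ) : |obs g F τ φ z| ≤ M₀ / gl * (B + τ) := by
  have hM : 0 ≤ M₀ := (abs_nonneg _).trans (w.bound z.1)
  rw [obs, mul_add, mul_add]
  refine (abs_add_le _ _).trans (add_le_add (w.abs_mul_le hgl hB _) ?_)
  rw [abs_mul]
  exact mul_le_mul (w.abs_div_le hgl _) (abs_trunc_le hτ _) (abs_nonneg _) (by positivity)

lemma Model.aemeasurable_div (h : Model g p F) (hφ : Measurable φ) :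
    AEMeasurable (fun x => φ x / g x) (designLaw g) :=
  hφ.aemeasurable.div h.g_aemeasurable

lemma Model.aemeasurable_obs (h : Model g p F) (hφ : Measurable φ) :
    AEMeasurable (obs g F τ φ) (jointLaw g p F) := by
  have hg : AEMeasurable (fun z : (Fin 2 → ℝ) × ℝ => φ z.1 / g z.1) (jointLaw g p F) := by
    have h1 : AEMeasurable g (volume : Measure (Fin 2 → ℝ)) :=
      (integrable_of_integral_eq_one h.g_one).aestronglyMeasurable.aemeasurable
    have h2 : AEMeasurable (fun z : (Fin 2 → ℝ) × ℝ => g z.1) volume :=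
      h1.comp_quasiMeasurePreserving Measure.quasiMeasurePreserving_fst
    exact (hφ.comp measurable_fst).aemeasurable.div
      (h2.mono_ac (withDensity_absolutelyContinuous _ _))
  refine hg.mul (Measurable.aemeasurable ?_)
  have := h.F_meas
  have := measurable_trunc τ
  fun_prop

lemma Model.integral_obs (h : Model g p F) (w : Weight g F φ gl B M₀ V₀) (hgl : 0 < gl)
    (hB : 0 ≤ B) (hτ : 0 ≤ τ) :
    ∫ z, obs g F τ φ z ∂jointLaw g p F = ∫ x, φ x * F x := by
  have := h.design_prob
  have := h.noise_prob
  have ha : AEStronglyMeasurable (fun x => φ x / g x) (designLaw g) :=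
    (h.aemeasurable_div w.meas).aestronglyMeasurable
  have ht : AEStronglyMeasurable (trunc τ) (noiseLaw p) :=
    (measurable_trunc τ).aestronglyMeasurable
  have hai : Integrable (fun x => φ x / g x) (designLaw g) :=
    Integrable.of_bound ha _ (Filter.Eventually.of_forall (w.abs_div_le hgl))
  have hti : Integrable (trunc τ) (noiseLaw p) :=
    Integrable.of_bound ht _ (Filter.Eventually.of_forall (abs_trunc_le hτ))
  have haF : Integrable (fun x => φ x / g x * F x) (designLaw g) :=
    Integrable.of_bound (ha.mul h.F_meas.aestronglyMeasurable) _
      (Filter.Eventually.of_forall (w.abs_mul_le hgl hB))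
  rw [h.integral_joint]
  have e1 : ∀ z : (Fin 2 → ℝ) × ℝ, obs g F τ φ (z.1, F z.1 + z.2)
      = φ z.1 / g z.1 * F z.1 * 1 + φ z.1 / g z.1 * trunc τ z.2 := by
    intro z; simp only [obs, add_sub_cancel_left]; ring
  simp only [e1]
  rw [integral_add (haF.mul_prod (integrable_const (1 : ℝ))) (hai.mul_prod hti),
    integral_prod_mul (fun x => φ x / g x * F x) (fun _ : ℝ => (1 : ℝ)),
    integral_prod_mul (fun x => φ x / g x) (trunc τ), h.integral_trunc, mul_zero, add_zero,
    h.integral_design]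
  simp only [integral_const, probReal_univ, smul_eq_mul, mul_one]
  congr 1
  funext x
  by_cases hx : φ x = 0
  · simp [hx]
  · have : g x ≠ 0 := (hgl.trans_le (w.support x hx).1).ne'
    field_simp

lemma Model.integral_obs_sq (h : Model g p F) (w : Weight g F φ gl B M₀ V₀) (hgl : 0 < gl)
    (hB : 0 ≤ B) (hτ : 0 ≤ τ) {S : ℝ} (hS : ∫ e, trunc τ e ^ 2 ∂noiseLaw p ≤ S) :
    ∫ z, obs g F τ φ z ^ 2 ∂jointLaw g p F ≤ V₀ / gl * (B ^ 2 + S) := by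
  have := h.design_prob
  have := h.noise_prob
  have hS0 : 0 ≤ S := (integral_nonneg fun _ => sq_nonneg _).trans hS
  have ha : AEStronglyMeasurable (fun x => φ x / g x) (designLaw g) :=
    (h.aemeasurable_div w.meas).aestronglyMeasurable
  have hM : 0 ≤ M₀ := (abs_nonneg _).trans (w.bound 0)
  have ht : AEStronglyMeasurable (trunc τ) (noiseLaw p) :=
    (measurable_trunc τ).aestronglyMeasurable
  have hai : Integrable (fun x => (φ x / g x) ^ 2) (designLaw g) :=
    Integrable.of_bound (ha.pow 2) ((M₀ / gl) ^ 2) (Filter.Eventually.of_forall fun x => by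
      rw [Real.norm_eq_abs, abs_pow]
      exact pow_le_pow_left₀ (abs_nonneg _) (w.abs_div_le hgl x) 2)
  have hti : Integrable (trunc τ) (noiseLaw p) :=
    Integrable.of_bound ht _ (Filter.Eventually.of_forall (abs_trunc_le hτ))
  have hti2 : Integrable (fun e => trunc τ e ^ 2) (noiseLaw p) :=
    Integrable.of_bound (ht.pow 2) (τ ^ 2) (Filter.Eventually.of_forall fun x => by
      rw [Real.norm_eq_abs, abs_pow]
      exact pow_le_pow_left₀ (abs_nonneg _) (abs_trunc_le hτ x) 2)
  have haF2 : Integrable (fun x => (φ x / g x * F x) ^ 2) (designLaw g) :=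
    Integrable.of_bound ((ha.mul h.F_meas.aestronglyMeasurable).pow 2) ((M₀ / gl * B) ^ 2)
      (Filter.Eventually.of_forall fun x => by
        rw [Real.norm_eq_abs, abs_pow]
        exact pow_le_pow_left₀ (abs_nonneg _) (w.abs_mul_le hgl hB x) 2)
  have haF : Integrable (fun x => φ x / g x * (φ x / g x * F x)) (designLaw g) :=
    Integrable.of_bound (ha.mul (ha.mul h.F_meas.aestronglyMeasurable)) (M₀ / gl * (M₀ / gl * B))
      (Filter.Eventually.of_forall fun x => by
        rw [Real.norm_eq_abs, abs_mul]
        exact mul_le_mul (w.abs_div_le hgl x) (w.abs_mul_le hgl hB x) (abs_nonneg _)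
          (by positivity))
  rw [h.integral_joint]
  have e1 : ∀ z : (Fin 2 → ℝ) × ℝ, obs g F τ φ (z.1, F z.1 + z.2) ^ 2
      = (φ z.1 / g z.1 * F z.1) ^ 2 * 1
        + 2 * ((φ z.1 / g z.1 * (φ z.1 / g z.1 * F z.1)) * trunc τ z.2)
        + (φ z.1 / g z.1) ^ 2 * trunc τ z.2 ^ 2 := by
    intro z; simp only [obs, add_sub_cancel_left]; ring
  simp only [e1]
  have i1 := haF2.mul_prod (ν := noiseLaw p) (integrable_const (1 : ℝ))
  have i2 := (haF.mul_prod hti).const_mul 2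
  have i3 : Integrable (fun z : (Fin 2 → ℝ) × ℝ => (φ z.1 / g z.1 * F z.1) ^ 2 * 1
      + 2 * ((φ z.1 / g z.1 * (φ z.1 / g z.1 * F z.1)) * trunc τ z.2))
      ((designLaw g).prod (noiseLaw p)) := i1.add i2
  rw [integral_add i3 (hai.mul_prod hti2), integral_add i1 i2, integral_const_mul,
    integral_prod_mul (fun x => (φ x / g x * F x) ^ 2) (fun _ : ℝ => (1 : ℝ)),
    integral_prod_mul (fun x => φ x / g x * (φ x / g x * F x)) (trunc τ), h.integral_trunc,
    integral_prod_mul (fun x => (φ x / g x) ^ 2) (fun e => trunc τ e ^ 2)]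
  simp only [integral_const, probReal_univ, smul_eq_mul, mul_one, mul_zero, add_zero]
  have hA : ∫ x, (φ x / g x) ^ 2 ∂designLaw g ≤ V₀ / gl := by
    rw [h.integral_design]
    calc ∫ x, g x * (φ x / g x) ^ 2 ≤ ∫ x, gl⁻¹ * φ x ^ 2 := by
          refine integral_mono_of_nonneg
            (Filter.Eventually.of_forall fun x => mul_nonneg (h.g_nonneg x) (sq_nonneg _))
            (w.integrable_sq.const_mul _) (Filter.Eventually.of_forall fun x => ?_)
          by_cases hx : φ x = 0
          · simp [hx]
          · have h1 := (w.support x hx).1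
            have h2 := hgl.trans_le h1
            have : g x * (φ x / g x) ^ 2 = (g x)⁻¹ * φ x ^ 2 := by field_simp
            simp only [this]
            gcongr
      _ ≤ V₀ / gl := by
          rw [integral_const_mul, div_eq_inv_mul]
          exact mul_le_mul_of_nonneg_left w.integral_sq (by positivity)
  have hA0 : 0 ≤ ∫ x, (φ x / g x) ^ 2 ∂designLaw g := integral_nonneg fun _ => sq_nonneg _
  have hF2 : ∫ x, (φ x / g x * F x) ^ 2 ∂designLaw g
      ≤ (∫ x, (φ x / g x) ^ 2 ∂designLaw g) * B ^ 2 := by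
    rw [← integral_mul_const]
    refine integral_mono haF2 (hai.mul_const _) fun x => ?_
    by_cases hx : φ x = 0
    · simp [hx]
    · rw [mul_pow]
      have := (w.support x hx).2
      have : F x ^ 2 ≤ B ^ 2 := sq_le_sq' (by linarith [(abs_le.1 this).1]) (abs_le.1 this).2
      gcongr
  calc _ ≤ (∫ x, (φ x / g x) ^ 2 ∂designLaw g) * B ^ 2
        + (∫ x, (φ x / g x) ^ 2 ∂designLaw g) * S := by gcongr
    _ = (∫ x, (φ x / g x) ^ 2 ∂designLaw g) * (B ^ 2 + S) := by ring
    _ ≤ _ := by gcongr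

section Deviation

variable {g : (Fin 2 → ℝ) → ℝ} {p : ℝ → ℝ} {F : (Fin 2 → ℝ) → ℝ} {gl B M₀ V₀ τ : ℝ}

lemma abs_obs_sub_le {φ ψ : (Fin 2 → ℝ) → ℝ} (hφ : Weight g F φ gl B M₀ V₀)
    (hψ : Weight g F ψ gl B M₀ V₀) (hgl : 0 < gl) (hB : 0 ≤ B) (hτ : 0 ≤ τ) {D : ℝ}
    (hD : ∀ x, |φ x - ψ x| ≤ D) (z : (Fin 2 → ℝ) × ℝ) :
    |obs g F τ φ z - obs g F τ ψ z| ≤ D / gl * (B + τ) := by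
  have hD0 : 0 ≤ D := (abs_nonneg _).trans (hD 0)
  have e : obs g F τ φ z - obs g F τ ψ z
      = (φ z.1 - ψ z.1) / g z.1 * (F z.1 + trunc τ (z.2 - F z.1)) := by
    simp only [obs]; ring
  rw [e]
  by_cases hz : φ z.1 = 0 ∧ ψ z.1 = 0
  · simp only [hz.1, hz.2, sub_zero, zero_div, zero_mul, abs_zero]; positivity
  · have h1 : gl ≤ g z.1 ∧ |F z.1| ≤ B := by
      by_cases h : φ z.1 = 0
      · exact hψ.support _ fun h' => hz ⟨h, h'⟩
      · exact hφ.support _ h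
    rw [abs_mul, abs_div, abs_of_pos (hgl.trans_le h1.1)]
    refine mul_le_mul (div_le_div₀ hD0 (hD _) hgl h1.1)
      ((abs_add_le _ _).trans (add_le_add h1.2 (abs_trunc_le hτ _))) (abs_nonneg _)
      (by positivity)

/-- Uniform deviation of the weighted means of truncated observations over a family of weights
indexed by a bounded planar set. -/
lemma Model.uniform_deviation (h : Model g p F) {S : Set (Fin 2 → ℝ)}
    {φ : (Fin 2 → ℝ) → (Fin 2 → ℝ) → ℝ} {R δ D Sg c : ℝ} {n : ℕ} (hn : 0 < n)
    (hR : 0 ≤ R) (hδ : 0 < δ) (hc : 0 < c) (hS : ∀ w ∈ S, ∀ i, |w i| ≤ R)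
    (hw : ∀ w ∈ S, Weight g F (φ w) gl B M₀ V₀) (hgl : 0 < gl) (hB : 0 ≤ B) (hτ : 0 < τ)
    (hM : 0 < M₀)
    (hlip : ∀ w ∈ S, ∀ w' ∈ S, (∀ i, |w i - w' i| ≤ δ) → ∀ x, |φ w x - φ w' x| ≤ D)
    (hSg : ∫ e, trunc τ e ^ 2 ∂noiseLaw p ≤ Sg) :
    (Measure.pi fun _ : Fin n => jointLaw g p F) {d | ∀ w ∈ S,
      |(n : ℝ)⁻¹ * ∑ i, obs g F τ (φ w) (d i) - ∫ x, φ w x * F x|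
        ≤ 2 * √(V₀ / gl * (B ^ 2 + Sg) * c / n) + M₀ / gl * (B + τ) * c / n
          + 2 * (D / gl * (B + τ))}ᶜ
      ≤ ENNReal.ofReal ((2 * R / δ + 2) ^ 2 * (2 * exp (-c))) := by
  have hprob := h.joint_prob
  have hn' : (0 : ℝ) < n := by exact_mod_cast hn
  obtain ⟨T, hTS, hTc, hTn⟩ := exists_finset_net S hR hδ hS
  set lev := 2 * √(V₀ / gl * (B ^ 2 + Sg) * c / n) + M₀ / gl * (B + τ) * c / n with hlev
  let bad : (Fin 2 → ℝ) → Set (Fin n → (Fin 2 → ℝ) × ℝ) := fun w =>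
    {d | lev ≤ |(n : ℝ)⁻¹ * ∑ i, obs g F τ (φ w) (d i) - ∫ z, obs g F τ (φ w) z ∂jointLaw g p F|}
  have hbad : ∀ w ∈ T, (Measure.pi fun _ : Fin n => jointLaw g p F) (bad w)
      ≤ ENNReal.ofReal (2 * exp (-c)) := by
    intro w hwT
    have W := hw w (hTS w hwT)
    exact bernstein_pi (jointLaw g p F) (h.aemeasurable_obs W.meas) hn (by positivity) hc
      (W.abs_obs_le hgl hB hτ.le) (h.integral_obs_sq W hgl hB hτ.le hSg)
  have hsub : {d | ∀ w ∈ S,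
      |(n : ℝ)⁻¹ * ∑ i, obs g F τ (φ w) (d i) - ∫ x, φ w x * F x|
        ≤ lev + 2 * (D / gl * (B + τ))}ᶜ ⊆ ⋃ w ∈ T, bad w := by
    intro d hd
    by_contra hcon
    simp only [Set.mem_iUnion, not_exists] at hcon
    refine hd fun w hwS => ?_
    obtain ⟨w', hw'T, hww'⟩ := hTn w hwS
    have hw'S := hTS w' hw'T
    have hgood : |(n : ℝ)⁻¹ * ∑ i, obs g F τ (φ w') (d i)
        - ∫ z, obs g F τ (φ w') z ∂jointLaw g p F| < lev := not_le.1 (hcon w' hw'T)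
    have hdiff := abs_obs_sub_le (hw w hwS) (hw w' hw'S) hgl hB hτ.le
      (hlip w hwS w' hw'S hww')
    have W := hw w hwS
    have W' := hw w' hw'S
    have h_integrable : ∀ {ψ}, Weight g F ψ gl B M₀ V₀ → Integrable (obs g F τ ψ) (jointLaw g p F) :=
      fun Wψ => Integrable.of_bound (h.aemeasurable_obs Wψ.meas).aestronglyMeasurable _
        (Filter.Eventually.of_forall (Wψ.abs_obs_le hgl hB hτ.le))
    have hi : |∫ z, obs g F τ (φ w) z ∂jointLaw g p F - ∫ z, obs g F τ (φ w') z ∂jointLaw g p F|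
        ≤ D / gl * (B + τ) := by
      rw [← integral_sub (h_integrable W) (h_integrable W')]
      have := norm_integral_le_of_norm_le_const (μ := jointLaw g p F)
        (f := fun z => obs g F τ (φ w) z - obs g F τ (φ w') z)
        (Filter.Eventually.of_forall hdiff)
      simpa using this
    have hs : |(n : ℝ)⁻¹ * ∑ i, obs g F τ (φ w) (d i) - (n : ℝ)⁻¹ * ∑ i, obs g F τ (φ w') (d i)|
        ≤ D / gl * (B + τ) := by
      rw [← mul_sub, ← Finset.sum_sub_distrib, abs_mul, abs_of_pos (inv_pos.2 hn'),
        inv_mul_le_iff₀ hn']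
      refine (Finset.abs_sum_le_sum_abs _ _).trans ((Finset.sum_le_sum fun i _ =>
        hdiff (d i)).trans ?_)
      simp
    rw [← h.integral_obs W hgl hB hτ.le]
    rw [abs_le] at *
    have := (abs_lt.1 hgood)
    constructor <;> linarith [this.1, this.2, hi.1, hi.2, hs.1, hs.2]
  calc _ ≤ _ := measure_mono hsub
    _ ≤ ∑ w ∈ T, (Measure.pi fun _ : Fin n => jointLaw g p F) (bad w) :=
        measure_biUnion_finset_le _ _
    _ ≤ ∑ _w ∈ T, ENNReal.ofReal (2 * exp (-c)) := Finset.sum_le_sum hbad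
    _ = ENNReal.ofReal (T.card * (2 * exp (-c))) := by
        rw [Finset.sum_const, nsmul_eq_mul, ENNReal.ofReal_mul (p := (T.card : ℝ)) (by positivity),
          ENNReal.ofReal_natCast]
    _ ≤ _ := by
        apply ENNReal.ofReal_le_ofReal
        gcongr

lemma noiseLaw_tail {Υ Ωc ω : ℝ} (hp : p ∈ NoiseClass Υ Ωc ω) {x : ℝ} (hx : 0 ≤ x) :
    noiseLaw p {e | x ≤ |e|} ≤ ENNReal.ofReal (2 * (Υ * exp (-Ωc * x ^ ω))) := by
  obtain ⟨h0, h1, hs, ht⟩ := hp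
  have hpi : Integrable p := integrable_of_integral_eq_one h1
  have hIci : noiseLaw p (Set.Ici x) ≤ ENNReal.ofReal (Υ * exp (-Ωc * x ^ ω)) := by
    rw [noiseLaw, withDensity_apply _ measurableSet_Ici,
      ← ofReal_integral_eq_lintegral_ofReal hpi.integrableOn (Filter.Eventually.of_forall h0)]
    exact ENNReal.ofReal_le_ofReal (ht x hx)
  have hIic : noiseLaw p (Set.Iic (-x)) ≤ ENNReal.ofReal (Υ * exp (-Ωc * x ^ ω)) := by
    rw [noiseLaw, withDensity_apply _ measurableSet_Iic,
      ← ofReal_integral_eq_lintegral_ofReal hpi.integrableOn (Filter.Eventually.of_forall h0)]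
    have : ∫ e in Set.Iic (-x), p e = ∫ e in Set.Ioi x, p e := by
      rw [← integral_comp_neg_Ioi]
      simp only [hs]
    rw [this, ← integral_Ici_eq_integral_Ioi]
    exact ENNReal.ofReal_le_ofReal (ht x hx)
  have hsub : {e : ℝ | x ≤ |e|} ⊆ Set.Ici x ∪ Set.Iic (-x) := by
    intro e he
    have he' : x ≤ |e| := he
    rcases le_abs.1 he' with h | h
    · exact Or.inl h
    · exact Or.inr (Set.mem_Iic.2 (by linarith))
  have hpos : 0 ≤ Υ * exp (-Ωc * x ^ ω) :=
    (integral_nonneg fun e => h0 e).trans (ht x hx)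
  calc _ ≤ _ := measure_mono hsub
    _ ≤ _ := measure_union_le _ _
    _ ≤ _ := add_le_add hIci hIic
    _ = _ := by rw [← ENNReal.ofReal_add hpos hpos, two_mul]

lemma exists_noise_moment {Υ Ωc ω q : ℝ} (hΥ : 0 < Υ) (hΩ : 0 < Ωc) (hω : 0 < ω) (hq : 0 < q) :
    ∃ C : ℝ, 0 ≤ C ∧ ∀ p ∈ NoiseClass Υ Ωc ω,
      ∫⁻ e, ENNReal.ofReal (|e| ^ q) ∂noiseLaw p ≤ ENNReal.ofReal C := by
  have hI : IntegrableOn (fun x : ℝ => x ^ (q - 1) * exp (-Ωc * x ^ ω)) (Set.Ioi 0) :=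
    integrableOn_rpow_mul_exp_neg_mul_rpow (by linarith) hω hΩ
  have hnn : 0 ≤ ∫ x in Set.Ioi (0 : ℝ), 2 * Υ * (x ^ (q - 1) * exp (-Ωc * x ^ ω)) :=
    setIntegral_nonneg measurableSet_Ioi fun x hx => by
      have := rpow_nonneg (le_of_lt hx) (q - 1)
      positivity
  refine ⟨q * ∫ x in Set.Ioi (0 : ℝ), 2 * Υ * (x ^ (q - 1) * exp (-Ωc * x ^ ω)),
    mul_nonneg hq.le hnn, fun p hp => ?_⟩
  rw [lintegral_rpow_eq_lintegral_meas_lt_mul _ (Filter.Eventually.of_forall fun e => abs_nonneg e)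
    measurable_norm.aemeasurable hq, ENNReal.ofReal_mul hq.le]
  gcongr
  rw [ofReal_integral_eq_lintegral_ofReal (hI.const_mul _)]
  · refine setLIntegral_mono' measurableSet_Ioi fun x hx => ?_
    have hx' : (0 : ℝ) ≤ x := le_of_lt hx
    calc _ ≤ ENNReal.ofReal (2 * (Υ * exp (-Ωc * x ^ ω))) * ENNReal.ofReal (x ^ (q - 1)) := by
          gcongr
          refine (measure_mono ?_).trans (noiseLaw_tail hp hx')
          intro e he
          have he' : x < |e| := he
          exact he'.le
      _ = _ := by
          rw [← ENNReal.ofReal_mul (by positivity)]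
          ring_nf
  · filter_upwards [ae_restrict_mem measurableSet_Ioi] with x hx
    have := rpow_nonneg (le_of_lt hx) (q - 1)
    simp only [Pi.zero_apply]
    positivity

lemma Model.joint_noise_exceed (h : Model g p F) {Υ Ωc ω : ℝ} (hp : p ∈ NoiseClass Υ Ωc ω)
    (hτ : 0 ≤ τ) (n : ℕ) :
    (Measure.pi fun _ : Fin n => jointLaw g p F)
      {d | ∀ i, |(d i).2 - F (d i).1| ≤ τ}ᶜ
      ≤ ENNReal.ofReal (n * (2 * (Υ * exp (-Ωc * τ ^ ω)))) := by
  have hprob := h.joint_prob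
  have := h.design_prob
  have := h.noise_prob
  let A : Set ((Fin 2 → ℝ) × ℝ) := {z | τ < |z.2 - F z.1|}
  have hA : MeasurableSet A := by
    have := h.F_meas
    have hm : Measurable fun z : (Fin 2 → ℝ) × ℝ => z.2 - F z.1 := by fun_prop
    exact measurableSet_lt measurable_const hm.abs
  have hA1 : jointLaw g p F A ≤ ENNReal.ofReal (2 * (Υ * exp (-Ωc * τ ^ ω))) := by
    rw [h.joint_eq, MeasurableEquiv.map_apply]
    have hsub : (shear F h.F_meas) ⁻¹' A ⊆ Set.univ ×ˢ {e | τ ≤ |e|} := by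
      intro z hz
      have : τ < |(F z.1 + z.2) - F z.1| := hz
      rw [add_sub_cancel_left] at this
      exact ⟨trivial, this.le⟩
    refine (measure_mono hsub).trans ?_
    rw [Measure.prod_prod, measure_univ, one_mul]
    exact noiseLaw_tail hp hτ
  have hsub : {d : Fin n → (Fin 2 → ℝ) × ℝ | ∀ i, |(d i).2 - F (d i).1| ≤ τ}ᶜ
      ⊆ ⋃ i ∈ (Finset.univ : Finset (Fin n)), (fun d => d i) ⁻¹' A := by
    intro d hd
    simp only [Set.mem_compl_iff, Set.mem_ofPred_eq, not_forall, not_le] at hd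
    obtain ⟨i, hi⟩ := hd
    simp only [Set.mem_iUnion]
    exact ⟨i, Finset.mem_univ _, hi⟩
  calc _ ≤ _ := measure_mono hsub
    _ ≤ _ := measure_biUnion_finset_le _ _
    _ ≤ ∑ _i : Fin n, ENNReal.ofReal (2 * (Υ * exp (-Ωc * τ ^ ω))) := by
        refine Finset.sum_le_sum fun i _ => ?_
        rw [(measurePreserving_eval (fun _ : Fin n => jointLaw g p F) i).measure_preimage
          hA.nullMeasurableSet]
        exact hA1
    _ = _ := by
        rw [Finset.sum_const, nsmul_eq_mul, Finset.card_univ, Fintype.card_fin,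
          ENNReal.ofReal_mul (p := (n : ℝ)) (by positivity), ENNReal.ofReal_natCast]

lemma Model.joint_moment (h : Model g p F) {L q C : ℝ} (hL : 0 ≤ L) (hq : 0 < q) (hC : 0 ≤ C)
    (hF : ∀ x, |F x| ≤ L)
    (hp : ∫⁻ e, ENNReal.ofReal (|e| ^ q) ∂noiseLaw p ≤ ENNReal.ofReal C) :
    ∫⁻ z, ENNReal.ofReal (|z.2| ^ q) ∂jointLaw g p F ≤ ENNReal.ofReal (2 ^ q * (L ^ q + C)) := by
  have := h.design_prob
  have := h.noise_prob
  rw [h.lintegral_joint]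
  have hpt : ∀ z : (Fin 2 → ℝ) × ℝ, ENNReal.ofReal (|F z.1 + z.2| ^ q)
      ≤ ENNReal.ofReal (2 ^ q * L ^ q) + ENNReal.ofReal (2 ^ q) * ENNReal.ofReal (|z.2| ^ q) := by
    intro z
    rw [← ENNReal.ofReal_mul (by positivity), ← ENNReal.ofReal_add (by positivity) (by positivity)]
    apply ENNReal.ofReal_le_ofReal
    rw [← mul_rpow zero_le_two hL, ← mul_rpow zero_le_two (abs_nonneg _)]
    have h1 : |F z.1 + z.2| ≤ L + |z.2| := (abs_add_le _ _).trans (by gcongr; exact hF _)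
    rcases le_total L |z.2| with h2 | h2
    · calc |F z.1 + z.2| ^ q ≤ (2 * |z.2|) ^ q := by gcongr; linarith
        _ ≤ _ := by have : 0 ≤ (2 * L) ^ q := by positivity
                    linarith
    · calc |F z.1 + z.2| ^ q ≤ (2 * L) ^ q := by gcongr; linarith
        _ ≤ _ := by have : 0 ≤ (2 * |z.2|) ^ q := by positivity
                    linarith
  refine (lintegral_mono hpt).trans ?_
  have hm : Measurable fun e : ℝ => ENNReal.ofReal (|e| ^ q) :=
    (measurable_norm.pow_const q).ennreal_ofReal
  rw [lintegral_add_left measurable_const, lintegral_const, measure_univ, mul_one,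
    lintegral_const_mul (ENNReal.ofReal (2 ^ q)) (f := fun z : (Fin 2 → ℝ) × ℝ =>
      ENNReal.ofReal (|z.2| ^ q)) (hm.comp measurable_snd)]
  have h2 : ∫⁻ z : (Fin 2 → ℝ) × ℝ, ENNReal.ofReal (|z.2| ^ q) ∂(designLaw g).prod (noiseLaw p)
      = ∫⁻ e, ENNReal.ofReal (|e| ^ q) ∂noiseLaw p := by
    rw [lintegral_prod (fun z : (Fin 2 → ℝ) × ℝ => ENNReal.ofReal (|z.2| ^ q))
      (hm.comp measurable_snd).aemeasurable]
    simp
  rw [h2, mul_add, ENNReal.ofReal_add (by positivity) (by positivity),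
    ENNReal.ofReal_mul (q := C) (by positivity)]
  gcongr

end Deviation

/-- Taylor expansion with Hölder remainder. -/
lemma exists_taylor_coeff {m : ℕ} {α L : ℝ} (hα : 0 ≤ α) (hL : 0 ≤ L) {f : ℝ → ℝ}
    (hf : ContDiff ℝ m f)
    (hh : ∀ u v, |iteratedDeriv m f u - iteratedDeriv m f v| ≤ L * |u - v| ^ α) (y : ℝ) :
    ∃ c : ℕ → ℝ, ∀ x, |f (y + x) - f y - ∑ j ∈ Finset.range m, c j * x ^ (j + 1)|
      ≤ L * |x| ^ (m + α) := by
  induction m generalizing f with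
  | zero =>
    refine ⟨0, fun x => ?_⟩
    simpa using hh (y + x) y
  | succ m ih =>
    have hd : Differentiable ℝ f := hf.differentiable (by simp)
    have hf' : ContDiff ℝ m (deriv f) := by
      have : ContDiff ℝ ((m : WithTop ℕ∞) + 1) f := by exact_mod_cast hf
      exact (contDiff_succ_iff_deriv.1 this).2.2
    obtain ⟨c, hc⟩ := ih hf' (by simpa only [iteratedDeriv_succ'] using hh)
    let c' : ℕ → ℝ := fun j => if j = 0 then deriv f y else c (j - 1) / (j + 1)
    refine ⟨c', fun x => ?_⟩
    let G : ℝ → ℝ := fun x => f (y + x) - f y - ∑ j ∈ Finset.range (m + 1), c' j * x ^ (j + 1)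
    have hG : ∀ z, HasDerivAt G
        (deriv f (y + z) - deriv f y - ∑ j ∈ Finset.range m, c j * z ^ (j + 1)) z := by
      intro z
      have h1 : HasDerivAt (fun x => f (y + x)) (deriv f (y + z)) z := by
        have := (hd (y + z)).hasDerivAt.comp_const_add y z
        exact this
      have h2 : HasDerivAt (fun x : ℝ => ∑ j ∈ Finset.range (m + 1), c' j * x ^ (j + 1))
          (∑ j ∈ Finset.range (m + 1), c' j * ((j + 1 : ℕ) * z ^ j)) z := by
        refine HasDerivAt.fun_sum fun j _ => ?_
        have := (hasDerivAt_pow (j + 1) z).const_mul (c' j)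
        simpa using this
      have h3 : HasDerivAt G _ z := (h1.sub_const (f y)).sub h2
      refine h3.congr_deriv ?_
      rw [Finset.sum_range_succ']
      have : ∀ j, c' (j + 1) * (((j + 1 + 1 : ℕ) : ℝ) * z ^ (j + 1)) = c j * z ^ (j + 1) := by
        intro j
        have : (j : ℝ) + 1 + 1 ≠ 0 := by positivity
        simp only [c', Nat.succ_ne_zero, if_false, Nat.add_sub_cancel]
        push_cast
        field_simp
      simp only [this]
      simp [c']
      ring
    have hG0 : G 0 = 0 := by simp [G]
    have hb : ∀ z ∈ segment ℝ 0 x, ‖deriv f (y + z) - deriv f y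
        - ∑ j ∈ Finset.range m, c j * z ^ (j + 1)‖ ≤ L * |x| ^ (m + α) := by
      intro z hz
      refine (hc z).trans (mul_le_mul_of_nonneg_left
        (rpow_le_rpow (abs_nonneg _) ?_ (by positivity)) hL)
      rw [segment_eq_uIcc] at hz
      have := Set.abs_sub_left_of_mem_uIcc hz
      simpa using this
    have := Convex.norm_image_sub_le_of_norm_hasDerivWithin_le
      (fun z _ => (hG z).hasDerivWithinAt) hb (convex_segment 0 x) (left_mem_segment ℝ 0 x)
      (right_mem_segment ℝ 0 x)
    rw [hG0, sub_zero, sub_zero] at this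
    refine (show |G x| ≤ _ from this).trans (le_of_eq ?_)
    rw [Real.norm_eq_abs, mul_assoc]
    congr 1
    by_cases hx : |x| = 0
    · rw [hx, mul_zero, zero_rpow]
      positivity
    · have : 0 < |x| := lt_of_le_of_ne (abs_nonneg _) (Ne.symm hx)
      rw [← rpow_add_one this.ne']
      congr 1
      push_cast
      ring

lemma mInt_lt {β : ℝ} (hβ : 0 < β) : (mInt β : ℝ) < β := by
  have h := Nat.ceil_lt_add_one hβ.le
  have h1 : 1 ≤ ⌈β⌉₊ := Nat.one_le_ceil_iff.2 hβ
  rw [mInt, Nat.cast_sub h1]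
  push_cast
  linarith

lemma mInt_mono {β b : ℝ} (h : β ≤ b) : mInt β ≤ mInt b :=
  Nat.sub_le_sub_right (Nat.ceil_mono h) 1

lemma HolderClass.exists_coeff {β L : ℝ} (hβ : 0 < β) (hL : 0 < L) {f : ℝ → ℝ}
    (hf : f ∈ HolderClass β L) (y : ℝ) :
    ∃ c : ℕ → ℝ, ∀ x, |f (y + x) - f y - ∑ j ∈ Finset.range (mInt β), c j * x ^ (j + 1)|
      ≤ L * |x| ^ β := by
  obtain ⟨h1, h2, h3⟩ := hf
  have hm := mInt_lt hβ
  have := exists_taylor_coeff (α := β - mInt β) (by linarith) hL.le h1 (fun u v => ?_) y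
  · simpa using this
  · rcases lt_trichotomy u v with h | h | h
    · have := h3 u (v - u) (by linarith)
      rw [abs_sub_comm u v, abs_of_pos (sub_pos.2 h), abs_sub_comm]
      simpa using this
    · subst h
      simp only [sub_self, abs_zero]
      positivity
    · have := h3 v (u - v) (by linarith)
      rw [abs_of_pos (sub_pos.2 h)]
      simpa using this

lemma HolderClass.abs_le {β L : ℝ} {f : ℝ → ℝ} (hf : f ∈ HolderClass β L) (y : ℝ) :
    |f y| ≤ L := by
  simpa using hf.2.1 0 (Nat.zero_le _) y

lemma HolderClass.continuous {β L : ℝ} {f : ℝ → ℝ} (hf : f ∈ HolderClass β L) : Continuous f :=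
  hf.1.continuous

namespace KernelHyp

variable {K : ℝ → ℝ} {Q : ℝ}

lemma Q_nonneg (hK : KernelHyp K Q) : 0 ≤ Q := by
  have := (abs_nonneg _).trans (hK.lip 1 0)
  simpa using this

lemma continuous (hK : KernelHyp K Q) : Continuous K := by
  have : LipschitzWith Q.toNNReal K := LipschitzWith.of_dist_le_mul fun u v => by
    rw [Real.dist_eq, Real.dist_eq, Real.coe_toNNReal _ hK.Q_nonneg]
    exact hK.lip u v
  exact this.continuous

lemma hasCompactSupport (hK : KernelHyp K Q) : HasCompactSupport K :=
  HasCompactSupport.intro isCompact_Icc hK.supp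

lemma integrable (hK : KernelHyp K Q) : Integrable K :=
  hK.continuous.integrable_of_hasCompactSupport hK.hasCompactSupport

lemma exists_bound (hK : KernelHyp K Q) : ∃ C, ∀ u, ‖K u‖ ≤ C :=
  hK.hasCompactSupport.exists_bound_of_continuous hK.continuous

lemma bddAbove (hK : KernelHyp K Q) : BddAbove (Set.range fun u => |K u|) := by
  obtain ⟨C, hC⟩ := hK.exists_bound
  exact ⟨C, by rintro _ ⟨u, rfl⟩; exact hC u⟩

lemma abs_le_Ksup (hK : KernelHyp K Q) (u : ℝ) : |K u| ≤ Ksup K := le_ciSup hK.bddAbove u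

lemma one_le_K1 (hK : KernelHyp K Q) : 1 ≤ K1 K := by
  have := norm_integral_le_integral_norm K (μ := volume)
  rw [hK.norm_one] at this
  simpa [K1] using this

lemma K1_le_Ksup (hK : KernelHyp K Q) : K1 K ≤ Ksup K := by
  have h0 : 0 ≤ Ksup K := (abs_nonneg _).trans (hK.abs_le_Ksup 0)
  calc K1 K = ∫ u in Set.Icc (-(1/2) : ℝ) (1/2), |K u| := by
        rw [K1, setIntegral_eq_integral_of_forall_compl_eq_zero]
        intro u hu
        rw [hK.supp u hu, abs_zero]
    _ ≤ ∫ _u in Set.Icc (-(1/2) : ℝ) (1/2), Ksup K := by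
        refine setIntegral_mono hK.integrable.abs.integrableOn (by simp) fun u => hK.abs_le_Ksup u
    _ = Ksup K := by
        simp; norm_num

lemma one_le_Ksup (hK : KernelHyp K Q) : 1 ≤ Ksup K := hK.one_le_K1.trans hK.K1_le_Ksup

lemma Q_pos (hK : KernelHyp K Q) : 0 < Q := by
  refine lt_of_le_of_ne hK.Q_nonneg fun h => ?_
  have h1 : ∀ u, K u = 0 := fun u => by
    have := hK.lip u 1
    rw [← h, zero_mul, hK.supp 1 (by norm_num)] at this
    simpa using this
  have := hK.norm_one
  simp [h1] at this

lemma integrable_mul (hK : KernelHyp K Q) {f : ℝ → ℝ} (hf : Continuous f) :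
    Integrable fun u => K u * f u :=
  (hK.continuous.mul hf).integrable_of_hasCompactSupport hK.hasCompactSupport.mul_right

/-- The univariate bias bound. -/
lemma abs_bias_le (hK : KernelHyp K Q) {b β L : ℝ} (hmom : VanishingMoments K (mInt b))
    (hβ : 0 < β) (hβb : β ≤ b) (hL : 0 < L) {f : ℝ → ℝ} (hf : f ∈ HolderClass β L) (y a : ℝ) :
    |(∫ u, K u * f (y + a * u)) - f y| ≤ L * K1 K * |a| ^ β := by
  obtain ⟨c, hc⟩ := HolderClass.exists_coeff hβ hL hf y
  have hfc := HolderClass.continuous hf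
  have hpoly : ∫ u, K u * ∑ j ∈ Finset.range (mInt β), c j * (a * u) ^ (j + 1) = 0 := by
    simp only [Finset.mul_sum]
    rw [integral_finsetSum _ fun j _ => hK.integrable_mul (by fun_prop)]
    refine Finset.sum_eq_zero fun j hj => ?_
    have e : ∀ u, K u * (c j * (a * u) ^ (j + 1)) = (c j * a ^ (j + 1)) * (u ^ (j + 1) * K u) := by
      intro u; rw [mul_pow]; ring
    simp only [e, integral_const_mul]
    rw [hmom (j + 1) (by omega)
      ((Nat.succ_le_of_lt (Finset.mem_range.1 hj)).trans (mInt_mono hβb)), mul_zero]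
  have i1 : Integrable fun u => K u * f (y + a * u) :=
    hK.integrable_mul (f := fun u => f (y + a * u)) (by fun_prop)
  have i2 : Integrable fun u => K u * ∑ j ∈ Finset.range (mInt β), c j * (a * u) ^ (j + 1) :=
    hK.integrable_mul (by fun_prop)
  have i3 := hK.integrable.mul_const (f y)
  have e : (∫ u, K u * f (y + a * u)) - f y = ∫ u, K u * (f (y + a * u) - f y
      - ∑ j ∈ Finset.range (mInt β), c j * (a * u) ^ (j + 1)) := by
    simp only [mul_sub]
    have i12 : Integrable fun u => K u * f (y + a * u) - K u * f y := i1.sub i3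
    rw [integral_sub i12 i2, integral_sub i1 i3, hpoly, integral_mul_const, hK.norm_one]
    ring
  rw [e]
  calc _ ≤ ∫ u, |K u| * (L * |a| ^ β) := by
        rw [← Real.norm_eq_abs]
        refine norm_integral_le_of_norm_le (hK.integrable.abs.mul_const _)
          (Filter.Eventually.of_forall fun u => ?_)
        rw [Real.norm_eq_abs, abs_mul]
        by_cases hu : u ∈ Set.Icc (-(1/2) : ℝ) (1/2)
        · refine mul_le_mul_of_nonneg_left ((hc (a * u)).trans (mul_le_mul_of_nonneg_left
            (rpow_le_rpow (abs_nonneg _) ?_ hβ.le) hL.le)) (abs_nonneg _)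
          rw [abs_mul]
          have : |u| ≤ 1 := abs_le.2 ⟨by linarith [hu.1], by linarith [hu.2]⟩
          exact mul_le_of_le_one_right (abs_nonneg _) this
        · simp [hK.supp u hu]
    _ = _ := by rw [integral_mul_const, ← K1]; ring

end KernelHyp

lemma integral_det_mul_comp {E : Matrix (Fin 2) (Fin 2) ℝ} (hE : 0 < E.det) (t : Fin 2 → ℝ)
    {ψ : (Fin 2 → ℝ) → ℝ} (hψ : Continuous ψ) :
    ∫ x, E.det * ψ (E.mulVec (x - t)) = ∫ y, ψ y := by
  rw [integral_const_mul, integral_sub_right_eq_self (fun x => ψ (E.mulVec x)) t]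
  have h1 := Real.map_matrix_volume_pi_eq_smul_volume_pi hE.ne'
  have h2 : ∫ y, ψ y ∂(Measure.map (Matrix.toLin' E) volume) = ∫ x, ψ (E.mulVec x) := by
    rw [integral_map (LinearMap.continuous_on_pi _).aemeasurable hψ.aestronglyMeasurable]
    simp only [Matrix.toLin'_apply]
  rw [← h2, h1, integral_smul_measure, ENNReal.toReal_ofReal (abs_nonneg _), abs_inv,
    abs_of_pos hE, smul_eq_mul, mul_inv_cancel_left₀ hE.ne']

lemma integrable_comp_mulVec {E : Matrix (Fin 2) (Fin 2) ℝ} (hE : 0 < E.det) (t : Fin 2 → ℝ)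
    {ψ : (Fin 2 → ℝ) → ℝ} (hψ : Continuous ψ) (hi : Integrable ψ) :
    Integrable fun x => ψ (E.mulVec (x - t)) := by
  have h1 := Real.map_matrix_volume_pi_eq_smul_volume_pi hE.ne'
  have h2 : Integrable ψ (Measure.map (Matrix.toLin' E) volume) := by
    rw [h1]
    exact hi.smul_measure ENNReal.ofReal_ne_top
  rw [integrable_map_measure hψ.aestronglyMeasurable
    (LinearMap.continuous_on_pi _).aemeasurable] at h2
  have h3 : Integrable fun x => ψ (E.mulVec x) := by
    simpa only [Function.comp_def, Matrix.toLin'_apply] using h2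
  exact h3.comp_sub_right t

/-- The smoothing of `f` by `K ⊗ K` at `A` along the increments `a`, `b`. -/
def kmean (K f : ℝ → ℝ) (A a b : ℝ) : ℝ :=
  ∫ z : ℝ × ℝ, K z.1 * K z.2 * f (A + a * z.1 + b * z.2)

section Means

variable {K : ℝ → ℝ} {Q : ℝ}

lemma K2_continuous (hK : KernelHyp K Q) : Continuous (K2 K) := by
  have := hK.continuous
  unfold K2
  fun_prop

lemma integral_fin_two (ψ : ℝ → ℝ → ℝ) :
    ∫ y : Fin 2 → ℝ, ψ (y 0) (y 1) = ∫ z : ℝ × ℝ, ψ z.1 z.2 := by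
  rw [← (volume_preserving_finTwoArrow ℝ).integral_comp
    (MeasurableEquiv.finTwoArrow (α := ℝ)).measurableEmbedding]
  rfl

lemma integrable_fin_two {ψ : ℝ → ℝ → ℝ} (h : Integrable fun z : ℝ × ℝ => ψ z.1 z.2) :
    Integrable fun y : Fin 2 → ℝ => ψ (y 0) (y 1) :=
  ((volume_preserving_finTwoArrow ℝ).integrable_comp_emb
    (MeasurableEquiv.finTwoArrow (α := ℝ)).measurableEmbedding).2 h

lemma integral_weight_mul {E : Matrix (Fin 2) (Fin 2) ℝ} (hE : 0 < E.det) (t : Fin 2 → ℝ)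
    (hK : KernelHyp K Q) {f : ℝ → ℝ} (hf : Continuous f) {θ : Fin 2 → ℝ} {A a b : ℝ}
    (hx : ∀ x, dot2 x θ = A + a * E.mulVec (x - t) 0 + b * E.mulVec (x - t) 1) :
    ∫ x, E.det * K2 K (E.mulVec (x - t)) * f (dot2 x θ) = kmean K f A a b := by
  have hc := K2_continuous hK
  have := integral_det_mul_comp hE t (ψ := fun y => K2 K y * f (A + a * y 0 + b * y 1))
    (by fun_prop)
  simp only [← hx, ← mul_assoc] at this
  rw [this, kmean, ← integral_fin_two (fun u v => K u * K v * f (A + a * u + b * v))]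
  rfl

lemma integral_weight_sq {E : Matrix (Fin 2) (Fin 2) ℝ} (hE : 0 < E.det) (t : Fin 2 → ℝ)
    (hK : KernelHyp K Q) :
    Integrable (fun x => (E.det * K2 K (E.mulVec (x - t))) ^ 2) ∧
      ∫ x, (E.det * K2 K (E.mulVec (x - t))) ^ 2 ≤ E.det * Ksup K ^ 4 := by
  have hc := K2_continuous hK
  have hKK : Integrable fun u => K u * K u := hK.integrable_mul hK.continuous
  have hS0 : 0 ≤ Ksup K := zero_le_one.trans hK.one_le_Ksup
  have hKK0 : 0 ≤ ∫ u, K u * K u := integral_nonneg fun u => mul_self_nonneg _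
  have hKKb : ∫ u, K u * K u ≤ Ksup K ^ 2 := by
    calc ∫ u, K u * K u ≤ ∫ u, Ksup K * |K u| := by
          refine integral_mono hKK (hK.integrable.abs.const_mul _) fun u => ?_
          change K u * K u ≤ Ksup K * |K u|
          rw [← abs_mul_abs_self]
          exact mul_le_mul_of_nonneg_right (hK.abs_le_Ksup u) (abs_nonneg _)
      _ = Ksup K * K1 K := by rw [integral_const_mul, K1]
      _ ≤ _ := by
          rw [sq]
          exact mul_le_mul_of_nonneg_left hK.K1_le_Ksup hS0
  have e : ∀ x, (E.det * K2 K (E.mulVec (x - t))) ^ 2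
      = E.det * (E.det * (fun y => K2 K y ^ 2) (E.mulVec (x - t))) := fun x => by
    simp only; ring
  have h_integrable : Integrable fun y => K2 K y ^ 2 := by
    have := integrable_fin_two (ψ := fun u v => (K u * K u) * (K v * K v)) (hKK.mul_prod hKK)
    refine this.congr (Filter.Eventually.of_forall fun y => ?_)
    simp only [K2]; ring
  simp only [e]
  refine ⟨((integrable_comp_mulVec hE t (by fun_prop) h_integrable).const_mul _).const_mul _, ?_⟩
  rw [integral_const_mul, integral_det_mul_comp hE t (ψ := fun y => K2 K y ^ 2) (by fun_prop)]
  refine mul_le_mul_of_nonneg_left ?_ hE.le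
  have : ∫ y, K2 K y ^ 2 = (∫ u, K u * K u) * ∫ u, K u * K u := by
    rw [← integral_prod_mul (fun u => K u * K u) (fun u => K u * K u)]
    refine Eq.trans ?_ (integral_fin_two (fun u v => (K u * K u) * (K v * K v)))
    congr 1
    funext y
    simp only [K2]; ring
  rw [this]
  calc _ ≤ Ksup K ^ 2 * Ksup K ^ 2 := by gcongr
    _ = _ := by ring

variable {b β L : ℝ} {f : ℝ → ℝ}

lemma abs_kmean_sub_le (hK : KernelHyp K Q) (hmom : VanishingMoments K (mInt b))
    (hβ : 0 < β) (hβb : β ≤ b) (hL : 0 < L) (hf : f ∈ HolderClass β L) (A a c : ℝ) :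
    |kmean K f A a c - ∫ v, K v * f (A + c * v)| ≤ L * K1 K ^ 2 * |a| ^ β := by
  have hfc := HolderClass.continuous hf
  have hKc := hK.continuous
  have hi : Integrable fun z : ℝ × ℝ => K z.1 * K z.2 * f (A + a * z.1 + c * z.2) := by
    refine (hK.integrable.mul_prod hK.integrable).mul_bdd (c := L) ?_ ?_
    · exact Continuous.aestronglyMeasurable (by fun_prop)
    · exact Filter.Eventually.of_forall fun z => HolderClass.abs_le hf _
  have e1 : kmean K f A a c = ∫ v, ∫ u, K u * K v * f (A + a * u + c * v) :=
    integral_prod_symm _ hi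
  have hi2 : Integrable fun v => ∫ u, K u * K v * f (A + a * u + c * v) := hi.integral_prod_right
  have hi3 : Integrable fun v => K v * f (A + c * v) :=
    hK.integrable_mul (f := fun v => f (A + c * v)) (by fun_prop)
  rw [e1, ← integral_sub hi2 hi3]
  calc _ ≤ ∫ v, |K v| * (L * K1 K * |a| ^ β) := by
        rw [← Real.norm_eq_abs]
        refine norm_integral_le_of_norm_le (hK.integrable.abs.mul_const _)
          (Filter.Eventually.of_forall fun v => ?_)
        have e2 : ∫ u, K u * K v * f (A + a * u + c * v)
            = K v * ∫ u, K u * f (A + c * v + a * u) := by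
          rw [← integral_const_mul]
          congr 1
          funext u
          rw [add_right_comm]
          ring
        rw [e2, ← mul_sub, Real.norm_eq_abs, abs_mul]
        exact mul_le_mul_of_nonneg_left (hK.abs_bias_le hmom hβ hβb hL hf _ _) (abs_nonneg _)
    _ = _ := by rw [integral_mul_const, ← K1]; ring

lemma abs_kmean_sub_self_le (hK : KernelHyp K Q) (hmom : VanishingMoments K (mInt b))
    (hβ : 0 < β) (hβb : β ≤ b) (hL : 0 < L) (hf : f ∈ HolderClass β L) (A a c : ℝ) :
    |kmean K f A a c - f A| ≤ L * K1 K ^ 2 * |a| ^ β + L * K1 K * |c| ^ β := by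
  have h1 := abs_kmean_sub_le hK hmom hβ hβb hL hf A a c
  have h2 := hK.abs_bias_le hmom hβ hβb hL hf A c
  calc _ = |(kmean K f A a c - ∫ v, K v * f (A + c * v))
        + ((∫ v, K v * f (A + c * v)) - f A)| := by ring_nf
    _ ≤ _ := (abs_add_le _ _).trans (add_le_add h1 h2)

lemma abs_kmean_sub_kmean_le (hK : KernelHyp K Q) (hmom : VanishingMoments K (mInt b))
    (hβ : 0 < β) (hβb : β ≤ b) (hL : 0 < L) (hf : f ∈ HolderClass β L) (A a a' c : ℝ) :
    |kmean K f A a c - kmean K f A a' c|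
      ≤ L * K1 K ^ 2 * |a| ^ β + L * K1 K ^ 2 * |a'| ^ β := by
  have h1 := abs_kmean_sub_le hK hmom hβ hβb hL hf A a c
  have h2 := abs_kmean_sub_le hK hmom hβ hβb hL hf A a' c
  rw [abs_sub_comm] at h2
  calc _ = |(kmean K f A a c - ∫ v, K v * f (A + c * v))
        + ((∫ v, K v * f (A + c * v)) - kmean K f A a' c)| := by ring_nf
    _ ≤ _ := (abs_add_le _ _).trans (add_le_add h1 h2)

end Means

/-- The common form of the matrices of the family: the rows are `w / η` and the rotation of `w`
by a right angle. -/
def wmat (w : Fin 2 → ℝ) (η : ℝ) : Matrix (Fin 2) (Fin 2) ℝ :=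
  !![w 0 / η, w 1 / η; -w 1, w 0]

/-- The range of the vectors `w` for which `wmat w η` is needed. -/
def wset : Set (Fin 2 → ℝ) := {w | 1 / 4 ≤ w 0 ^ 2 + w 1 ^ 2 ∧ w 0 ^ 2 + w 1 ^ 2 ≤ 1}

/-- The weight generated by a matrix. -/
def mweight (K : ℝ → ℝ) (E : Matrix (Fin 2) (Fin 2) ℝ) (t x : Fin 2 → ℝ) : ℝ :=
  E.det * K2 K (E.mulVec (x - t))

section Weights

variable {K : ℝ → ℝ} {Q : ℝ}

lemma wmat_det (w : Fin 2 → ℝ) (η : ℝ) : (wmat w η).det = (w 0 ^ 2 + w 1 ^ 2) / η := by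
  rw [wmat, Matrix.det_fin_two_of]; ring

lemma wmat_mulVec_zero (w z : Fin 2 → ℝ) (η : ℝ) :
    (wmat w η).mulVec z 0 = (w 0 * z 0 + w 1 * z 1) / η := by
  simp [wmat, Matrix.mulVec, dotProduct, Fin.sum_univ_two]; ring

lemma wmat_mulVec_one (w z : Fin 2 → ℝ) (η : ℝ) :
    (wmat w η).mulVec z 1 = -w 1 * z 0 + w 0 * z 1 := by
  simp [wmat, Matrix.mulVec, dotProduct, Fin.sum_univ_two]

lemma wset_abs_le {w : Fin 2 → ℝ} (hw : w ∈ wset) (i : Fin 2) : |w i| ≤ 1 := by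
  obtain ⟨_, h⟩ := hw
  rw [← sq_le_one_iff_abs_le_one]
  fin_cases i
  · change w 0 ^ 2 ≤ 1
    nlinarith [sq_nonneg (w 1)]
  · change w 1 ^ 2 ≤ 1
    nlinarith [sq_nonneg (w 0)]

lemma S1_subset_wset : S1 ⊆ wset := by
  intro w hw
  have hw' : w 0 ^ 2 + w 1 ^ 2 = 1 := hw
  exact ⟨by linarith, hw'.le⟩

lemma KernelHyp.abs_le_half (hK : KernelHyp K Q) {u : ℝ} (hu : K u ≠ 0) : |u| ≤ 1 / 2 := by
  by_contra h
  exact hu (hK.supp u fun hu' => h (abs_le.2 ⟨by linarith [hu'.1], hu'.2⟩))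

lemma abs_K2_le (hK : KernelHyp K Q) (v : Fin 2 → ℝ) : |K2 K v| ≤ Ksup K ^ 2 := by
  rw [K2, abs_mul, sq]
  exact mul_le_mul (hK.abs_le_Ksup _) (hK.abs_le_Ksup _) (abs_nonneg _)
    (zero_le_one.trans hK.one_le_Ksup)

lemma abs_K2_sub_le (hK : KernelHyp K Q) (v v' : Fin 2 → ℝ) :
    |K2 K v - K2 K v'| ≤ Q * Ksup K * (|v 0 - v' 0| + |v 1 - v' 1|) := by
  have e : K2 K v - K2 K v' = (K (v 0) - K (v' 0)) * K (v 1) + K (v' 0) * (K (v 1) - K (v' 1)) := by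
    simp only [K2]; ring
  rw [e]
  refine (abs_add_le _ _).trans ?_
  rw [abs_mul, abs_mul]
  have hS : 0 ≤ Ksup K := zero_le_one.trans hK.one_le_Ksup
  have hQ := hK.Q_nonneg
  calc _ ≤ (Q * |v 0 - v' 0|) * Ksup K + Ksup K * (Q * |v 1 - v' 1|) := by
        gcongr
        · exact hK.lip _ _
        · exact hK.abs_le_Ksup _
        · exact hK.abs_le_Ksup _
        · exact hK.lip _ _
    _ = _ := by ring

lemma mweight_measurable (hK : KernelHyp K Q) (E : Matrix (Fin 2) (Fin 2) ℝ) (t : Fin 2 → ℝ) :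
    Measurable (mweight K E t) := by
  have := K2_continuous hK
  have h : Continuous fun x : Fin 2 → ℝ => E.mulVec (x - t) := by fun_prop
  exact (continuous_const.mul (this.comp h)).measurable

lemma mweight_weight (hK : KernelHyp K Q) {E : Matrix (Fin 2) (Fin 2) ℝ} (hE : 0 < E.det)
    {t : Fin 2 → ℝ} {g F : (Fin 2 → ℝ) → ℝ} {gl B η : ℝ} (hEη : E.det ≤ η)
    (hs : ∀ x, K2 K (E.mulVec (x - t)) ≠ 0 → gl ≤ g x ∧ |F x| ≤ B) :
    Weight g F (mweight K E t) gl B (η * Ksup K ^ 2) (η * Ksup K ^ 4) where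
  meas := mweight_measurable hK E t
  bound x := by
    rw [mweight, abs_mul, abs_of_pos hE]
    exact mul_le_mul hEη (abs_K2_le hK _) (abs_nonneg _) (hE.le.trans hEη)
  support x hx := hs x (right_ne_zero_of_mul hx)
  integrable_sq := (integral_weight_sq hE t hK).1
  integral_sq := (integral_weight_sq hE t hK).2.trans (by gcongr)

lemma K2_wmat_support (hK : KernelHyp K Q) {w : Fin 2 → ℝ} (hw : w ∈ wset) {η : ℝ} (hη : 0 < η)
    (hη1 : η ≤ 1) {z : Fin 2 → ℝ} (hz : K2 K ((wmat w η).mulVec z) ≠ 0) (i : Fin 2) :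
    |z i| ≤ 3 / 2 := by
  have h0 := hK.abs_le_half (left_ne_zero_of_mul hz)
  have h1 := hK.abs_le_half (right_ne_zero_of_mul hz)
  rw [wmat_mulVec_zero, abs_div, abs_of_pos hη, div_le_iff₀ hη] at h0
  rw [wmat_mulVec_one] at h1
  have h0' : (w 0 * z 0 + w 1 * z 1) ^ 2 ≤ (1 / 2) ^ 2 :=
    sq_le_sq' (by linarith [(abs_le.1 h0).1]) (by linarith [(abs_le.1 h0).2])
  have h1' : (-w 1 * z 0 + w 0 * z 1) ^ 2 ≤ (1 / 2) ^ 2 :=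
    sq_le_sq' (by linarith [(abs_le.1 h1).1]) (by linarith [(abs_le.1 h1).2])
  have h2 : (w 0 ^ 2 + w 1 ^ 2) * (z 0 ^ 2 + z 1 ^ 2) ≤ 1 / 2 := by nlinarith
  have h3 : z 0 ^ 2 + z 1 ^ 2 ≤ 2 := by nlinarith [hw.1, sq_nonneg (z 0), sq_nonneg (z 1)]
  refine abs_le_of_sq_le_sq ?_ (by norm_num)
  fin_cases i <;> simp <;> nlinarith [sq_nonneg (z 0), sq_nonneg (z 1)]

lemma wmat_det_pos {w : Fin 2 → ℝ} (hw : w ∈ wset) {η : ℝ} (hη : 0 < η) :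
    0 < (wmat w η).det := by
  rw [wmat_det]
  have := hw.1
  positivity

lemma wmat_det_le {w : Fin 2 → ℝ} (hw : w ∈ wset) {η : ℝ} (hη : 0 < η) :
    (wmat w η).det ≤ 1 / η := by
  rw [wmat_det]
  exact div_le_div_of_nonneg_right hw.2 hη.le

lemma abs_mweight_wmat_sub_le (hK : KernelHyp K Q) {w w' : Fin 2 → ℝ} (hw : w ∈ wset)
    (hw' : w' ∈ wset) {η δ : ℝ} (hη : 0 < η) (hη1 : η ≤ 1) (hd : ∀ i, |w i - w' i| ≤ δ)
    (t x : Fin 2 → ℝ) :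
    |mweight K (wmat w η) t x - mweight K (wmat w' η) t x|
      ≤ (4 * Ksup K ^ 2 + 6 * Q * Ksup K) * δ / η ^ 2 := by
  have hS : 1 ≤ Ksup K := hK.one_le_Ksup
  have hQ := hK.Q_nonneg
  have hδ : 0 ≤ δ := (abs_nonneg _).trans (hd 0)
  set z := x - t with hz
  by_cases hzz : ∀ i, |z i| ≤ 3 / 2
  · have e : mweight K (wmat w η) t x - mweight K (wmat w' η) t x
        = ((wmat w η).det - (wmat w' η).det) * K2 K ((wmat w η).mulVec z)
          + (wmat w' η).det * (K2 K ((wmat w η).mulVec z) - K2 K ((wmat w' η).mulVec z)) := by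
      simp only [mweight, ← hz]; ring
    have d1 : |(wmat w η).det - (wmat w' η).det| ≤ 4 * δ / η := by
      rw [wmat_det, wmat_det, ← sub_div, abs_div, abs_of_pos hη]
      refine div_le_div_of_nonneg_right ?_ hη.le
      have e2 : w 0 ^ 2 + w 1 ^ 2 - (w' 0 ^ 2 + w' 1 ^ 2)
          = (w 0 - w' 0) * (w 0 + w' 0) + (w 1 - w' 1) * (w 1 + w' 1) := by ring
      have hsum : ∀ i, |w i + w' i| ≤ 2 := fun i =>
        (abs_add_le _ _).trans (by linarith [wset_abs_le hw i, wset_abs_le hw' i])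
      rw [e2]
      refine (abs_add_le _ _).trans ?_
      rw [abs_mul, abs_mul]
      have a0 := mul_le_mul (hd 0) (hsum 0) (abs_nonneg _) hδ
      have a1 := mul_le_mul (hd 1) (hsum 1) (abs_nonneg _) hδ
      linarith
    have d2 : |(wmat w η).mulVec z 0 - (wmat w' η).mulVec z 0| ≤ 3 * δ / η := by
      rw [wmat_mulVec_zero, wmat_mulVec_zero, ← sub_div, abs_div, abs_of_pos hη]
      refine div_le_div_of_nonneg_right ?_ hη.le
      have e2 : w 0 * z 0 + w 1 * z 1 - (w' 0 * z 0 + w' 1 * z 1)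
          = (w 0 - w' 0) * z 0 + (w 1 - w' 1) * z 1 := by ring
      rw [e2]
      refine (abs_add_le _ _).trans ?_
      rw [abs_mul, abs_mul]
      have a0 := mul_le_mul (hd 0) (hzz 0) (abs_nonneg _) hδ
      have a1 := mul_le_mul (hd 1) (hzz 1) (abs_nonneg _) hδ
      linarith
    have d3 : |(wmat w η).mulVec z 1 - (wmat w' η).mulVec z 1| ≤ 3 * δ / η := by
      rw [wmat_mulVec_one, wmat_mulVec_one]
      have e2 : -w 1 * z 0 + w 0 * z 1 - (-w' 1 * z 0 + w' 0 * z 1)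
          = -((w 1 - w' 1) * z 0) + (w 0 - w' 0) * z 1 := by ring
      rw [e2]
      refine (abs_add_le _ _).trans ?_
      rw [abs_neg, abs_mul, abs_mul]
      have a0 := mul_le_mul (hd 1) (hzz 0) (abs_nonneg _) hδ
      have a1 := mul_le_mul (hd 0) (hzz 1) (abs_nonneg _) hδ
      have : 3 * δ ≤ 3 * δ / η := le_div_self (by positivity) hη hη1
      linarith
    rw [e]
    refine (abs_add_le _ _).trans ?_
    rw [abs_mul, abs_mul, abs_of_pos (wmat_det_pos hw' hη)]
    have hη' : 1 / η ≤ 1 / η ^ 2 := one_div_le_one_div_of_le (by positivity) (by nlinarith)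
    calc _ ≤ 4 * δ / η * Ksup K ^ 2 + 1 / η * (Q * Ksup K * (3 * δ / η + 3 * δ / η)) := by
          gcongr
          · exact abs_K2_le hK _
          · exact wmat_det_le hw' hη
          · exact (abs_K2_sub_le hK _ _).trans (by gcongr)
      _ = 4 * δ * Ksup K ^ 2 * (1 / η) + 6 * Q * Ksup K * δ / η ^ 2 := by field_simp; ring
      _ ≤ 4 * δ * Ksup K ^ 2 * (1 / η ^ 2) + 6 * Q * Ksup K * δ / η ^ 2 := by gcongr
      _ = _ := by ring
  · push Not at hzz
    obtain ⟨i, hi⟩ := hzz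
    have h1 : K2 K ((wmat w η).mulVec z) = 0 := by
      by_contra h
      exact absurd (K2_wmat_support hK hw hη hη1 h i) (not_le.2 hi)
    have h2 : K2 K ((wmat w' η).mulVec z) = 0 := by
      by_contra h
      exact absurd (K2_wmat_support hK hw' hη hη1 h i) (not_le.2 hi)
    simp only [mweight, ← hz, h1, h2, mul_zero, sub_self, abs_zero]
    positivity

/-- The vector generating the matrix of the pair estimator. -/
def wpair (θ ν : Fin 2 → ℝ) : Fin 2 → ℝ :=
  if 0 ≤ dot2 ν θ then fun i => (θ i + ν i) / (2 * (1 + |dot2 ν θ|))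
  else fun i => (-θ i + ν i) / (2 * (1 + |dot2 ν θ|))

lemma abs_dot2_le {θ ν : Fin 2 → ℝ} (hθ : θ ∈ S1) (hν : ν ∈ S1) : |dot2 ν θ| ≤ 1 := by
  have h1 : θ 0 ^ 2 + θ 1 ^ 2 = 1 := hθ
  have h2 : ν 0 ^ 2 + ν 1 ^ 2 = 1 := hν
  rw [← sq_le_one_iff_abs_le_one, dot2]
  nlinarith [sq_nonneg (ν 0 * θ 1 - ν 1 * θ 0)]

lemma Epair_eq_wmat (θ ν : Fin 2 → ℝ) (η : ℝ) : Epair θ ν η = wmat (wpair θ ν) η := by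
  have h0 : dot2 ν (-θ) = -dot2 ν θ := by simp [dot2]; ring
  unfold Epair wpair wmat Ebar
  split_ifs with h
  · congr 2
    all_goals try simp only [div_div]; ring_nf
  · rw [h0, abs_neg]
    simp only [Pi.neg_apply, div_div]
    congr 2
    all_goals ring_nf

lemma wpair_normSq {θ ν : Fin 2 → ℝ} (hθ : θ ∈ S1) (hν : ν ∈ S1) :
    wpair θ ν 0 ^ 2 + wpair θ ν 1 ^ 2 = 1 / (2 * (1 + |dot2 ν θ|)) := by
  have h1 : θ 0 ^ 2 + θ 1 ^ 2 = 1 := hθ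
  have h2 : ν 0 ^ 2 + ν 1 ^ 2 = 1 := hν
  have hne : 1 + |dot2 ν θ| ≠ 0 := by positivity
  unfold wpair
  split_ifs with h
  · have : |dot2 ν θ| = ν 0 * θ 0 + ν 1 * θ 1 := by rw [abs_of_nonneg h, dot2]
    field_simp
    linear_combination h1 + h2 - 2 * this
  · have : |dot2 ν θ| = -(ν 0 * θ 0 + ν 1 * θ 1) := by rw [abs_of_neg (not_le.1 h), dot2]
    field_simp
    linear_combination h1 + h2 - 2 * this

lemma wpair_mem {θ ν : Fin 2 → ℝ} (hθ : θ ∈ S1) (hν : ν ∈ S1) : wpair θ ν ∈ wset := by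
  have hd := abs_dot2_le hθ hν
  have hd0 := abs_nonneg (dot2 ν θ)
  constructor
  · rw [wpair_normSq hθ hν]
    exact one_div_le_one_div_of_le (by positivity) (by linarith)
  · rw [wpair_normSq hθ hν, div_le_one (by positivity)]
    linarith

lemma abs_dot2_wpair {θ ν : Fin 2 → ℝ} (hθ : θ ∈ S1) : |dot2 (wpair θ ν) θ| = 1 / 2 := by
  have h1 : θ 0 ^ 2 + θ 1 ^ 2 = 1 := hθ
  have hne : 1 + |dot2 ν θ| ≠ 0 := by positivity
  by_cases h : 0 ≤ dot2 ν θ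
  · have e : |dot2 ν θ| = ν 0 * θ 0 + ν 1 * θ 1 := by rw [abs_of_nonneg h, dot2]
    have : wpair θ ν 0 * θ 0 + wpair θ ν 1 * θ 1 = 1 / 2 := by
      simp only [wpair, if_pos h]
      field_simp
      linear_combination h1 - e
    rw [dot2, this]; norm_num
  · have e : |dot2 ν θ| = -(ν 0 * θ 0 + ν 1 * θ 1) := by rw [abs_of_neg (not_le.1 h), dot2]
    have : wpair θ ν 0 * θ 0 + wpair θ ν 1 * θ 1 = -(1 / 2) := by
      simp only [wpair, if_neg h]
      field_simp
      linear_combination -h1 + e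
    rw [dot2, this]; norm_num

lemma wpair_rotate (θ ν : Fin 2 → ℝ) :
    -wpair θ ν 1 * θ 0 + wpair θ ν 0 * θ 1
      = (-ν 1 * θ 0 + ν 0 * θ 1) * (1 / (2 * (1 + |dot2 ν θ|))) := by
  unfold wpair
  split_ifs <;> ring

lemma estM_pair_comm (hK : KernelHyp K Q) (g : (Fin 2 → ℝ) → ℝ) (n : ℕ) (θ ν : Fin 2 → ℝ)
    (η : ℝ) (t : Fin 2 → ℝ) (d : Fin n → (Fin 2 → ℝ) × ℝ) :
    estM K g n (Epair θ ν η) t d = estM K g n (Epair ν θ η) t d := by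
  have hc : dot2 ν θ = dot2 θ ν := by simp only [dot2]; ring
  rw [Epair_eq_wmat, Epair_eq_wmat]
  by_cases h : 0 ≤ dot2 ν θ
  · have : wpair θ ν = wpair ν θ := by
      unfold wpair
      rw [← hc, if_pos h, if_pos h]
      funext i
      rw [add_comm]
    rw [this]
  · have hw : wpair θ ν = -wpair ν θ := by
      unfold wpair
      rw [← hc, if_neg h, if_neg h]
      funext i
      simp only [Pi.neg_apply]
      ring
    have hm : wmat (wpair θ ν) η = -wmat (wpair ν θ) η := by
      rw [hw]
      ext i j
      fin_cases i <;> fin_cases j <;> simp [wmat] <;> ring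
    have hdet : (wmat (wpair θ ν) η).det = (wmat (wpair ν θ) η).det := by
      rw [wmat_det, wmat_det, hw]; simp
    unfold estM
    rw [hdet, hm]
    simp only [Matrix.neg_mulVec, K2, Pi.neg_apply, hK.symm]

end Weights

section Means

variable {K : ℝ → ℝ} {Q b β L : ℝ} {f : ℝ → ℝ}

lemma integral_mweight_wmat (hK : KernelHyp K Q) (hf : Continuous f) {w : Fin 2 → ℝ}
    (hw : w ∈ wset) {η : ℝ} (hη : 0 < η) (t θ : Fin 2 → ℝ) :
    ∫ x, mweight K (wmat w η) t x * f (dot2 x θ)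
      = kmean K f (dot2 t θ) (η * dot2 w θ / (w 0 ^ 2 + w 1 ^ 2))
          ((-w 1 * θ 0 + w 0 * θ 1) / (w 0 ^ 2 + w 1 ^ 2)) := by
  refine integral_weight_mul (wmat_det_pos hw hη) t hK hf fun x => ?_
  rw [wmat_mulVec_zero, wmat_mulVec_one]
  have : w 0 ^ 2 + w 1 ^ 2 ≠ 0 := by have := hw.1; positivity
  simp only [dot2, Pi.sub_apply]
  field_simp
  ring

lemma integral_mweight_Emat (hK : KernelHyp K Q) (hf : Continuous f) {ν : Fin 2 → ℝ}
    (hν : ν ∈ S1) {η : ℝ} (hη : 0 < η) (t θ : Fin 2 → ℝ) :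
    ∫ x, mweight K (Emat ν η) t x * f (dot2 x θ)
      = kmean K f (dot2 t θ) (η * dot2 ν θ) (-ν 1 * θ 0 + ν 0 * θ 1) := by
  have h : ν 0 ^ 2 + ν 1 ^ 2 = 1 := hν
  have := integral_mweight_wmat hK hf (S1_subset_wset hν) hη t θ
  rw [h, div_one, div_one] at this
  exact this

lemma integral_mweight_Epair (hK : KernelHyp K Q) (hf : Continuous f) {θ ν : Fin 2 → ℝ}
    (hθ : θ ∈ S1) (hν : ν ∈ S1) {η : ℝ} (hη : 0 < η) (t : Fin 2 → ℝ) :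
    ∃ a, |a| ≤ 2 * η ∧ ∫ x, mweight K (Epair θ ν η) t x * f (dot2 x θ)
      = kmean K f (dot2 t θ) a (-ν 1 * θ 0 + ν 0 * θ 1) := by
  have hd := abs_dot2_le hθ hν
  have hd0 := abs_nonneg (dot2 ν θ)
  have hne : 1 / (2 * (1 + |dot2 ν θ|)) ≠ 0 := by positivity
  have h := integral_mweight_wmat hK hf (wpair_mem hθ hν) hη t θ
  rw [wpair_normSq hθ hν, wpair_rotate, mul_div_cancel_right₀ _ hne, ← Epair_eq_wmat] at h
  refine ⟨_, ?_, h⟩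
  rw [abs_div, abs_mul, abs_dot2_wpair hθ, abs_of_pos hη,
    abs_of_pos (show 0 < 1 / (2 * (1 + |dot2 ν θ|)) by positivity), div_div_eq_mul_div, div_one]
  nlinarith

lemma abs_integral_Epair_sub_le (hK : KernelHyp K Q) (hmom : VanishingMoments K (mInt b))
    (hβ : 0 < β) (hβb : β ≤ b) (hL : 0 < L) (hf : f ∈ HolderClass β L) {θ ν : Fin 2 → ℝ}
    (hθ : θ ∈ S1) (hν : ν ∈ S1) {η : ℝ} (hη : 0 < η) (t : Fin 2 → ℝ) :
    |(∫ x, mweight K (Epair θ ν η) t x * f (dot2 x θ))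
        - ∫ x, mweight K (Emat ν η) t x * f (dot2 x θ)|
      ≤ 2 * (L * K1 K ^ 2 * 2 ^ β) * η ^ β := by
  have hfc := HolderClass.continuous hf
  obtain ⟨a, ha, e⟩ := integral_mweight_Epair hK hfc hθ hν hη t
  rw [e, integral_mweight_Emat hK hfc hν hη]
  have hC : 0 ≤ L * K1 K ^ 2 := by positivity
  have hb : |η * dot2 ν θ| ≤ 2 * η := by
    rw [abs_mul, abs_of_pos hη]
    nlinarith [abs_dot2_le hθ hν]
  calc _ ≤ L * K1 K ^ 2 * (2 * η) ^ β + L * K1 K ^ 2 * (2 * η) ^ β :=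
        (abs_kmean_sub_kmean_le hK hmom hβ hβb hL hf _ _ _ _).trans (by gcongr)
    _ = _ := by rw [mul_rpow (by norm_num) hη.le]; ring

lemma abs_integral_Emat_sub_le (hK : KernelHyp K Q) (hmom : VanishingMoments K (mInt b))
    (hβ : 0 < β) (hβb : β ≤ b) (hL : 0 < L) (hf : f ∈ HolderClass β L) {θ ν : Fin 2 → ℝ}
    (hθ : θ ∈ S1) (hν : ν ∈ S1) {η h : ℝ} (hη : 0 < η) (hh : η ≤ h) (t : Fin 2 → ℝ) :
    |(∫ x, mweight K (Emat ν h) t x * f (dot2 x θ))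
        - ∫ x, mweight K (Emat ν η) t x * f (dot2 x θ)|
      ≤ 2 * (L * K1 K ^ 2 * 2 ^ β) * h ^ β := by
  have hfc := HolderClass.continuous hf
  rw [integral_mweight_Emat hK hfc hν (hη.trans_le hh), integral_mweight_Emat hK hfc hν hη]
  have hC : 0 ≤ L * K1 K ^ 2 := by positivity
  have hb : ∀ x, 0 < x → x ≤ h → |x * dot2 ν θ| ≤ 2 * h := by
    intro x hx hxh
    rw [abs_mul, abs_of_pos hx]
    nlinarith [abs_dot2_le hθ hν]
  calc _ ≤ L * K1 K ^ 2 * (2 * h) ^ β + L * K1 K ^ 2 * (2 * h) ^ β :=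
        (abs_kmean_sub_kmean_le hK hmom hβ hβb hL hf _ _ _ _).trans (by
          gcongr
          · exact hb _ (hη.trans_le hh) le_rfl
          · exact hb _ hη hh)
    _ = _ := by rw [mul_rpow (by norm_num) (hη.le.trans hh)]; ring

lemma abs_integral_Emat_sub_self_le (hK : KernelHyp K Q) (hmom : VanishingMoments K (mInt b))
    (hβ : 0 < β) (hβb : β ≤ b) (hL : 0 < L) (hf : f ∈ HolderClass β L) {θ : Fin 2 → ℝ}
    (hθ : θ ∈ S1) {h : ℝ} (hh : 0 < h) (t : Fin 2 → ℝ) :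
    |(∫ x, mweight K (Emat θ h) t x * f (dot2 x θ)) - f (dot2 t θ)|
      ≤ 2 * (L * K1 K ^ 2 * 2 ^ β) * h ^ β := by
  have h1 : θ 0 ^ 2 + θ 1 ^ 2 = 1 := hθ
  have hfc := HolderClass.continuous hf
  rw [integral_mweight_Emat hK hfc hθ hh]
  refine (abs_kmean_sub_self_le hK hmom hβ hβb hL hf _ _ _).trans ?_
  have e1 : h * dot2 θ θ = h := by rw [dot2]; linear_combination h * h1
  have e2 : -θ 1 * θ 0 + θ 0 * θ 1 = 0 := by ring
  rw [e1, e2, abs_zero, zero_rpow hβ.ne', mul_zero, add_zero, abs_of_pos hh]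
  have h2 : (1 : ℝ) ≤ 2 * 2 ^ β := by
    have := one_le_rpow (x := 2) (z := β) (by norm_num) hβ.le
    linarith
  have h3 : 0 ≤ L * K1 K ^ 2 * h ^ β := by positivity
  nlinarith

lemma FhatAux_matrix_det {h : ℝ} (hh : 0 < h) :
    (!![h⁻¹, 0; 0, h⁻¹] : Matrix (Fin 2) (Fin 2) ℝ).det = 1 / h ^ 2 := by
  rw [Matrix.det_fin_two_of]
  field_simp
  ring

lemma FhatAux_matrix_mulVec (h : ℝ) (z : Fin 2 → ℝ) (i : Fin 2) :
    (!![h⁻¹, 0; 0, h⁻¹] : Matrix (Fin 2) (Fin 2) ℝ).mulVec z i = z i / h := by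
  fin_cases i <;> simp [Matrix.mulVec, dotProduct, Fin.sum_univ_two, div_eq_inv_mul]

lemma abs_integral_diag_sub_le (hK : KernelHyp K Q) (hmom : VanishingMoments K (mInt b))
    (hβ : 0 < β) (hβb : β ≤ b) (hL : 0 < L) (hf : f ∈ HolderClass β L) {θ : Fin 2 → ℝ}
    (hθ : θ ∈ S1) {h : ℝ} (hh : 0 < h) (v : Fin 2 → ℝ) :
    |(∫ x, mweight K !![h⁻¹, 0; 0, h⁻¹] v x * f (dot2 x θ)) - f (dot2 v θ)|
      ≤ 2 * (L * K1 K ^ 2) * h ^ β := by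
  have hfc := HolderClass.continuous hf
  have e : ∫ x, mweight K !![h⁻¹, 0; 0, h⁻¹] v x * f (dot2 x θ)
      = kmean K f (dot2 v θ) (h * θ 0) (h * θ 1) := by
    refine integral_weight_mul (by rw [FhatAux_matrix_det hh]; positivity) v hK hfc fun x => ?_
    rw [FhatAux_matrix_mulVec, FhatAux_matrix_mulVec]
    simp only [dot2, Pi.sub_apply]
    field_simp
    ring
  rw [e]
  have hθi := fun i => wset_abs_le (S1_subset_wset hθ) i
  have hK1 := hK.one_le_K1
  have hb : ∀ i, |h * θ i| ≤ h := fun i => by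
    rw [abs_mul, abs_of_pos hh]
    exact mul_le_of_le_one_right hh.le (hθi i)
  calc _ ≤ L * K1 K ^ 2 * h ^ β + L * K1 K * h ^ β :=
        (abs_kmean_sub_self_le hK hmom hβ hβb hL hf _ _ _).trans (by
          gcongr
          · exact hb 0
          · exact hb 1)
    _ ≤ L * K1 K ^ 2 * h ^ β + L * K1 K ^ 2 * h ^ β := by
          gcongr
          exact le_self_pow₀ hK1 (by norm_num)
    _ = _ := by ring

lemma abs_mweight_diag_sub_le (hK : KernelHyp K Q) {h δ : ℝ} (hh : 0 < h) {v v' : Fin 2 → ℝ}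
    (hd : ∀ i, |v i - v' i| ≤ δ) (x : Fin 2 → ℝ) :
    |mweight K !![h⁻¹, 0; 0, h⁻¹] v x - mweight K !![h⁻¹, 0; 0, h⁻¹] v' x|
      ≤ 2 * Q * Ksup K * δ / h ^ 3 := by
  have hS : 1 ≤ Ksup K := hK.one_le_Ksup
  have hQ := hK.Q_nonneg
  rw [mweight, mweight, ← mul_sub, abs_mul, FhatAux_matrix_det hh, abs_of_pos (by positivity)]
  have hi : ∀ i, |(!![h⁻¹, 0; 0, h⁻¹] : Matrix (Fin 2) (Fin 2) ℝ).mulVec (x - v) i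
      - (!![h⁻¹, 0; 0, h⁻¹] : Matrix (Fin 2) (Fin 2) ℝ).mulVec (x - v') i| ≤ δ / h := by
    intro i
    rw [FhatAux_matrix_mulVec, FhatAux_matrix_mulVec, ← sub_div, abs_div, abs_of_pos hh]
    refine div_le_div_of_nonneg_right ?_ hh.le
    simp only [Pi.sub_apply, sub_sub_sub_cancel_left]
    rw [abs_sub_comm]
    exact hd i
  calc _ ≤ 1 / h ^ 2 * (Q * Ksup K * (δ / h + δ / h)) := by
        gcongr
        exact (abs_K2_sub_le hK _ _).trans (by gcongr <;> exact hi _)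
    _ = _ := by field_simp; ring

lemma K2_diag_support (hK : KernelHyp K Q) {h : ℝ} (hh : 0 < h) (hh1 : h ≤ 1) {z : Fin 2 → ℝ}
    (hz : K2 K ((!![h⁻¹, 0; 0, h⁻¹] : Matrix (Fin 2) (Fin 2) ℝ).mulVec z) ≠ 0) (i : Fin 2) :
    |z i| ≤ 1 / 2 := by
  have h0 := hK.abs_le_half (left_ne_zero_of_mul hz)
  have h1 := hK.abs_le_half (right_ne_zero_of_mul hz)
  rw [FhatAux_matrix_mulVec, abs_div, abs_of_pos hh, div_le_iff₀ hh] at h0 h1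
  fin_cases i
  · exact h0.trans (by linarith)
  · exact h1.trans (by linarith)

end Means

section Oracle

variable {P : Pars} {n : ℕ} {t : Fin 2 → ℝ} {d : Fin n → (Fin 2 → ℝ) × ℝ}

lemma Hgrid_pos {ω η : ℝ} (hη : η ∈ Hgrid ω n) : 0 < η := by
  obtain ⟨⟨k, rfl⟩, _⟩ := hη
  positivity

lemma abs_estM_le (hK : KernelHyp P.K P.Q) {w : Fin 2 → ℝ} (hw : w ∈ wset) {η : ℝ}
    (hη : 0 < η) :
    |estM P.K P.g n (wmat w η) t d|
      ≤ 1 / η * (Ksup P.K ^ 2 / n * ∑ i, |(d i).2 / P.g (d i).1|) := by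
  have hd := wmat_det_le hw hη
  have hd0 := wmat_det_pos hw hη
  rw [estM, abs_mul, abs_div, abs_of_pos hd0, Nat.abs_cast]
  calc _ ≤ (wmat w η).det / n * ∑ i, Ksup P.K ^ 2 * |(d i).2 / P.g (d i).1| := by
        refine mul_le_mul_of_nonneg_left ((Finset.abs_sum_le_sum_abs _ _).trans
          (Finset.sum_le_sum fun i _ => ?_)) (by positivity)
        rw [mul_div_assoc, abs_mul]
        exact mul_le_mul_of_nonneg_right (abs_K2_le hK _) (abs_nonneg _)
    _ ≤ 1 / η / n * ∑ i, Ksup P.K ^ 2 * |(d i).2 / P.g (d i).1| := by gcongr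
    _ = _ := by rw [← Finset.mul_sum]; ring

lemma bddAbove_abs_sub (hK : KernelHyp P.K P.Q) {η h : ℝ} (hη : 0 < η) (hh : η ≤ h)
    {w w' : (Fin 2 → ℝ) → Fin 2 → ℝ}
    (hw : ∀ ν ∈ S1, w ν ∈ wset) (hw' : ∀ ν ∈ S1, w' ν ∈ wset) :
    ∀ v ∈ {v | ∃ ν ∈ S1, v = |estM P.K P.g n (wmat (w ν) h) t d
        - estM P.K P.g n (wmat (w' ν) η) t d|},
      v ≤ 1 / η * (2 * (Ksup P.K ^ 2 / n * ∑ i, |(d i).2 / P.g (d i).1|)) := by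
  rintro v ⟨ν, hν, rfl⟩
  refine (abs_sub _ _).trans ?_
  have h1 := abs_estM_le (n := n) (t := t) (d := d) hK (hw ν hν) (hη.trans_le hh)
  have h2 := abs_estM_le (n := n) (t := t) (d := d) hK (hw' ν hν) hη
  have hA : 0 ≤ Ksup P.K ^ 2 / n * ∑ i, |(d i).2 / P.g (d i).1| :=
    mul_nonneg (by positivity) (Finset.sum_nonneg fun i _ => abs_nonneg _)
  have h3 := mul_le_mul_of_nonneg_right (one_div_le_one_div_of_le hη hh) hA
  linarith

lemma TH_nonneg
    (hbr : 0 ≤ Ksup P.K ^ 2 * √(log n) + FhatInf P n d * C1f P n + C2f P n) {η : ℝ} (hη : 0 < η) :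
    0 ≤ TH P n d η := by
  unfold TH
  positivity

lemma TH_anti (hn : 0 < n)
    (hbr : 0 ≤ Ksup P.K ^ 2 * √(log n) + FhatInf P n d * C1f P n + C2f P n) {η h : ℝ} (hη : 0 < η)
    (hh : η ≤ h) : TH P n d h ≤ TH P n d η := by
  unfold TH
  refine mul_le_mul_of_nonneg_left ?_ (by positivity)
  have hn' : (0 : ℝ) < n := by exact_mod_cast hn
  exact rpow_le_rpow_of_nonpos (by positivity) (by gcongr) (by norm_num)

lemma R1_nonneg (θ : Fin 2 → ℝ) (h : ℝ) : 0 ≤ R1 P n t θ h d := by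
  refine Real.sSup_nonneg ?_
  rintro _ ⟨η, _, _, rfl⟩
  exact le_max_right _ _

lemma R2_nonneg (h : ℝ) : 0 ≤ R2 P n t h d := by
  refine Real.sSup_nonneg ?_
  rintro _ ⟨η, _, _, rfl⟩
  exact le_max_right _ _

lemma le_R1 (hK : KernelHyp P.K P.Q) (hmin0 : 0 < hmin P.ω n)
    (hbr : 0 ≤ Ksup P.K ^ 2 * √(log n) + FhatInf P n d * C1f P n + C2f P n)
    {θ ν : Fin 2 → ℝ} (hθ : θ ∈ S1) (hν : ν ∈ S1) {η h : ℝ} (hη : η ∈ Hgrid P.ω n)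
    (hh : η ≤ h) :
    |estM P.K P.g n (Epair θ ν η) t d - estM P.K P.g n (Emat ν η) t d|
      ≤ R1 P n t θ h d + TH P n d η := by
  set A := Ksup P.K ^ 2 / n * ∑ i, |(d i).2 / P.g (d i).1| with hA
  have hA0 : 0 ≤ A := mul_nonneg (by positivity) (Finset.sum_nonneg fun i _ => abs_nonneg _)
  have hb : ∀ η ∈ Hgrid P.ω n, ∀ v ∈ {w | ∃ ν ∈ S1,
      w = |estM P.K P.g n (Epair θ ν η) t d - estM P.K P.g n (Emat ν η) t d|},
      v ≤ 1 / η * (2 * A) := by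
    intro η hη
    simp only [Epair_eq_wmat]
    exact bddAbove_abs_sub hK (Hgrid_pos hη) le_rfl (w' := fun ν => ν)
      (fun ν hν => wpair_mem hθ hν) fun ν hν => S1_subset_wset hν
  have h1 : |estM P.K P.g n (Epair θ ν η) t d - estM P.K P.g n (Emat ν η) t d|
      ≤ sSup {w | ∃ ν ∈ S1,
        w = |estM P.K P.g n (Epair θ ν η) t d - estM P.K P.g n (Emat ν η) t d|} :=
    le_csSup ⟨_, hb η hη⟩ ⟨ν, hν, rfl⟩
  have h2 : max (sSup {w | ∃ ν ∈ S1,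
        w = |estM P.K P.g n (Epair θ ν η) t d - estM P.K P.g n (Emat ν η) t d|}
        - TH P n d η) 0 ≤ R1 P n t θ h d := by
    refine le_csSup ⟨2 / hmin P.ω n * (2 * A), ?_⟩ ⟨η, hη, hh, rfl⟩
    rintro _ ⟨η', hη', _, rfl⟩
    refine max_le ?_ (by positivity)
    have h3 := Real.sSup_le (hb η' hη') (by have := Hgrid_pos hη'; positivity)
    have h4 := TH_nonneg hbr (Hgrid_pos hη')
    have h5 : 1 / η' * (2 * A) ≤ 2 / hmin P.ω n * (2 * A) := by
      refine mul_le_mul_of_nonneg_right ?_ (by positivity)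
      rw [div_le_div_iff₀ (Hgrid_pos hη') hmin0]
      linarith [hη'.2.1]
    linarith
  linarith [le_max_left (sSup {w | ∃ ν ∈ S1,
        w = |estM P.K P.g n (Epair θ ν η) t d - estM P.K P.g n (Emat ν η) t d|}
        - TH P n d η) 0]

lemma le_R2 (hK : KernelHyp P.K P.Q) (hmin0 : 0 < hmin P.ω n)
    (hbr : 0 ≤ Ksup P.K ^ 2 * √(log n) + FhatInf P n d * C1f P n + C2f P n)
    {θ : Fin 2 → ℝ} (hθ : θ ∈ S1) {η h : ℝ} (hη : η ∈ Hgrid P.ω n) (hh : η ≤ h) :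
    |estM P.K P.g n (Emat θ h) t d - estM P.K P.g n (Emat θ η) t d|
      ≤ R2 P n t h d + TH P n d η := by
  set A := Ksup P.K ^ 2 / n * ∑ i, |(d i).2 / P.g (d i).1| with hA
  have hA0 : 0 ≤ A := mul_nonneg (by positivity) (Finset.sum_nonneg fun i _ => abs_nonneg _)
  have hb : ∀ η ∈ Hgrid P.ω n, η ≤ h → ∀ v ∈ {w | ∃ θ ∈ S1,
      w = |estM P.K P.g n (Emat θ h) t d - estM P.K P.g n (Emat θ η) t d|},
      v ≤ 1 / η * (2 * A) := fun η hη hηh =>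
    bddAbove_abs_sub hK (Hgrid_pos hη) hηh (w := fun ν => ν) (w' := fun ν => ν)
      (fun ν hν => S1_subset_wset hν) fun ν hν => S1_subset_wset hν
  have h1 : |estM P.K P.g n (Emat θ h) t d - estM P.K P.g n (Emat θ η) t d|
      ≤ sSup {w | ∃ θ ∈ S1,
        w = |estM P.K P.g n (Emat θ h) t d - estM P.K P.g n (Emat θ η) t d|} :=
    le_csSup ⟨_, hb η hη hh⟩ ⟨θ, hθ, rfl⟩
  have h2 : max (sSup {w | ∃ θ ∈ S1,
        w = |estM P.K P.g n (Emat θ h) t d - estM P.K P.g n (Emat θ η) t d|}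
        - TH P n d η) 0 ≤ R2 P n t h d := by
    refine le_csSup ⟨2 / hmin P.ω n * (2 * A), ?_⟩ ⟨η, hη, hh, rfl⟩
    rintro _ ⟨η', hη', hh', rfl⟩
    refine max_le ?_ (by positivity)
    have h3 := Real.sSup_le (hb η' hη' hh') (by have := Hgrid_pos hη'; positivity)
    have h4 := TH_nonneg hbr (Hgrid_pos hη')
    have h5 : 1 / η' * (2 * A) ≤ 2 / hmin P.ω n * (2 * A) := by
      refine mul_le_mul_of_nonneg_right ?_ (by positivity)
      rw [div_le_div_iff₀ (Hgrid_pos hη') hmin0]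
      linarith [hη'.2.1]
    linarith
  linarith [le_max_left (sSup {w | ∃ θ ∈ S1,
        w = |estM P.K P.g n (Emat θ h) t d - estM P.K P.g n (Emat θ η) t d|}
        - TH P n d η) 0]

/-- The oracle inequality on the event where the stochastic errors of the whole family are
dominated by the thresholds. -/
lemma selEst_oracle (hK : KernelHyp P.K P.Q) {b β L : ℝ} (hmom : VanishingMoments P.K (mInt b))
    (hβ : 0 < β) (hβb : β ≤ b) (hL : 0 < L) {f : ℝ → ℝ} (hf : f ∈ HolderClass β L)
    {θ : Fin 2 → ℝ} (hθ : θ ∈ S1) (hn : 0 < n) (hmin0 : 0 < hmin P.ω n)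
    (hbr : 0 ≤ Ksup P.K ^ 2 * √(log n) + FhatInf P n d * C1f P n + C2f P n)
    (hdev : ∀ η ∈ Hgrid P.ω n, ∀ w ∈ wset, |estM P.K P.g n (wmat w η) t d
      - ∫ x, mweight P.K (wmat w η) t x * f (dot2 x θ)| ≤ TH P n d η / 2)
    {sel : (Fin n → (Fin 2 → ℝ) × ℝ) → (Fin 2 → ℝ) × ℝ} (hsel : IsSelector P n t sel)
    {h : ℝ} (hh : h ∈ Hgrid P.ω n) :
    |selEst P n t sel d - f (dot2 t θ)|
      ≤ 17 * (2 * (L * K1 P.K ^ 2 * 2 ^ β) * h ^ β) + 9 * TH P n d h := by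
  obtain ⟨hs1, hs2, hs3⟩ := hsel d
  have hmin := hs3 θ hθ h hh
  set Cb := 2 * (L * K1 P.K ^ 2 * 2 ^ β) with hCb
  have hCb0 : 0 ≤ Cb := by positivity
  have hh0 := Hgrid_pos hh
  have hB0 : 0 ≤ Cb * h ^ β := by positivity
  have hdevE : ∀ η ∈ Hgrid P.ω n, ∀ ν ∈ S1, |estM P.K P.g n (Emat ν η) t d
      - ∫ x, mweight P.K (Emat ν η) t x * f (dot2 x θ)| ≤ TH P n d η / 2 :=
    fun η hη ν hν => hdev η hη ν (S1_subset_wset hν)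
  have hR1 : R1 P n t θ h d ≤ Cb * h ^ β := by
    refine Real.sSup_le ?_ hB0
    rintro _ ⟨η, hη, hηh, rfl⟩
    have hη0 := Hgrid_pos hη
    have hT := TH_nonneg hbr hη0
    refine max_le (sub_le_iff_le_add.2 (Real.sSup_le ?_ (by positivity))) hB0
    rintro _ ⟨ν, hν, rfl⟩
    have a1 := hdev η hη _ (wpair_mem hθ hν)
    rw [← Epair_eq_wmat] at a1
    have a2 := hdevE η hη ν hν
    have a3 := abs_integral_Epair_sub_le hK hmom hβ hβb hL hf hθ hν hη0 t
    have a4 : Cb * η ^ β ≤ Cb * h ^ β := by gcongr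
    rw [← hCb] at a3
    rw [abs_le] at *
    constructor <;> linarith [a1.1, a1.2, a2.1, a2.2, a3.1, a3.2]
  have hR2 : R2 P n t h d ≤ Cb * h ^ β := by
    refine Real.sSup_le ?_ hB0
    rintro _ ⟨η, hη, hηh, rfl⟩
    have hη0 := Hgrid_pos hη
    have hT := TH_nonneg hbr hη0
    have hT2 := TH_anti hn hbr hη0 hηh
    refine max_le (sub_le_iff_le_add.2 (Real.sSup_le ?_ (by positivity))) hB0
    rintro _ ⟨ν, hν, rfl⟩
    have a1 := hdevE h hh ν hν
    have a2 := hdevE η hη ν hν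
    have a3 := abs_integral_Emat_sub_le hK hmom hβ hβb hL hf hθ hν hη0 hηh t
    rw [← hCb] at a3
    rw [abs_le] at *
    constructor <;> linarith [a1.1, a1.2, a2.1, a2.2, a3.1, a3.2]
  set η := min (sel d).2 h with hη
  have hηg : η ∈ Hgrid P.ω n := by
    rcases min_choice (sel d).2 h with h' | h' <;> rw [hη, h'] <;> assumption
  have hTη : TH P n d η ≤ TH P n d (sel d).2 + TH P n d h := by
    have t1 := TH_nonneg hbr hh0
    have t2 := TH_nonneg hbr (Hgrid_pos hs2)
    rcases min_choice (sel d).2 h with h' | h' <;> rw [hη, h'] <;> linarith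
  have r1 := R1_nonneg (P := P) (n := n) (t := t) (d := d) (sel d).1 (sel d).2
  have r2 := R2_nonneg (P := P) (n := n) (t := t) (d := d) (sel d).2
  have r3 := R1_nonneg (P := P) (n := n) (t := t) (d := d) θ h
  have r4 := R2_nonneg (P := P) (n := n) (t := t) (d := d) h
  have b1 := le_R2 (t := t) hK hmin0 hbr hs1 hηg (min_le_left _ _)
  have b2 := le_R1 (t := t) hK hmin0 hbr hθ hs1 hηg (min_le_right _ _)
  have b3 := le_R1 (t := t) hK hmin0 hbr hs1 hθ hηg (min_le_left _ _)
  have b4 := le_R2 (t := t) hK hmin0 hbr hθ hηg (min_le_right _ _)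
  have b5 := hdevE h hh θ hθ
  have b6 := abs_integral_Emat_sub_self_le hK hmom hβ hβb hL hf hθ hh0 t
  rw [estM_pair_comm hK] at b3
  rw [← hCb] at b6
  rw [selEst]
  rw [abs_le] at *
  constructor <;> linarith [b1.1, b1.2, b2.1, b2.2, b3.1, b3.2, b4.1, b4.2, b5.1, b5.2, b6.1, b6.2]

end Oracle

section GoodEvent

variable {P : Pars} {n : ℕ} {t : Fin 2 → ℝ} {d : Fin n → (Fin 2 → ℝ) × ℝ}
  {p : ℝ → ℝ} {F : (Fin 2 → ℝ) → ℝ}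

lemma obs_eq_of_abs_le {g φ : (Fin 2 → ℝ) → ℝ} {τ : ℝ} {z : (Fin 2 → ℝ) × ℝ}
    (hz : |z.2 - F z.1| ≤ τ) : obs g F τ φ z = φ z.1 / g z.1 * z.2 := by
  rw [obs, trunc, if_pos hz]
  ring

lemma estM_eq_mean_obs {K : ℝ → ℝ} {g : (Fin 2 → ℝ) → ℝ} {τ : ℝ}
    (hd : ∀ i, |(d i).2 - F (d i).1| ≤ τ) (E : Matrix (Fin 2) (Fin 2) ℝ) :
    estM K g n E t d = (n : ℝ)⁻¹ * ∑ i, obs g F τ (mweight K E t) (d i) := by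
  rw [estM, div_eq_inv_mul, mul_assoc, Finset.mul_sum]
  congr 1
  refine Finset.sum_congr rfl fun i _ => ?_
  rw [obs_eq_of_abs_le (hd i), mweight]
  ring

lemma FhatAux_eq_mean_obs {τ : ℝ} (hh : 0 < frakh P.ω n)
    (hd : ∀ i, |(d i).2 - F (d i).1| ≤ τ) (v : Fin 2 → ℝ) :
    FhatAux P n d v = (n : ℝ)⁻¹ * ∑ i, obs P.g F τ
      (mweight P.K !![(frakh P.ω n)⁻¹, 0; 0, (frakh P.ω n)⁻¹] v) (d i) := by
  rw [FhatAux]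
  congr 1
  refine Finset.sum_congr rfl fun i _ => ?_
  rw [obs_eq_of_abs_le (hd i), mweight, K2, FhatAux_matrix_mulVec, FhatAux_matrix_mulVec,
    FhatAux_matrix_det hh, zpow_neg, ← one_div]
  simp only [Pi.sub_apply]
  norm_cast
  ring

lemma integral_trunc_sq_le (hΥ : 0 < P.Υ) (hΩ : 0 < P.Ωc) (hω : 0 < P.ω)
    (h : Model P.g p F) (hp : p ∈ NoiseClass P.Υ P.Ωc P.ω) (τ : ℝ) :
    ∫ e, trunc τ e ^ 2 ∂noiseLaw p ≤ sigma2 P := by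
  obtain ⟨C, hC, hmom⟩ := exists_noise_moment hΥ hΩ hω (q := 2) two_pos
  have sq : ∀ e : ℝ, |e| ^ (2 : ℝ) = e ^ 2 := fun e => by
    rw [← sq_abs e]; exact_mod_cast rpow_natCast |e| 2
  have key : ∀ q ∈ NoiseClass P.Υ P.Ωc P.ω,
      Integrable (fun e : ℝ => e ^ 2) (noiseLaw q) ∧ ∫ x, x ^ 2 * q x ≤ C ∧
        ∫ x, x ^ 2 * q x = ∫ e, e ^ 2 ∂noiseLaw q := by
    intro q hq
    have hm : Model P.g q F := ⟨h.g_nonneg, h.g_one, hq.1, hq.2.1, hq.2.2.1, h.F_meas⟩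
    have hl := hmom q hq
    simp only [sq] at hl
    have hi : Integrable (fun e : ℝ => e ^ 2) (noiseLaw q) := by
      refine ⟨by fun_prop, ?_⟩
      rw [hasFiniteIntegral_iff_ofReal (Filter.Eventually.of_forall fun e => sq_nonneg e)]
      exact hl.trans_lt ENNReal.ofReal_lt_top
    have e : ∫ x, x ^ 2 * q x = ∫ e, e ^ 2 ∂noiseLaw q := by
      rw [hm.integral_noise]
      simp only [mul_comm]
    refine ⟨hi, ?_, e⟩
    rw [e, integral_eq_lintegral_of_nonneg_ae (Filter.Eventually.of_forall fun e => sq_nonneg e)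
      hi.aestronglyMeasurable]
    exact ENNReal.toReal_le_of_le_ofReal hC hl
  obtain ⟨hi, -, he⟩ := key p hp
  calc ∫ e, trunc τ e ^ 2 ∂noiseLaw p ≤ ∫ e, e ^ 2 ∂noiseLaw p :=
        integral_mono_of_nonneg (Filter.Eventually.of_forall fun e => sq_nonneg _) hi
          (Filter.Eventually.of_forall fun e => trunc_sq_le τ e)
    _ = ∫ x, x ^ 2 * p x := he.symm
    _ ≤ sigma2 P := by
        refine le_csSup ⟨C, ?_⟩ ⟨p, hp, rfl⟩
        rintro _ ⟨q, hq, rfl⟩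
        exact (key q hq).2.1

/-- The uniform deviation level of the family of estimators built on weights bounded by
`M`, with second moment `M * Ksup ^ 2` and Lipschitz increments `D`. -/
def devLevel (P : Pars) (n : ℕ) (c M B D : ℝ) : ℝ :=
  2 * √(M * Ksup P.K ^ 4 / P.gl * (B ^ 2 + sigma2 P) * c / n)
    + M * Ksup P.K ^ 2 / P.gl * (B + tauf P n) * c / n + 2 * (D / P.gl * (B + tauf P n))

/-- The event on which the noise is bounded by `tauf P n` and the estimators are uniformly close
to their means. -/
def goodEvent (P : Pars) (n : ℕ) (t : Fin 2 → ℝ) (F : (Fin 2 → ℝ) → ℝ) (c δ B L : ℝ) :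
    Set (Fin n → (Fin 2 → ℝ) × ℝ) :=
  {d | (∀ i, |(d i).2 - F (d i).1| ≤ tauf P n) ∧
    (∀ η ∈ Hgrid P.ω n, ∀ w ∈ wset,
      |estM P.K P.g n (wmat w η) t d - ∫ x, mweight P.K (wmat w η) t x * F x|
        ≤ devLevel P n c (1 / η) B ((4 * Ksup P.K ^ 2 + 6 * P.Q * Ksup P.K) * δ / η ^ 2)) ∧
    ∀ v ∈ Set.Icc (fun _ : Fin 2 => -(5/2 : ℝ)) (fun _ : Fin 2 => (5/2 : ℝ)),
      |FhatAux P n d v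
          - ∫ x, mweight P.K !![(frakh P.ω n)⁻¹, 0; 0, (frakh P.ω n)⁻¹] v x * F x|
        ≤ devLevel P n c (1 / frakh P.ω n ^ 2) L
          (2 * P.Q * Ksup P.K * δ / frakh P.ω n ^ 3)}

lemma mem_cube_of_abs_le {a : ℝ} {x : Fin 2 → ℝ} (h : ∀ i, |x i| ≤ a) :
    x ∈ Set.Icc (fun _ : Fin 2 => -a) (fun _ : Fin 2 => a) :=
  ⟨fun i => (abs_le.1 (h i)).1, fun i => (abs_le.1 (h i)).2⟩

lemma abs_le_of_mem_cube {a : ℝ} {x : Fin 2 → ℝ}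
    (h : x ∈ Set.Icc (fun _ : Fin 2 => -a) (fun _ : Fin 2 => a)) (i : Fin 2) : |x i| ≤ a :=
  abs_le.2 ⟨h.1 i, h.2 i⟩

lemma abs_le_of_abs_sub_le {a b : ℝ} {x y : Fin 2 → ℝ} (hy : ∀ i, |y i| ≤ a)
    (h : ∀ i, |(x - y) i| ≤ b) (i : Fin 2) : |x i| ≤ a + b := by
  have h1 := h i
  have h2 := hy i
  rw [Pi.sub_apply] at h1
  rw [abs_le] at *
  constructor <;> linarith

lemma DesignOK.le_of_abs_le {g : (Fin 2 → ℝ) → ℝ} {gl : ℝ} (hg : DesignOK g gl)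
    {x : Fin 2 → ℝ} (h : ∀ i, |x i| ≤ 3) : gl ≤ g x :=
  hg.2.2 x (mem_cube_of_abs_le h)

lemma one_div_le_of_mem_Hgrid (hn : 0 < n) {ω : ℝ} (hmin1 : (n : ℝ)⁻¹ ≤ hmin ω n) {η : ℝ}
    (hη : η ∈ Hgrid ω n) : 1 / η ≤ 2 * n := by
  have hn' : (0 : ℝ) < n := by exact_mod_cast hn
  have := hη.2.1
  rw [div_le_iff₀ (Hgrid_pos hη)]
  have h : (n : ℝ)⁻¹ ≤ 2 * η := by linarith
  rw [inv_le_iff_one_le_mul₀ hn'] at h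
  linarith

lemma exists_lt_of_mem_Hgrid (hn : 0 < n) {ω : ℝ} (hmin1 : (n : ℝ)⁻¹ ≤ hmin ω n) {η : ℝ}
    (hη : η ∈ Hgrid ω n) : ∃ k ∈ Finset.range (n + 1), η = (2 : ℝ) ^ (-(k : ℤ)) := by
  have h := one_div_le_of_mem_Hgrid hn hmin1 hη
  obtain ⟨⟨k, rfl⟩, -⟩ := hη
  refine ⟨k, ?_, rfl⟩
  rw [one_div, zpow_neg, inv_inv] at h
  have h' : 2 ^ k ≤ 2 * n := by exact_mod_cast h
  have h2 : n < 2 ^ n := Nat.lt_two_pow_self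
  have h3 : 2 ^ k < 2 ^ (n + 1) := by rw [pow_succ]; omega
  exact Finset.mem_range.2 ((Nat.pow_lt_pow_iff_right (by norm_num)).1 h3)

lemma goodEvent_compl_le (hΥ : 0 < P.Υ) (hΩ : 0 < P.Ωc) (hω : 0 < P.ω)
    (hK : KernelHyp P.K P.Q) (hgl : 0 < P.gl) (hg : DesignOK P.g P.gl)
    (hm : Model P.g p F) (hp : p ∈ NoiseClass P.Υ P.Ωc P.ω)
    (ht : t ∈ Set.Icc (fun _ : Fin 2 => -(1/2 : ℝ)) (fun _ : Fin 2 => (1/2 : ℝ)))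
    {c δ B L : ℝ} (hc : 0 < c) (hδ : 0 < δ) (hB : 0 ≤ B) (hL : 0 ≤ L)
    (hFB : ∀ x, (∀ i, |x i| ≤ 2) → |F x| ≤ B) (hFL : ∀ x, |F x| ≤ L)
    (hn : 0 < n) (hmin1 : (n : ℝ)⁻¹ ≤ hmin P.ω n) (hh0 : 0 < frakh P.ω n) (hh1 : frakh P.ω n ≤ 1)
    (hτ : 0 < tauf P n) :
    (Measure.pi fun _ : Fin n => jointLaw P.g p F) (goodEvent P n t F c δ B L)ᶜ
      ≤ ENNReal.ofReal (n * (2 * (P.Υ * exp (-P.Ωc * tauf P n ^ P.ω)))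
        + (n + 2) * ((5 / δ + 2) ^ 2 * (2 * exp (-c)))) := by
  have hS0 : 0 < Ksup P.K := zero_lt_one.trans_le hK.one_le_Ksup
  have hSg := integral_trunc_sq_le hΥ hΩ hω hm hp (tauf P n)
  set μ := Measure.pi fun _ : Fin n => jointLaw P.g p F
  set A : Set (Fin n → (Fin 2 → ℝ) × ℝ) := {d | ∀ i, |(d i).2 - F (d i).1| ≤ tauf P n}ᶜ with hA
  set E : ℝ → Set (Fin n → (Fin 2 → ℝ) × ℝ) := fun η => {d | ∀ w ∈ wset,
    |(n : ℝ)⁻¹ * ∑ i, obs P.g F (tauf P n) (mweight P.K (wmat w η) t) (d i)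
      - ∫ x, mweight P.K (wmat w η) t x * F x|
      ≤ devLevel P n c (1 / η) B ((4 * Ksup P.K ^ 2 + 6 * P.Q * Ksup P.K) * δ / η ^ 2)}ᶜ with hE
  set G : Set (Fin n → (Fin 2 → ℝ) × ℝ) := {d | ∀ v ∈ Set.Icc (fun _ : Fin 2 => -(5/2 : ℝ))
      (fun _ : Fin 2 => (5/2 : ℝ)),
    |(n : ℝ)⁻¹ * ∑ i, obs P.g F (tauf P n)
        (mweight P.K !![(frakh P.ω n)⁻¹, 0; 0, (frakh P.ω n)⁻¹] v) (d i)
      - ∫ x, mweight P.K !![(frakh P.ω n)⁻¹, 0; 0, (frakh P.ω n)⁻¹] v x * F x|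
      ≤ devLevel P n c (1 / frakh P.ω n ^ 2) L
          (2 * P.Q * Ksup P.K * δ / frakh P.ω n ^ 3)}ᶜ with hG
  have hAμ : μ A ≤ ENNReal.ofReal (n * (2 * (P.Υ * exp (-P.Ωc * tauf P n ^ P.ω)))) :=
    hm.joint_noise_exceed hp hτ.le n
  have hGμ : μ G ≤ ENNReal.ofReal ((5 / δ + 2) ^ 2 * (2 * exp (-c))) := by
    have := hm.uniform_deviation (S := Set.Icc (fun _ : Fin 2 => -(5/2 : ℝ))
      (fun _ : Fin 2 => (5/2 : ℝ)))
      (φ := fun v => mweight P.K !![(frakh P.ω n)⁻¹, 0; 0, (frakh P.ω n)⁻¹] v)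
      (R := 5 / 2) (δ := δ) (c := c) (gl := P.gl) (B := L) (τ := tauf P n)
      (M₀ := 1 / frakh P.ω n ^ 2 * Ksup P.K ^ 2) (V₀ := 1 / frakh P.ω n ^ 2 * Ksup P.K ^ 4)
      (D := 2 * P.Q * Ksup P.K * δ / frakh P.ω n ^ 3) hn (by norm_num) hδ hc
      (fun w hw i => abs_le_of_mem_cube hw i)
      (fun w hw => mweight_weight hK (by rw [FhatAux_matrix_det hh0]; positivity)
        (FhatAux_matrix_det hh0).le fun x hx => ⟨?_, hFL x⟩) hgl hL hτ (by positivity)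
      (fun w _ w' _ hd x => abs_mweight_diag_sub_le hK hh0 hd x) hSg
    · refine this.trans_eq ?_
      norm_num
    · refine hg.le_of_abs_le fun i => ?_
      have := abs_le_of_abs_sub_le (abs_le_of_mem_cube hw) (K2_diag_support hK hh0 hh1 hx) i
      linarith
  have hEμ : ∀ η ∈ Hgrid P.ω n, μ (E η) ≤ ENNReal.ofReal ((5 / δ + 2) ^ 2 * (2 * exp (-c))) := by
    intro η hη
    have hη0 := Hgrid_pos hη
    have := hm.uniform_deviation (S := wset)
      (φ := fun w => mweight P.K (wmat w η) t)
      (R := 1) (δ := δ) (c := c) (gl := P.gl) (B := B) (τ := tauf P n)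
      (M₀ := 1 / η * Ksup P.K ^ 2) (V₀ := 1 / η * Ksup P.K ^ 4)
      (D := (4 * Ksup P.K ^ 2 + 6 * P.Q * Ksup P.K) * δ / η ^ 2) hn (by norm_num) hδ hc
      (fun w hw i => wset_abs_le hw i)
      (fun w hw => mweight_weight hK (wmat_det_pos hw hη0)
        (wmat_det_le hw hη0) fun x hx => ?_) hgl hB hτ (by positivity)
      (fun w hw w' hw' hd x => abs_mweight_wmat_sub_le hK hw hw' hη0 hη.2.2 hd t x) hSg
    · refine this.trans (ENNReal.ofReal_le_ofReal ?_)
      gcongr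
      norm_num
    · have h2 : ∀ i, |x i| ≤ 2 := fun i => by
        have := abs_le_of_abs_sub_le (abs_le_of_mem_cube ht)
          (K2_wmat_support hK hw hη0 hη.2.2 hx) i
        linarith
      exact ⟨hg.le_of_abs_le fun i => (h2 i).trans (by norm_num), hFB x h2⟩
  have hsub : (goodEvent P n t F c δ B L)ᶜ ⊆ A ∪ (G ∪ ⋃ k ∈ Finset.range (n + 1),
      {d | (2 : ℝ) ^ (-(k : ℤ)) ∈ Hgrid P.ω n ∧ d ∈ E ((2 : ℝ) ^ (-(k : ℤ)))}) := by
    intro d hd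
    by_contra hc'
    simp only [Set.mem_union, not_or, Set.mem_iUnion, not_exists] at hc'
    obtain ⟨h1, h2, h3⟩ := hc'
    have h1' : ∀ i, |(d i).2 - F (d i).1| ≤ tauf P n := Set.notMem_compl_iff.1 h1
    refine hd ⟨h1', fun η hη => ?_, ?_⟩
    · obtain ⟨k, hk, hkη⟩ := exists_lt_of_mem_Hgrid hn hmin1 hη
      have h4 : d ∉ E η := fun h => h3 k hk ⟨hkη ▸ hη, hkη ▸ h⟩
      intro w hw
      rw [estM_eq_mean_obs h1']
      exact Set.notMem_compl_iff.1 h4 w hw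
    · intro v hv
      rw [FhatAux_eq_mean_obs hh0 h1']
      exact Set.notMem_compl_iff.1 h2 v hv
  have hU : μ (⋃ k ∈ Finset.range (n + 1),
      {d | (2 : ℝ) ^ (-(k : ℤ)) ∈ Hgrid P.ω n ∧ d ∈ E ((2 : ℝ) ^ (-(k : ℤ)))})
      ≤ ENNReal.ofReal ((n + 1) * ((5 / δ + 2) ^ 2 * (2 * exp (-c)))) := by
    calc _ ≤ ∑ k ∈ Finset.range (n + 1),
          μ {d | (2 : ℝ) ^ (-(k : ℤ)) ∈ Hgrid P.ω n ∧ d ∈ E ((2 : ℝ) ^ (-(k : ℤ)))} :=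
          measure_biUnion_finset_le _ _
      _ ≤ ∑ k ∈ Finset.range (n + 1), ENNReal.ofReal ((5 / δ + 2) ^ 2 * (2 * exp (-c))) := by
          refine Finset.sum_le_sum fun k _ => ?_
          by_cases hk : (2 : ℝ) ^ (-(k : ℤ)) ∈ Hgrid P.ω n
          · exact (measure_mono fun d hd => (show _ ∧ _ from hd).2).trans (hEμ _ hk)
          · refine (measure_mono (t := ∅) fun d hd => hk (show _ ∧ _ from hd).1).trans ?_
            simp
      _ = _ := by
          rw [Finset.sum_const, Finset.card_range, ← ENNReal.ofReal_nsmul, nsmul_eq_mul]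
          push_cast
          rfl
  calc _ ≤ μ A + (μ G + _) := (measure_mono hsub).trans ((measure_union_le _ _).trans
        (add_le_add_right (measure_union_le _ _) _))
    _ ≤ ENNReal.ofReal _ + (ENNReal.ofReal _ + ENNReal.ofReal _) :=
        add_le_add hAμ (add_le_add hGμ hU)
    _ = _ := by
        have := hΥ.le
        rw [← ENNReal.ofReal_add (by positivity) (by positivity),
          ← ENNReal.ofReal_add (by positivity) (by positivity)]
        congr 1
        ring

end GoodEvent

section Levels

variable {P : Pars} {n : ℕ}

lemma rpow_neg_half_eq {a : ℝ} (ha : 0 ≤ a) : a ^ (-(1/2) : ℝ) = (√a)⁻¹ := by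
  rw [rpow_neg ha, sqrt_eq_rpow]

lemma sq_rpow_neg_half {a : ℝ} (ha : 0 ≤ a) : (a ^ (-(1/2) : ℝ)) ^ 2 = a⁻¹ := by
  rw [rpow_neg_half_eq ha, inv_pow, sq_sqrt ha]

lemma sigma2_nonneg : 0 ≤ sigma2 P := by
  refine Real.sSup_nonneg ?_
  rintro _ ⟨p, hp, rfl⟩
  exact integral_nonneg fun x => mul_nonneg (sq_nonneg x) (hp.1 x)

lemma devLevel_le (hgl : 0 < P.gl) {c M B D x : ℝ} (hB : 0 ≤ B)
    (hx : 0 ≤ x) (hM : M / n = x ^ 2) :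
    devLevel P n c M B D
      ≤ 2 * P.gl ^ (-(1/2) : ℝ) * Ksup P.K ^ 2 * (B + √(sigma2 P)) * √c * x
        + P.gl⁻¹ * Ksup P.K ^ 2 * (B + tauf P n) * c * x ^ 2
        + 2 * (D / P.gl * (B + tauf P n)) := by
  have hσ := sigma2_nonneg (P := P)
  have e1 : M * Ksup P.K ^ 4 / P.gl * (B ^ 2 + sigma2 P) * c / n
      = (P.gl ^ (-(1/2) : ℝ) * Ksup P.K ^ 2 * x) ^ 2 * ((B ^ 2 + sigma2 P) * c) := by
    rw [mul_pow, mul_pow, sq_rpow_neg_half hgl.le, ← hM]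
    ring
  have e2 : M * Ksup P.K ^ 2 / P.gl * (B + tauf P n) * c / n
      = P.gl⁻¹ * Ksup P.K ^ 2 * (B + tauf P n) * c * x ^ 2 := by
    rw [← hM]
    ring
  have h3 : √(B ^ 2 + sigma2 P) ≤ B + √(sigma2 P) := by
    refine (sqrt_le_left (by positivity)).2 ?_
    nlinarith [sq_sqrt hσ, sqrt_nonneg (sigma2 P), mul_nonneg hB (sqrt_nonneg (sigma2 P))]
  have hg0 : 0 ≤ P.gl ^ (-(1/2) : ℝ) := rpow_nonneg hgl.le _
  rw [devLevel, e1, e2, sqrt_mul (sq_nonneg _), sqrt_sq (by positivity), sqrt_mul (by positivity)]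
  refine add_le_add_left (add_le_add_left ?_ _) _
  calc 2 * (P.gl ^ (-(1/2) : ℝ) * Ksup P.K ^ 2 * x * (√(B ^ 2 + sigma2 P) * √c))
      ≤ 2 * (P.gl ^ (-(1/2) : ℝ) * Ksup P.K ^ 2 * x * ((B + √(sigma2 P)) * √c)) := by gcongr
    _ = _ := by ring

lemma Hgrid_rate_le (hω : 0 < P.ω) (hn : 0 < n) (hlog : 1 ≤ log n) {η : ℝ}
    (hη : η ∈ Hgrid P.ω n) :
    (η * n) ^ (-(1/2) : ℝ) ≤ 8 / 3 * log n ^ (-((2 + P.ω) / (2 * P.ω))) := by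
  have hn' : (0 : ℝ) < n := by exact_mod_cast hn
  have hl : 0 < log n := by linarith
  have hlo : log n ^ (1 + 2 / P.ω) / 2 ≤ η * n := by
    have h := mul_le_mul_of_nonneg_right hη.2.1 hn'.le
    rw [hmin] at h
    calc _ = (n : ℝ)⁻¹ * log n ^ (1 + 2 / P.ω) / 2 * n := by field_simp
      _ ≤ _ := h
  have h2 : ((1 : ℝ) / 2) ^ (-(1/2) : ℝ) ≤ 8 / 3 := by
    rw [rpow_neg_half_eq (by norm_num), inv_le_comm₀ (by positivity) (by norm_num)]
    exact le_sqrt_of_sq_le (by norm_num)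
  calc (η * n) ^ (-(1/2) : ℝ) ≤ (log n ^ (1 + 2 / P.ω) / 2) ^ (-(1/2) : ℝ) :=
        rpow_le_rpow_of_nonpos (by positivity) hlo (by norm_num)
    _ = ((1 : ℝ) / 2) ^ (-(1/2) : ℝ) * log n ^ (-((2 + P.ω) / (2 * P.ω))) := by
        rw [div_eq_mul_one_div, mul_rpow (by positivity) (by norm_num), ← rpow_mul hl.le, mul_comm]
        congr 2
        field_simp
        ring
    _ ≤ _ := by gcongr

lemma tauf_eq (hΩ : 0 < P.Ωc) (hr : 0 ≤ P.r) (hlog : 0 ≤ log n) :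
    tauf P n = (P.Ωc⁻¹ * (4 * P.r + 1)) ^ (1 / P.ω) * log n ^ (1 / P.ω) := by
  rw [tauf, mul_rpow (by positivity) hlog]

lemma tauf_mul_rate (hΩ : 0 < P.Ωc) (hω : 0 < P.ω) (hr : 0 ≤ P.r) (hlog : 0 < log n) :
    tauf P n * log n ^ (-((2 + P.ω) / (2 * P.ω)))
      = (P.Ωc⁻¹ * (4 * P.r + 1)) ^ (1 / P.ω) * log n ^ (-(1/2) : ℝ) := by
  rw [tauf_eq hΩ hr hlog.le, mul_assoc, ← rpow_add hlog]
  congr 2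
  field_simp
  ring

lemma two_le_two_mul_sqrt_two : (2 : ℝ) ≤ 2 * √2 := by
  have : (1 : ℝ) ≤ √2 := le_sqrt_of_sq_le (by norm_num)
  linarith

lemma devLevel_grid_le (hgl : 0 < P.gl) (hΩ : 0 < P.Ωc) (hω : 0 < P.ω) (hr : 0 ≤ P.r)
    (hn : 0 < n) (hlog : 1 ≤ log n) {c B D η : ℝ} (hc : 0 ≤ c) (hc1 : c ≤ c1f P n)
    (hc2 : c ≤ c2f P n) (hB : 0 ≤ B) (hη : η ∈ Hgrid P.ω n)
    (hD : 2 * (D / P.gl * (B + tauf P n))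
      ≤ Ksup P.K ^ 2 * √(log n) * (η * n) ^ (-(1/2) : ℝ)) :
    devLevel P n c (1 / η) B D
      ≤ (Ksup P.K ^ 2 * √(log n) + B * C1f P n + C2f P n) * (η * n) ^ (-(1/2) : ℝ) := by
  have hn' : (0 : ℝ) < n := by exact_mod_cast hn
  have hη0 := Hgrid_pos hη
  have hl : 0 < log n := by linarith
  have hrate := Hgrid_rate_le hω hn hlog hη
  have hτr := tauf_mul_rate hΩ hω hr hl
  have hτ0 : 0 ≤ tauf P n := by rw [tauf_eq hΩ hr hl.le]; positivity
  set x := (η * n) ^ (-(1/2) : ℝ) with hx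
  set y := log n ^ (-((2 + P.ω) / (2 * P.ω))) with hy
  have hx0 : 0 ≤ x := by positivity
  have hM : 1 / η / n = x ^ 2 := by
    rw [hx, sq_rpow_neg_half (by positivity)]
    field_simp
  have hg0 : 0 ≤ P.gl ^ (-(1/2) : ℝ) := rpow_nonneg hgl.le _
  have hσ : √(sigma2 P) ≤ max √(sigma2 P) 1 := le_max_left _ _
  have hs1 : √c ≤ √(c1f P n) := sqrt_le_sqrt hc1
  have hs2 : √c ≤ √(c2f P n) := sqrt_le_sqrt hc2
  have h22 := two_le_two_mul_sqrt_two
  have T1 : 2 * P.gl ^ (-(1/2) : ℝ) * Ksup P.K ^ 2 * (B + √(sigma2 P)) * √c * x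
      ≤ (B * (2 * √2 * P.gl ^ (-(1/2) : ℝ) * Ksup P.K ^ 2 * √(c1f P n))
        + 2 * √2 * max (√(sigma2 P)) 1 * P.gl ^ (-(1/2) : ℝ) * Ksup P.K ^ 2 * √(c2f P n)) * x := by
    calc _ = (B * (2 * P.gl ^ (-(1/2) : ℝ) * Ksup P.K ^ 2 * √c)
        + 2 * √(sigma2 P) * P.gl ^ (-(1/2) : ℝ) * Ksup P.K ^ 2 * √c) * x := by ring
      _ ≤ _ := by gcongr
  have T2 : P.gl⁻¹ * Ksup P.K ^ 2 * (B + tauf P n) * c * x ^ 2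
      ≤ (B * (8 / 3 * c1f P n * y * P.gl⁻¹ * Ksup P.K ^ 2)
        + 8 / 3 * c2f P n * log n ^ (-(1/2) : ℝ) * P.gl⁻¹ * Ksup P.K ^ 2
          * (P.Ωc⁻¹ * (4 * P.r + 1)) ^ ((1 : ℝ) / P.ω)) * x := by
    calc _ = (P.gl⁻¹ * Ksup P.K ^ 2 * (B + tauf P n) * c * x) * x := by ring
      _ ≤ (P.gl⁻¹ * Ksup P.K ^ 2 * (B + tauf P n) * c * (8 / 3 * y)) * x := by gcongr
      _ = (B * (8 / 3 * c * y * P.gl⁻¹ * Ksup P.K ^ 2)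
          + 8 / 3 * c * (tauf P n * y) * P.gl⁻¹ * Ksup P.K ^ 2) * x := by ring
      _ ≤ (B * (8 / 3 * c1f P n * y * P.gl⁻¹ * Ksup P.K ^ 2)
          + 8 / 3 * c2f P n * (tauf P n * y) * P.gl⁻¹ * Ksup P.K ^ 2) * x := by gcongr
      _ = _ := by rw [hτr]; ring
  refine (devLevel_le hgl hB hx0 hM).trans ?_
  rw [C1f, C2f, ← hy]
  linarith

lemma devLevel_aux_le (hgl : 0 < P.gl) (hn : 0 < n) (hh : 0 < frakh P.ω n)
    (hτ0 : 0 ≤ tauf P n) {c L D : ℝ} (hc : 0 ≤ c) (hc3 : c ≤ c3f P n)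
    (hc4 : c ≤ c4f P n) (hL : 0 ≤ L) :
    devLevel P n c (1 / frakh P.ω n ^ 2) L D
      ≤ (L * C3f P n + C4f P n) * ((n : ℝ) * frakh P.ω n ^ 2) ^ (-(1/2) : ℝ)
        + 2 * (D / P.gl * (L + tauf P n)) := by
  have hn' : (0 : ℝ) < n := by exact_mod_cast hn
  rw [C3f, C4f]
  set x := ((n : ℝ) * frakh P.ω n ^ 2) ^ (-(1/2) : ℝ) with hx
  have hx0 : 0 ≤ x := by positivity
  have hM : 1 / frakh P.ω n ^ 2 / n = x ^ 2 := by
    rw [hx, sq_rpow_neg_half (by positivity)]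
    field_simp
  have hg0 : 0 ≤ P.gl ^ (-(1/2) : ℝ) := rpow_nonneg hgl.le _
  have hσ : √(sigma2 P) ≤ max √(sigma2 P) 1 := le_max_left _ _
  have hs1 : √c ≤ √(c3f P n) := sqrt_le_sqrt hc3
  have hs2 : √c ≤ √(c4f P n) := sqrt_le_sqrt hc4
  have h22 := two_le_two_mul_sqrt_two
  have T1 : 2 * P.gl ^ (-(1/2) : ℝ) * Ksup P.K ^ 2 * (L + √(sigma2 P)) * √c * x
      ≤ (L * (2 * √2 * P.gl ^ (-(1/2) : ℝ) * Ksup P.K ^ 2 * √(c3f P n))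
        + 2 * √2 * max (√(sigma2 P)) 1 * P.gl ^ (-(1/2) : ℝ) * Ksup P.K ^ 2 * √(c4f P n)) * x := by
    calc _ = (L * (2 * P.gl ^ (-(1/2) : ℝ) * Ksup P.K ^ 2 * √c)
        + 2 * √(sigma2 P) * P.gl ^ (-(1/2) : ℝ) * Ksup P.K ^ 2 * √c) * x := by ring
      _ ≤ _ := by gcongr
  have T2 : P.gl⁻¹ * Ksup P.K ^ 2 * (L + tauf P n) * c * x ^ 2
      ≤ (L * (8 / 3 * P.gl⁻¹ * Ksup P.K ^ 2 * c3f P n * x)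
        + 8 / 3 * tauf P n * c4f P n * x * P.gl⁻¹ * Ksup P.K ^ 2) * x := by
    calc _ = (L * (1 * P.gl⁻¹ * Ksup P.K ^ 2 * c * x)
          + 1 * tauf P n * c * x * P.gl⁻¹ * Ksup P.K ^ 2) * x := by ring
      _ ≤ _ := by
        have : 0 ≤ P.gl⁻¹ := by positivity
        gcongr <;> norm_num
  refine (devLevel_le hgl hL hx0 hM).trans ?_
  linarith

end Levels

section Asymptotics

open Filter Topology

variable {P : Pars} {n : ℕ}

/-- The properties of a sample size beyond which the oracle bound takes effect. -/
structure LargeSample (P : Pars) (β L A : ℝ) (n : ℕ) : Prop where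
  n_pos : 0 < n
  log_ge : 1 ≤ log n
  frakh_le : frakh P.ω n ≤ 1
  hmin_le : hmin P.ω n ≤ ((n : ℝ)⁻¹ * log n) ^ (1 / (2 * β + 1))
  le_c1 : (4 * P.r + 12) * log n ≤ c1f P n
  le_c2 : (4 * P.r + 12) * log n ≤ c2f P n
  le_c3 : (4 * P.r + 12) * log n ≤ c3f P n
  le_c4 : (4 * P.r + 12) * log n ≤ c4f P n
  C1_nonneg : 0 ≤ C1f P n
  C2_nonneg : 0 ≤ C2f P n
  C5_nonneg : 0 ≤ C5f P n
  C1_le : C1f P n ≤ A * √(log n)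
  C2_le : C2f P n ≤ A * √(log n)
  C5_le : C5f P n ≤ A
  incr : (Ksup P.K ^ 2 + P.Q * Ksup P.K) / P.gl * (L + tauf P n) * (n : ℝ)⁻¹ ≤ 1 / 100
  aux : L * C3f P n * ((n : ℝ) * frakh P.ω n ^ 2) ^ (-(1/2) : ℝ)
    + 2 * (L * K1 P.K ^ 2) * frakh P.ω n ^ β ≤ 1 / 4

lemma tendsto_log_natCast : Tendsto (fun n : ℕ => log n) atTop atTop :=
  tendsto_log_atTop.comp tendsto_natCast_atTop_atTop

lemma tendsto_log_rpow_mul_rpow_neg (a : ℝ) {b : ℝ} (hb : 0 < b) :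
    Tendsto (fun n : ℕ => log n ^ a * (n : ℝ) ^ (-b)) atTop (𝓝 0) := by
  have h := ((isLittleO_log_rpow_rpow_atTop a hb).tendsto_div_nhds_zero).comp
    tendsto_natCast_atTop_atTop
  refine h.congr fun n => ?_
  simp only [Function.comp]
  rw [rpow_neg (Nat.cast_nonneg n), div_eq_mul_inv]

lemma tendsto_log_rpow_neg {b : ℝ} (hb : 0 < b) :
    Tendsto (fun n : ℕ => log n ^ (-b)) atTop (𝓝 0) :=
  (tendsto_rpow_neg_atTop hb).comp tendsto_log_natCast

lemma eventually_log_ge (a : ℝ) : ∀ᶠ n : ℕ in atTop, a ≤ log n :=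
  tendsto_log_natCast.eventually_ge_atTop a

lemma eventually_log_mul_mem {q : ℝ} (hq : 0 < q) : ∀ᶠ n : ℕ in atTop, ∀ τ : ℝ, 1 ≤ τ → τ ≤ n →
    log n ≤ log ((n : ℝ) ^ 2 * τ * q) ∧ log ((n : ℝ) ^ 2 * τ * q) ≤ 4 * log n := by
  filter_upwards [eventually_log_ge |log q|, eventually_gt_atTop 0] with n hn hn0 τ hτ1 hτn
  have hn' : (0 : ℝ) < n := by exact_mod_cast hn0
  have hτ0 : 0 < τ := by linarith
  rw [log_mul (by positivity) hq.ne', log_mul (by positivity) hτ0.ne', log_pow]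
  have h1 := log_nonneg hτ1
  have h2 := log_le_log hτ0 hτn
  obtain ⟨h3, h4⟩ := abs_le.1 hn
  push_cast
  constructor <;> linarith

lemma tendsto_tauf_mul_inv (hΩ : 0 < P.Ωc) (hr : 0 ≤ P.r) :
    Tendsto (fun n : ℕ => tauf P n * (n : ℝ)⁻¹) atTop (𝓝 0) := by
  have h := (tendsto_log_rpow_mul_rpow_neg (1 / P.ω) one_pos).const_mul
    ((P.Ωc⁻¹ * (4 * P.r + 1)) ^ (1 / P.ω))
  rw [mul_zero] at h
  refine h.congr' ?_
  filter_upwards [eventually_log_ge 0] with n hn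
  rw [tauf_eq hΩ hr hn, rpow_neg_one, mul_assoc]

lemma one_le_tauf (hΩ : P.Ωc ∈ Set.Ioc (0 : ℝ) 1) (hω : 0 < P.ω) (hr : 1 ≤ P.r)
    (hlog : 1 ≤ log n) : 1 ≤ tauf P n := by
  refine one_le_rpow ?_ (by positivity)
  have h1 : 1 ≤ P.Ωc⁻¹ := (one_le_inv₀ hΩ.1).2 hΩ.2
  have h2 : 1 ≤ P.Ωc⁻¹ * (4 * P.r + 1) := by nlinarith
  nlinarith

lemma frakh_sq (hn : 0 < n) {ω : ℝ} :
    (n : ℝ) * frakh ω n ^ 2 = log n ^ (1 + 1 / ω) := by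
  have hn' : (0 : ℝ) < n := by exact_mod_cast hn
  have := log_natCast_nonneg n
  rw [frakh, sq_sqrt (by positivity)]
  field_simp

lemma tendsto_frakh (ω : ℝ) : Tendsto (fun n : ℕ => frakh ω n) atTop (𝓝 0) := by
  have h := (tendsto_log_rpow_mul_rpow_neg (1 + 1 / ω) one_pos).sqrt
  rw [sqrt_zero] at h
  refine h.congr fun n => ?_
  rw [frakh, rpow_neg_one, mul_comm]

lemma eventually_hmin_le {ω β : ℝ} (hβ : 0 < β) : ∀ᶠ n : ℕ in atTop,
    hmin ω n ≤ ((n : ℝ)⁻¹ * log n) ^ (1 / (2 * β + 1)) := by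
  have hb : 0 < 1 - 1 / (2 * β + 1) := by
    rw [sub_pos, div_lt_one (by positivity)]
    linarith
  have h := tendsto_log_rpow_mul_rpow_neg (1 + 2 / ω) hb
  filter_upwards [h.eventually_le_const one_pos, eventually_log_ge 1, eventually_gt_atTop 0]
    with n h1 hlog hn0
  have hn' : (0 : ℝ) < n := by exact_mod_cast hn0
  calc hmin ω n = (log n ^ (1 + 2 / ω) * (n : ℝ) ^ (-(1 - 1 / (2 * β + 1))))
        * ((n : ℝ)⁻¹) ^ (1 / (2 * β + 1)) := by
        rw [hmin, inv_rpow hn'.le, ← rpow_neg hn'.le, mul_assoc, ← rpow_add hn', mul_comm]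
        congr 1
        rw [← rpow_neg_one]
        congr 1
        ring
    _ ≤ 1 * ((n : ℝ)⁻¹ * log n) ^ (1 / (2 * β + 1)) := by
        gcongr
        exact le_mul_of_one_le_right (by positivity) hlog
    _ = _ := one_mul _

/-- The logarithmic size of the constants entering the thresholds. -/
lemma eventually_c_mem (hΩ : P.Ωc ∈ Set.Ioc (0 : ℝ) 1) (hω : 0 < P.ω) (hgl : 0 < P.gl)
    (hQ : 0 < P.Q) (hr : 1 ≤ P.r) : ∀ᶠ n : ℕ in atTop,
      ∀ c ∈ ({c1f P n, c2f P n, c3f P n, c4f P n} : Set ℝ),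
      (4 * P.r + 12) * log n ≤ c ∧ c ≤ (4000 + 8 * P.r) * log n := by
  have hg0 : 0 < P.gl ^ (-(1/2) : ℝ) := rpow_pos_of_pos hgl _
  have hq1 : 0 < 16 * P.gl ^ (-(1/2) : ℝ) * (12 * P.Q + √2) := by positivity
  have hq3 : 0 < 5 * P.Q * P.gl ^ (-(1/2) : ℝ) := by positivity
  filter_upwards [eventually_log_mul_mem hq1, eventually_log_mul_mem hq3, eventually_log_ge 1,
    (tendsto_tauf_mul_inv hΩ.1 (by linarith)).eventually_le_const one_pos,
    eventually_gt_atTop 0] with n h1 h3 hlog hτn hn0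
  have hn1 : (1 : ℝ) ≤ n := by exact_mod_cast hn0
  have hτ1 := one_le_tauf hΩ hω hr hlog
  rw [mul_inv_le_iff₀ (by linarith), one_mul] at hτn
  have a1 := h1 1 le_rfl hn1
  have a2 := h1 _ hτ1 hτn
  have a3 := h3 1 le_rfl hn1
  have a4 := h3 _ hτ1 hτn
  have hrl : 0 ≤ P.r * log n := by positivity
  have e1 : 16 * (n : ℝ) ^ 2 * P.gl ^ (-(1/2) : ℝ) * (12 * P.Q + √2)
      = (n : ℝ) ^ 2 * 1 * (16 * P.gl ^ (-(1/2) : ℝ) * (12 * P.Q + √2)) := by ring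
  have e2 : 16 * (n : ℝ) ^ 2 * tauf P n * P.gl ^ (-(1/2) : ℝ) * (12 * P.Q + √2)
      = (n : ℝ) ^ 2 * tauf P n * (16 * P.gl ^ (-(1/2) : ℝ) * (12 * P.Q + √2)) := by ring
  have e3 : 5 * (n : ℝ) ^ 2 * P.Q * P.gl ^ (-(1/2) : ℝ)
      = (n : ℝ) ^ 2 * 1 * (5 * P.Q * P.gl ^ (-(1/2) : ℝ)) := by ring
  have e4 : 5 * (n : ℝ) ^ 2 * tauf P n * P.Q * P.gl ^ (-(1/2) : ℝ)
      = (n : ℝ) ^ 2 * tauf P n * (5 * P.Q * P.gl ^ (-(1/2) : ℝ)) := by ring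
  rintro c (rfl | rfl | rfl | rfl)
  · rw [c1f, e1]
    constructor <;> linarith [a1.1, a1.2]
  · rw [c2f, e2]
    constructor <;> linarith [a2.1, a2.2]
  · rw [c3f, e3]
    constructor <;> linarith [a3.1, a3.2]
  · rw [c4f, e4]
    constructor <;> linarith [a4.1, a4.2]

end Asymptotics

section Asymptotics

open Filter Topology

variable {P : Pars} {n : ℕ}

lemma log_mul_rate_le {ω : ℝ} (hω : 0 < ω) {l : ℝ} (hl : 1 ≤ l) :
    l * l ^ (-((2 + ω) / (2 * ω))) ≤ √l := by
  have hl0 : 0 < l := by linarith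
  rw [sqrt_eq_rpow]
  calc _ = l ^ (1 + -((2 + ω) / (2 * ω))) := by rw [rpow_add hl0, rpow_one]
    _ ≤ _ := rpow_le_rpow_of_exponent_le hl (by
      have : (2 + ω) / (2 * ω) = 1 / ω + 1 / 2 := by field_simp
      have := one_div_pos.2 hω
      linarith)

lemma log_mul_rpow_neg_half {l : ℝ} (hl : 0 ≤ l) : l * l ^ (-(1/2) : ℝ) = √l := by
  rw [rpow_neg_half_eq hl, ← div_eq_mul_inv, div_sqrt]

lemma sqrt_log_mul_rate (hn : 0 < n) (hlog : 0 < log n) {ω : ℝ} :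
    √(log n) * ((n : ℝ) * frakh ω n ^ 2) ^ (-(1/2) : ℝ) = log n ^ (-(1 / (2 * ω))) := by
  rw [frakh_sq hn, ← rpow_mul hlog.le, sqrt_eq_rpow, ← rpow_add hlog]
  congr 1
  ring

lemma eventually_largeSample (hΩ : P.Ωc ∈ Set.Ioc (0 : ℝ) 1) (hω : 0 < P.ω) (hgl : 0 < P.gl)
    (hQ : 0 < P.Q) (hr : 1 ≤ P.r) {β L : ℝ} (hβ : 0 < β) (hL : 0 < L) :
    ∃ A : ℝ, 0 < A ∧ ∀ᶠ n : ℕ in atTop, LargeSample P β L A n := by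
  set G := P.gl ^ (-(1/2) : ℝ) with hG
  set m := max (√(sigma2 P)) 1 with hm
  set A₀ := 4000 + 8 * P.r with hA₀
  set T := (P.Ωc⁻¹ * (4 * P.r + 1)) ^ ((1 : ℝ) / P.ω) with hT
  have hG0 : 0 < G := rpow_pos_of_pos hgl _
  have hgi : 0 < P.gl⁻¹ := inv_pos.2 hgl
  have hm0 : 0 < m := lt_max_of_lt_right one_pos
  have hA00 : 0 < A₀ := by rw [hA₀]; linarith
  have hΩi : 0 < P.Ωc⁻¹ := inv_pos.2 hΩ.1
  have hT0 : 0 < T := rpow_pos_of_pos (by positivity) _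
  set A₁ := 2 * √2 * G * Ksup P.K ^ 2 * √A₀ + 8 / 3 * A₀ * P.gl⁻¹ * Ksup P.K ^ 2 with hA₁
  set A₂ := 2 * √2 * m * G * Ksup P.K ^ 2 * √A₀ + 8 / 3 * A₀ * P.gl⁻¹ * Ksup P.K ^ 2 * T with hA₂
  have hA₁0 : 0 ≤ A₁ := by positivity
  have hA₂0 : 0 ≤ A₂ := by positivity
  refine ⟨A₁ + A₂ + K1 P.K ^ 2 + 1 / 2, by positivity, ?_⟩
  have hincr : Tendsto (fun n : ℕ => (Ksup P.K ^ 2 + P.Q * Ksup P.K) / P.gl * (L + tauf P n)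
      * (n : ℝ)⁻¹) atTop (𝓝 0) := by
    have h := ((tendsto_inv_atTop_nhds_zero_nat (𝕜 := ℝ)).const_mul L).add
      (tendsto_tauf_mul_inv hΩ.1 (by linarith : 0 ≤ P.r))
    have h2 := h.const_mul ((Ksup P.K ^ 2 + P.Q * Ksup P.K) / P.gl)
    rw [mul_zero, add_zero, mul_zero] at h2
    exact h2.congr fun n => by ring
  have haux : Tendsto (fun n : ℕ => L * A₁ * log n ^ (-(1 / (2 * P.ω)))
      + 2 * (L * K1 P.K ^ 2) * frakh P.ω n ^ β) atTop (𝓝 0) := by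
    have h1 := (tendsto_log_rpow_neg (b := 1 / (2 * P.ω)) (by positivity)).const_mul (L * A₁)
    have h2 := ((tendsto_frakh P.ω).rpow_const (p := β) (Or.inr hβ.le)).const_mul
      (2 * (L * K1 P.K ^ 2))
    rw [zero_rpow hβ.ne'] at h2
    simpa using h1.add h2
  filter_upwards [eventually_c_mem hΩ hω hgl hQ hr, eventually_gt_atTop 0, eventually_log_ge 1,
    (tendsto_frakh P.ω).eventually_le_const one_pos, eventually_hmin_le (ω := P.ω) hβ,
    hincr.eventually_le_const (by norm_num : (0 : ℝ) < 1 / 100),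
    haux.eventually_le_const (by norm_num : (0 : ℝ) < 1 / 4)] with n hc hn hlog hfr hmin hi ha
  obtain ⟨l1, u1⟩ := hc (c1f P n) (by simp)
  obtain ⟨l2, u2⟩ := hc (c2f P n) (by simp)
  obtain ⟨l3, u3⟩ := hc (c3f P n) (by simp)
  obtain ⟨l4, u4⟩ := hc (c4f P n) (by simp)
  have hn' : (0 : ℝ) < n := by exact_mod_cast hn
  have hl0 : 0 < log n := by linarith
  have hlow : 0 ≤ (4 * P.r + 12) * log n := by positivity
  have hu := sqrt_log_mul_rate hn hl0 (ω := P.ω)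
  have hu1 : log n ^ (-(1 / (2 * P.ω))) ≤ 1 :=
    rpow_le_one_of_one_le_of_nonpos hlog (neg_nonpos.2 (by positivity))
  have hτu : tauf P n * (log n ^ (-(1 / (2 * P.ω)))) ^ 2 = T := by
    rw [tauf_eq hΩ.1 (by linarith) hl0.le, ← hT, mul_assoc, ← rpow_natCast, ← rpow_mul hl0.le,
      ← rpow_add hl0]
    have : 1 / P.ω + -(1 / (2 * P.ω)) * ((2 : ℕ) : ℝ) = 0 := by
      push_cast
      field_simp
      ring
    rw [this, rpow_zero, mul_one]
  have hτ0 : 0 ≤ tauf P n := zero_le_one.trans (one_le_tauf hΩ hω hr hlog)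
  set u := log n ^ (-(1 / (2 * P.ω))) with hu_def
  have hu0 : 0 ≤ u := by positivity
  set y := ((n : ℝ) * frakh P.ω n ^ 2) ^ (-(1/2) : ℝ) with hy
  have hy0 : 0 ≤ y := by positivity
  have hsq : √(log n) ^ 2 = log n := sq_sqrt hl0.le
  have hsc : ∀ c, c ≤ A₀ * log n → √c ≤ √A₀ * √(log n) := fun c h =>
    (sqrt_le_sqrt h).trans (sqrt_mul hA00.le _).le
  have s1 := hsc _ u1
  have s2 := hsc _ u2
  have s3 := hsc _ u3
  have s4 := hsc _ u4
  have p1 := hlow.trans l1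
  have p2 := hlow.trans l2
  have p3 := hlow.trans l3
  have p4 := hlow.trans l4
  have C1b : C1f P n ≤ A₁ * √(log n) := by
    rw [C1f]
    calc _ ≤ 2 * √2 * G * Ksup P.K ^ 2 * (√A₀ * √(log n))
          + 8 / 3 * (A₀ * log n) * log n ^ (-((2 + P.ω) / (2 * P.ω))) * P.gl⁻¹
            * Ksup P.K ^ 2 := by gcongr
      _ = 2 * √2 * G * Ksup P.K ^ 2 * (√A₀ * √(log n))
          + 8 / 3 * A₀ * (log n * log n ^ (-((2 + P.ω) / (2 * P.ω)))) * P.gl⁻¹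
            * Ksup P.K ^ 2 := by ring
      _ ≤ 2 * √2 * G * Ksup P.K ^ 2 * (√A₀ * √(log n))
          + 8 / 3 * A₀ * √(log n) * P.gl⁻¹ * Ksup P.K ^ 2 := by
          gcongr
          exact log_mul_rate_le hω hlog
      _ = _ := by ring
  have C2b : C2f P n ≤ A₂ * √(log n) := by
    rw [C2f]
    calc _ ≤ 2 * √2 * m * G * Ksup P.K ^ 2 * (√A₀ * √(log n))
          + 8 / 3 * (A₀ * log n) * log n ^ (-(1/2) : ℝ) * P.gl⁻¹ * Ksup P.K ^ 2 * T := by gcongr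
      _ = 2 * √2 * m * G * Ksup P.K ^ 2 * (√A₀ * √(log n))
          + 8 / 3 * A₀ * (log n * log n ^ (-(1/2) : ℝ)) * P.gl⁻¹ * Ksup P.K ^ 2 * T := by ring
      _ = _ := by rw [log_mul_rpow_neg_half hl0.le]; ring
  have C3b : C3f P n * y ≤ A₁ * u := by
    rw [C3f, ← hy]
    calc _ ≤ (2 * √2 * G * Ksup P.K ^ 2 * (√A₀ * √(log n))
          + 8 / 3 * P.gl⁻¹ * Ksup P.K ^ 2 * (A₀ * log n) * y) * y := by gcongr
      _ = 2 * √2 * G * Ksup P.K ^ 2 * √A₀ * (√(log n) * y)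
          + 8 / 3 * A₀ * P.gl⁻¹ * Ksup P.K ^ 2 * (√(log n) * y) * (√(log n) * y) := by
          nth_rw 2 [← hsq]
          ring
      _ ≤ 2 * √2 * G * Ksup P.K ^ 2 * √A₀ * u + 8 / 3 * A₀ * P.gl⁻¹ * Ksup P.K ^ 2 * u * 1 := by
          rw [hu]
          gcongr
      _ = _ := by ring
  have C4b : y * C4f P n ≤ A₂ := by
    rw [C4f, ← hy]
    calc _ ≤ y * (2 * √2 * m * G * Ksup P.K ^ 2 * (√A₀ * √(log n))
          + 8 / 3 * tauf P n * (A₀ * log n) * y * P.gl⁻¹ * Ksup P.K ^ 2) := by gcongr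
      _ = 2 * √2 * m * G * Ksup P.K ^ 2 * √A₀ * (√(log n) * y)
          + 8 / 3 * A₀ * P.gl⁻¹ * Ksup P.K ^ 2 * (tauf P n * (√(log n) * y) ^ 2) := by
          nth_rw 2 [← hsq]
          ring
      _ ≤ 2 * √2 * m * G * Ksup P.K ^ 2 * √A₀ * 1 + 8 / 3 * A₀ * P.gl⁻¹ * Ksup P.K ^ 2 * T := by
          rw [hu, hτu]
          gcongr
      _ = _ := by ring
  have hC4 : 0 ≤ C4f P n := by
    rw [C4f]
    positivity
  have hs0 : 0 ≤ √(log n) := sqrt_nonneg _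
  have hk : 0 ≤ K1 P.K ^ 2 := sq_nonneg _
  refine ⟨hn, hlog, hfr, hmin, l1, l2, l3, l4, ?_, ?_, ?_, C1b.trans ?_, C2b.trans ?_, ?_, hi, ?_⟩
  · rw [C1f]
    positivity
  · rw [C2f]
    positivity
  · rw [C5f]
    positivity
  · gcongr
    linarith
  · gcongr
    linarith
  · rw [C5f, ← hy]
    linarith
  · refine le_trans (add_le_add_left ?_ _) ha
    rw [mul_assoc, mul_assoc]
    gcongr

end Asymptotics

section GoodBound

variable {P : Pars} {n : ℕ} {β L A : ℝ}

lemma inv_le_hmin (hn : 0 < n) (hlog : 1 ≤ log n) {ω : ℝ} (hω : 0 < ω) :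
    (n : ℝ)⁻¹ ≤ hmin ω n :=
  le_mul_of_one_le_right (by positivity) (one_le_rpow hlog (by positivity))

lemma inv_le_frakh (hn : 0 < n) (hlog : 1 ≤ log n) {ω : ℝ} (hω : 0 < ω) :
    (n : ℝ)⁻¹ ≤ frakh ω n := by
  have hn1 : (1 : ℝ) ≤ n := by exact_mod_cast hn
  refine le_sqrt_of_sq_le ?_
  calc ((n : ℝ)⁻¹) ^ 2 ≤ (n : ℝ)⁻¹ := by
        rw [sq]
        exact mul_le_of_le_one_left (by positivity) (inv_le_one_of_one_le₀ hn1)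
    _ ≤ _ := le_mul_of_one_le_right (by positivity) (one_le_rpow hlog (by positivity))

lemma LargeSample.grid_incr (hs : LargeSample P β L A n) (hK : KernelHyp P.K P.Q)
    (hω : 0 < P.ω) (hgl : 0 < P.gl) (hτ : 0 ≤ tauf P n) {B η : ℝ} (hB : 0 ≤ B) (hBL : B ≤ L)
    (hη : η ∈ Hgrid P.ω n) :
    2 * ((4 * Ksup P.K ^ 2 + 6 * P.Q * Ksup P.K) * ((n : ℝ)⁻¹) ^ 4 / η ^ 2 / P.gl
        * (B + tauf P n))
      ≤ Ksup P.K ^ 2 * √(log n) * (η * n) ^ (-(1/2) : ℝ) := by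
  have hS : 1 ≤ Ksup P.K := hK.one_le_Ksup
  have hQ := hK.Q_nonneg
  have hn1 : (1 : ℝ) ≤ n := by exact_mod_cast hs.n_pos
  have hn0 : (0 : ℝ) < n := by linarith
  have hη0 := Hgrid_pos hη
  have h1 := one_div_le_of_mem_Hgrid hs.n_pos (inv_le_hmin hs.n_pos hs.log_ge hω) hη
  have hinv : (n : ℝ)⁻¹ ≤ 1 := inv_le_one_of_one_le₀ hn1
  have hi := hs.incr
  have hL : 0 ≤ L := hB.trans hBL
  have hpos : 0 ≤ (Ksup P.K ^ 2 + P.Q * Ksup P.K) / P.gl * (L + tauf P n) := by positivity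
  calc _ = 2 * ((4 * Ksup P.K ^ 2 + 6 * (P.Q * Ksup P.K)) * ((n : ℝ)⁻¹) ^ 4 * (1 / η) ^ 2 / P.gl
        * (B + tauf P n)) := by ring
    _ ≤ 2 * (6 * (Ksup P.K ^ 2 + P.Q * Ksup P.K) * ((n : ℝ)⁻¹) ^ 4 * (2 * n) ^ 2 / P.gl
        * (L + tauf P n)) := by
        have : 4 * Ksup P.K ^ 2 + 6 * (P.Q * Ksup P.K)
          ≤ 6 * (Ksup P.K ^ 2 + P.Q * Ksup P.K) := by nlinarith
        gcongr
    _ = 48 * ((Ksup P.K ^ 2 + P.Q * Ksup P.K) / P.gl * (L + tauf P n) * (n : ℝ)⁻¹)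
        * (n : ℝ)⁻¹ := by
        field_simp
        ring
    _ ≤ 48 * (1 / 100) * (n : ℝ)⁻¹ := by gcongr
    _ ≤ 1 * 1 * (n : ℝ)⁻¹ := by
        have : (0 : ℝ) < (n : ℝ)⁻¹ := by positivity
        linarith
    _ ≤ Ksup P.K ^ 2 * √(log n) * (η * n) ^ (-(1/2) : ℝ) := by
        have e1 : 1 ≤ Ksup P.K ^ 2 := one_le_pow₀ hS
        have e2 : 1 ≤ √(log n) := one_le_sqrt.2 hs.log_ge
        have e3 : (n : ℝ)⁻¹ ≤ (η * n) ^ (-(1/2) : ℝ) := by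
          rw [← rpow_neg_one]
          calc (n : ℝ) ^ (-1 : ℝ) ≤ (n : ℝ) ^ (-(1/2) : ℝ) :=
                rpow_le_rpow_of_exponent_le hn1 (by norm_num)
            _ ≤ _ := rpow_le_rpow_of_nonpos (by positivity)
                (mul_le_of_le_one_left hn0.le hη.2.2) (by norm_num)
        gcongr

lemma LargeSample.aux_incr (hs : LargeSample P β L A n) (hK : KernelHyp P.K P.Q)
    (hω : 0 < P.ω) (hgl : 0 < P.gl) (hL : 0 ≤ L) (hτ : 0 ≤ tauf P n) :
    2 * (2 * P.Q * Ksup P.K * ((n : ℝ)⁻¹) ^ 4 / frakh P.ω n ^ 3 / P.gl * (L + tauf P n))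
      ≤ 1 / 4 := by
  have hS : 1 ≤ Ksup P.K := hK.one_le_Ksup
  have hQ := hK.Q_nonneg
  have hn1 : (1 : ℝ) ≤ n := by exact_mod_cast hs.n_pos
  have hn0 : (0 : ℝ) < n := by linarith
  have hi := hs.incr
  have hf := inv_le_frakh hs.n_pos hs.log_ge hω
  have hf0 : 0 < frakh P.ω n := (inv_pos.2 hn0).trans_le hf
  calc _ = 4 * (P.Q * Ksup P.K * ((n : ℝ)⁻¹) ^ 4 / frakh P.ω n ^ 3 / P.gl
        * (L + tauf P n)) := by ring
    _ ≤ 4 * ((Ksup P.K ^ 2 + P.Q * Ksup P.K) * ((n : ℝ)⁻¹) ^ 4 / ((n : ℝ)⁻¹) ^ 3 / P.gl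
        * (L + tauf P n)) := by
        have : P.Q * Ksup P.K ≤ Ksup P.K ^ 2 + P.Q * Ksup P.K := by nlinarith
        gcongr
    _ = 4 * ((Ksup P.K ^ 2 + P.Q * Ksup P.K) / P.gl * (L + tauf P n) * (n : ℝ)⁻¹) := by
        field_simp
    _ ≤ 4 * (1 / 100) := by gcongr
    _ ≤ _ := by norm_num

variable {t θ : Fin 2 → ℝ} {f : ℝ → ℝ} {b B δ : ℝ} {d : Fin n → (Fin 2 → ℝ) × ℝ}

lemma LargeSample.abs_FhatAux_sub_le (hs : LargeSample P β L A n) (hK : KernelHyp P.K P.Q)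
    (hmom : VanishingMoments P.K (mInt b)) (hβ : 0 < β) (hβb : β ≤ b) (hL : 0 < L)
    (hω : 0 < P.ω) (hgl : 0 < P.gl) (hr : 1 ≤ P.r) (hτ : 0 ≤ tauf P n)
    (hf : f ∈ HolderClass β L) (hθ : θ ∈ S1)
    (hd : d ∈ goodEvent P n t (fun x => f (dot2 x θ)) ((4 * P.r + 12) * log n)
      (((n : ℝ)⁻¹) ^ 4) B L) {v : Fin 2 → ℝ}
    (hv : v ∈ Set.Icc (fun _ : Fin 2 => -(5/2 : ℝ)) (fun _ : Fin 2 => (5/2 : ℝ))) :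
    |FhatAux P n d v - f (dot2 v θ)| ≤ C5f P n := by
  have hn0 : (0 : ℝ) < n := by exact_mod_cast hs.n_pos
  have hf0 : 0 < frakh P.ω n := (inv_pos.2 hn0).trans_le (inv_le_frakh hs.n_pos hs.log_ge hω)
  have hlog := hs.log_ge
  have h1 := hd.2.2 v hv
  have h2 := devLevel_aux_le (D := 2 * P.Q * Ksup P.K * ((n : ℝ)⁻¹) ^ 4 / frakh P.ω n ^ 3)
    hgl hs.n_pos hf0 hτ (by positivity) hs.le_c3 hs.le_c4 hL.le
  have h3 := hs.aux_incr hK hω hgl hL.le hτ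
  have h4 := abs_integral_diag_sub_le hK hmom hβ hβb hL hf hθ hf0 v
  have h5 := hs.aux
  rw [C5f]
  have h6 := abs_sub_le (FhatAux P n d v) (∫ x, mweight P.K
    !![(frakh P.ω n)⁻¹, 0; 0, (frakh P.ω n)⁻¹] v x * f (dot2 x θ)) (f (dot2 v θ))
  nlinarith [sq_nonneg (K1 P.K)]

lemma LargeSample.FhatInf_bounds (hs : LargeSample P β L A n)
    (hL : 0 < L) (hfL : ∀ y, |f y| ≤ L)
    (hF : ∀ v ∈ Set.Icc (fun _ : Fin 2 => -(5/2 : ℝ)) (fun _ : Fin 2 => (5/2 : ℝ)),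
      |FhatAux P n d v - f (dot2 v θ)| ≤ C5f P n)
    {x₀ : Fin 2 → ℝ} (hx₀ : ∀ i, |x₀ i| ≤ 2) :
    |f (dot2 x₀ θ)| ≤ FhatInf P n d ∧ FhatInf P n d ≤ 2 * L + 4 * A := by
  have hub : ∀ w ∈ {w | ∃ v ∈ Set.Icc (fun _ : Fin 2 => -(5/2 : ℝ)) (fun _ : Fin 2 => (5/2 : ℝ)),
      w = |FhatAux P n d v|}, w ≤ L + C5f P n := by
    rintro _ ⟨v, hv, rfl⟩
    have h := abs_sub_abs_le_abs_sub (FhatAux P n d v) (f (dot2 v θ))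
    linarith [hF v hv, hfL (dot2 v θ)]
  have hx : x₀ ∈ Set.Icc (fun _ : Fin 2 => -(5/2 : ℝ)) (fun _ : Fin 2 => (5/2 : ℝ)) :=
    mem_cube_of_abs_le fun i => (hx₀ i).trans (by norm_num)
  have hle := le_csSup ⟨_, hub⟩ ⟨x₀, hx, rfl⟩
  have hge : _ ≤ L + C5f P n := Real.sSup_le hub (by linarith [hs.C5_nonneg])
  have h := abs_sub_abs_le_abs_sub (f (dot2 x₀ θ)) (FhatAux P n d x₀)
  rw [abs_sub_comm] at h
  have h' := hF x₀ hx
  have hC5 := hs.C5_le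
  rw [FhatInf]
  constructor
  · linarith [abs_nonneg (f (dot2 x₀ θ))]
  · linarith

lemma exists_mem_Hgrid {ω h₀ : ℝ} (hmin : hmin ω n ≤ h₀) (h0 : 0 < h₀) (h1 : h₀ ≤ 1) :
    ∃ h ∈ Hgrid ω n, h ≤ h₀ ∧ h₀ ≤ 2 * h := by
  obtain ⟨k, hk1, hk2⟩ := exists_nat_pow_near_of_lt_one (x := h₀) (y := (1 / 2 : ℝ)) h0 h1
    (by norm_num) (by norm_num)
  have e : (2 : ℝ) ^ (-((k + 1 : ℕ) : ℤ)) = (1 / 2) ^ (k + 1) := by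
    rw [zpow_neg, zpow_natCast, one_div, inv_pow]
  have h2 : h₀ ≤ 2 * (1 / 2) ^ (k + 1) := by
    rw [pow_succ]
    linarith
  exact ⟨(1 / 2) ^ (k + 1), ⟨⟨k + 1, e.symm⟩, by linarith, hk1.le.trans h1⟩, hk1.le, h2⟩

lemma sqrt_log_mul_rpow_le (hn : 0 < n) (hlog : 0 < log n) (hβ : 0 < β) {h : ℝ}
    (hh : ((n : ℝ)⁻¹ * log n) ^ (1 / (2 * β + 1)) ≤ 2 * h) :
    √(log n) * (h * n) ^ (-(1/2) : ℝ) ≤ 2 * ((n : ℝ)⁻¹ * log n) ^ (β / (2 * β + 1)) := by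
  have hn' : (0 : ℝ) < n := by exact_mod_cast hn
  set ρ := (n : ℝ)⁻¹ * log n with hρ
  have hρ0 : 0 < ρ := by positivity
  have h00 : 0 < ρ ^ (1 / (2 * β + 1)) := by positivity
  have hh0 : 0 < h := by linarith
  rw [rpow_neg_half_eq (by positivity), ← div_eq_mul_inv, ← sqrt_div hlog.le]
  refine (sqrt_le_left (by positivity)).2 ?_
  have e : ρ = (ρ ^ (β / (2 * β + 1))) ^ 2 * ρ ^ (1 / (2 * β + 1)) := by
    rw [← rpow_natCast, ← rpow_mul hρ0.le, ← rpow_add hρ0]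
    conv_lhs => rw [← rpow_one ρ]
    congr 1
    push_cast
    field_simp
  calc log n / (h * n) = ρ / h := by rw [hρ]; field_simp
    _ ≤ (2 * ρ ^ (β / (2 * β + 1))) ^ 2 := by
      rw [div_le_iff₀ hh0, mul_pow]
      nth_rw 1 [e]
      have : 0 ≤ (ρ ^ (β / (2 * β + 1))) ^ 2 := sq_nonneg _
      nlinarith

lemma LargeSample.selEst_le (hs : LargeSample P β L A n) (hA : 0 < A) (hK : KernelHyp P.K P.Q)
    (hmom : VanishingMoments P.K (mInt b)) (hβ : 0 < β) (hβb : β ≤ b) (hL : 0 < L)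
    (hΩ : P.Ωc ∈ Set.Ioc (0 : ℝ) 1) (hω : 0 < P.ω) (hgl : 0 < P.gl) (hr : 1 ≤ P.r)
    (hf : f ∈ HolderClass β L) (hθ : θ ∈ S1) {x₀ : Fin 2 → ℝ} (hx₀ : ∀ i, |x₀ i| ≤ 2)
    (hd : d ∈ goodEvent P n t (fun x => f (dot2 x θ)) ((4 * P.r + 12) * log n)
      (((n : ℝ)⁻¹) ^ 4) |f (dot2 x₀ θ)| L)
    {sel : (Fin n → (Fin 2 → ℝ) × ℝ) → (Fin 2 → ℝ) × ℝ} (hsel : IsSelector P n t sel) :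
    |selEst P n t sel d - f (dot2 t θ)|
      ≤ (34 * (L * K1 P.K ^ 2 * 2 ^ β) + 36 * (Ksup P.K ^ 2 + (2 * L + 4 * A) * A + A))
        * ((n : ℝ)⁻¹ * log n) ^ (β / (2 * β + 1)) := by
  have hn := hs.n_pos
  have hlog := hs.log_ge
  have hl0 : 0 < log n := by linarith
  have hn' : (0 : ℝ) < n := by exact_mod_cast hn
  have hτ : 0 ≤ tauf P n := zero_le_one.trans (one_le_tauf hΩ hω hr hlog)
  have hfL := HolderClass.abs_le hf
  have hm0 : 0 < hmin P.ω n := (inv_pos.2 hn').trans_le (inv_le_hmin hn hlog hω)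
  obtain ⟨hI1, hI2⟩ := hs.FhatInf_bounds hL hfL (fun v hv =>
    hs.abs_FhatAux_sub_le hK hmom hβ hβb hL hω hgl hr hτ hf hθ hd hv) hx₀
  have hB := abs_nonneg (f (dot2 x₀ θ))
  have hI0 : 0 ≤ FhatInf P n d := hB.trans hI1
  have hC1 := hs.C1_nonneg
  have hC2 := hs.C2_nonneg
  set ρ := (n : ℝ)⁻¹ * log n with hρ
  have hρ0 : 0 < ρ := by positivity
  have hρ1 : ρ ≤ 1 := by
    rw [hρ, inv_mul_le_iff₀ hn', mul_one]
    exact (log_le_sub_one_of_pos hn').trans (by linarith)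
  obtain ⟨h, hh, hh1, hh2⟩ := exists_mem_Hgrid hs.hmin_le (by positivity)
    (rpow_le_one hρ0.le hρ1 (by positivity))
  have hh0 := Hgrid_pos hh
  have hor := selEst_oracle (d := d) hK hmom hβ hβb hL hf hθ hn hm0 (by positivity)
    (fun η hη w hw => ?_) hsel hh
  · refine hor.trans ?_
    have hb : h ^ β ≤ ρ ^ (β / (2 * β + 1)) := by
      calc h ^ β ≤ (ρ ^ (1 / (2 * β + 1))) ^ β := rpow_le_rpow hh0.le hh1 hβ.le
        _ = _ := by
          rw [← rpow_mul hρ0.le]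
          congr 1
          ring
    have hv := sqrt_log_mul_rpow_le hn hl0 hβ hh2
    have hTH : TH P n d h ≤ 4 * (Ksup P.K ^ 2 + (2 * L + 4 * A) * A + A)
        * ρ ^ (β / (2 * β + 1)) := by
      rw [TH]
      calc _ ≤ 2 * (Ksup P.K ^ 2 * √(log n) + (2 * L + 4 * A) * (A * √(log n)) + A * √(log n))
            * (h * n) ^ (-(1/2) : ℝ) := by
            have := hs.C1_le
            have := hs.C2_le
            gcongr
        _ = 2 * (Ksup P.K ^ 2 + (2 * L + 4 * A) * A + A)
            * (√(log n) * (h * n) ^ (-(1/2) : ℝ)) := by ring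
        _ ≤ 2 * (Ksup P.K ^ 2 + (2 * L + 4 * A) * A + A) * (2 * ρ ^ (β / (2 * β + 1))) := by
            gcongr
        _ = _ := by ring
    calc _ ≤ 17 * (2 * (L * K1 P.K ^ 2 * 2 ^ β) * ρ ^ (β / (2 * β + 1)))
          + 9 * (4 * (Ksup P.K ^ 2 + (2 * L + 4 * A) * A + A) * ρ ^ (β / (2 * β + 1))) := by
          gcongr
      _ = _ := by ring
  · refine (hd.2.1 η hη w hw).trans ?_
    have hη0 := Hgrid_pos hη
    refine (devLevel_grid_le hgl hΩ.1 hω (by linarith) hn hlog (by positivity) hs.le_c1 hs.le_c2 hB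
      hη (hs.grid_incr hK hω hgl hτ hB (hfL _) hη)).trans ?_
    calc _ ≤ (Ksup P.K ^ 2 * √(log n) + FhatInf P n d * C1f P n + C2f P n)
          * (η * n) ^ (-(1/2) : ℝ) := by gcongr
      _ = TH P n d η / 2 := by rw [TH]; ring

end GoodBound

section BadEvent

lemma integral_le_of_lintegral_ofReal_le {α : Type*} [MeasurableSpace α] {μ : Measure α}
    {φ : α → ℝ} (hφ : ∀ x, 0 ≤ φ x) {C : ℝ} (hC : 0 ≤ C)
    (h : ∫⁻ x, ENNReal.ofReal (φ x) ∂μ ≤ ENNReal.ofReal C) : ∫ x, φ x ∂μ ≤ C := by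
  by_cases hm : AEStronglyMeasurable φ μ
  · rw [integral_eq_lintegral_of_nonneg_ae (Filter.Eventually.of_forall hφ) hm]
    exact ENNReal.toReal_le_of_le_ofReal hC h
  · rwa [integral_non_aestronglyMeasurable hm]

lemma rpow_sum_le_split {n : ℕ} (hn : 0 < n) {r : ℝ} (hr : 1 ≤ r) {a : Fin n → ℝ}
    (ha : ∀ i, 0 ≤ a i) :
    (∑ i, a i) ^ r
      ≤ ∑ i, ((n : ℝ) ^ (-r - 1) * a i ^ (2 * r) + (n : ℝ) ^ (3 * r - 1)) := by
  have hn' : (0 : ℝ) < n := by exact_mod_cast hn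
  have h1 := Real.rpow_sum_le_const_mul_sum_rpow Finset.univ a hr
  simp only [Finset.card_univ, Fintype.card_fin, abs_of_nonneg (ha _)] at h1
  refine h1.trans ?_
  rw [Finset.mul_sum]
  refine Finset.sum_le_sum fun i _ => ?_
  have e1 : (n : ℝ) ^ (-r - 1) = (n : ℝ) ^ (r - 1) * ((n : ℝ) ^ (-r)) ^ 2 := by
    rw [← rpow_natCast, ← rpow_mul hn'.le, ← rpow_add hn']
    congr 1; push_cast; ring
  have e2 : (n : ℝ) ^ (3 * r - 1) = (n : ℝ) ^ (r - 1) * ((n : ℝ) ^ r) ^ 2 := by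
    rw [← rpow_natCast, ← rpow_mul hn'.le, ← rpow_add hn']
    congr 1; push_cast; ring
  have e3 : a i ^ (2 * r) = (a i ^ r) ^ 2 := by
    rw [← rpow_natCast, ← rpow_mul (ha i)]
    congr 1; push_cast; ring
  have e4 : (n : ℝ) ^ (-r) * (n : ℝ) ^ r = 1 := by
    rw [← rpow_add hn']; simp
  rw [e1, e2, e3]
  calc (n : ℝ) ^ (r - 1) * a i ^ r
      = (n : ℝ) ^ (r - 1) * (((n : ℝ) ^ (-r) * a i ^ r) * (n : ℝ) ^ r) := by
        linear_combination -(n : ℝ) ^ (r - 1) * a i ^ r * e4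
    _ ≤ (n : ℝ) ^ (r - 1) * (((n : ℝ) ^ (-r) * a i ^ r) ^ 2 + ((n : ℝ) ^ r) ^ 2) := by
        gcongr
        nlinarith [sq_nonneg ((n : ℝ) ^ (-r) * a i ^ r - (n : ℝ) ^ r),
          sq_nonneg ((n : ℝ) ^ (-r) * a i ^ r), sq_nonneg ((n : ℝ) ^ r)]
    _ = _ := by ring

lemma setLIntegral_rpow_sum_le {α : Type*} [MeasurableSpace α] {ν : Measure α}
    [IsProbabilityMeasure ν] {n : ℕ} (hn : 0 < n) {r M κ : ℝ} (hr : 1 ≤ r) (hM : 0 ≤ M)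
    (hκ : 0 ≤ κ) {a : α → ℝ} (ham : Measurable a) (ha : ∀ z, 0 ≤ a z)
    (hmom : ∫⁻ z, ENNReal.ofReal (a z ^ (2 * r)) ∂ν ≤ ENNReal.ofReal M)
    {S : Set (Fin n → α)}
    (hS : (Measure.pi fun _ : Fin n => ν) S ≤ ENNReal.ofReal (κ * (n : ℝ) ^ (-(4 * r)))) :
    ∫⁻ d in S, ENNReal.ofReal ((∑ i, a (d i)) ^ r) ∂(Measure.pi fun _ : Fin n => ν)
      ≤ ENNReal.ofReal ((M + κ) * (n : ℝ) ^ (-r)) := by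
  have hn' : (0 : ℝ) < n := by exact_mod_cast hn
  set μ := Measure.pi fun _ : Fin n => ν
  have hmeas : ∀ i : Fin n, Measurable fun d : Fin n → α => a (d i) :=
    fun i => ham.comp (measurable_pi_apply i)
  calc ∫⁻ d in S, ENNReal.ofReal ((∑ i, a (d i)) ^ r) ∂μ
      ≤ ∫⁻ d in S, ∑ i, (ENNReal.ofReal ((n : ℝ) ^ (-r - 1)) * ENNReal.ofReal (a (d i) ^ (2 * r))
          + ENNReal.ofReal ((n : ℝ) ^ (3 * r - 1))) ∂μ := by
        refine lintegral_mono fun d => ?_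
        refine (ENNReal.ofReal_le_ofReal (rpow_sum_le_split hn hr fun i => ha (d i))).trans ?_
        rw [ENNReal.ofReal_sum_of_nonneg fun i _ => by
          have := ha (d i)
          positivity]
        refine Finset.sum_le_sum fun i _ => ?_
        rw [← ENNReal.ofReal_mul (by positivity)]
        exact ENNReal.ofReal_add_le
    _ = ∑ i, ∫⁻ d in S, (ENNReal.ofReal ((n : ℝ) ^ (-r - 1)) * ENNReal.ofReal (a (d i) ^ (2 * r))
          + ENNReal.ofReal ((n : ℝ) ^ (3 * r - 1))) ∂μ :=
        lintegral_finsetSum _ fun i _ => by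
          have := hmeas i
          fun_prop
    _ ≤ ∑ _i : Fin n, ENNReal.ofReal ((M + κ) * (n : ℝ) ^ (-r - 1)) := by
        refine Finset.sum_le_sum fun i _ => ?_
        rw [lintegral_add_right _ measurable_const, setLIntegral_const, lintegral_const_mul _
          (by have := hmeas i; fun_prop)]
        have h1 : ∫⁻ d in S, ENNReal.ofReal (a (d i) ^ (2 * r)) ∂μ ≤ ENNReal.ofReal M := by
          refine (setLIntegral_le_lintegral _ _).trans (le_trans (le_of_eq ?_) hmom)
          exact (measurePreserving_eval (fun _ : Fin n => ν) i).lintegral_comp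
            (f := fun z => ENNReal.ofReal (a z ^ (2 * r))) (by fun_prop)
        calc _ ≤ ENNReal.ofReal ((n : ℝ) ^ (-r - 1)) * ENNReal.ofReal M
              + ENNReal.ofReal ((n : ℝ) ^ (3 * r - 1))
                * ENNReal.ofReal (κ * (n : ℝ) ^ (-(4 * r))) := by gcongr
          _ = ENNReal.ofReal ((n : ℝ) ^ (-r - 1) * M
              + (n : ℝ) ^ (3 * r - 1) * (κ * (n : ℝ) ^ (-(4 * r)))) := by
            rw [← ENNReal.ofReal_mul (by positivity), ← ENNReal.ofReal_mul (by positivity),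
              ← ENNReal.ofReal_add (by positivity) (by positivity)]
          _ = _ := by
            have : (n : ℝ) ^ (-r - 1) = (n : ℝ) ^ (3 * r - 1) * (n : ℝ) ^ (-(4 * r)) := by
              rw [← rpow_add hn']
              congr 1; ring
            rw [this]
            congr 1; ring
    _ = _ := by
        rw [Finset.sum_const, Finset.card_univ, Fintype.card_fin, nsmul_eq_mul,
          ← ENNReal.ofReal_natCast, ← ENNReal.ofReal_mul hn'.le]
        have : (n : ℝ) ^ (-r) = n * (n : ℝ) ^ (-r - 1) := by
          rw [rpow_sub hn', rpow_one]
          field_simp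
        rw [this]
        congr 1; ring

variable {P : Pars} {n : ℕ} {t : Fin 2 → ℝ}

lemma abs_selEst_le (hK : KernelHyp P.K P.Q) (hgl : 0 < P.gl) (hg : DesignOK P.g P.gl)
    (ht : t ∈ Set.Icc (fun _ : Fin 2 => -(1/2 : ℝ)) (fun _ : Fin 2 => (1/2 : ℝ)))
    (hn : 0 < n) (hmin1 : (n : ℝ)⁻¹ ≤ hmin P.ω n)
    {sel : (Fin n → (Fin 2 → ℝ) × ℝ) → (Fin 2 → ℝ) × ℝ} (hsel : IsSelector P n t sel)
    (d : Fin n → (Fin 2 → ℝ) × ℝ) :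
    |selEst P n t sel d| ≤ ∑ i, 2 * Ksup P.K ^ 2 / P.gl * |(d i).2| := by
  have hn' : (0 : ℝ) < n := by exact_mod_cast hn
  obtain ⟨hθ, hh, -⟩ := hsel d
  have hw := S1_subset_wset hθ
  have hh0 := Hgrid_pos hh
  have hdet : (Emat (sel d).1 (sel d).2).det ≤ 2 * n :=
    (wmat_det_le hw hh0).trans (one_div_le_of_mem_Hgrid hn hmin1 hh)
  have hdet0 : 0 < (Emat (sel d).1 (sel d).2).det := wmat_det_pos hw hh0
  rw [selEst, estM, abs_mul, abs_of_pos (by positivity)]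
  calc _ ≤ 2 * ∑ i, Ksup P.K ^ 2 / P.gl * |(d i).2| := by
        refine mul_le_mul ((div_le_iff₀ hn').2 hdet)
          ((Finset.abs_sum_le_sum_abs _ _).trans (Finset.sum_le_sum fun i _ => ?_))
          (abs_nonneg _) two_pos.le
        by_cases h0 : K2 P.K ((Emat (sel d).1 (sel d).2).mulVec ((d i).1 - t)) = 0
        · rw [h0, zero_mul, zero_div, abs_zero]
          positivity
        · have hx := abs_le_of_abs_sub_le (abs_le_of_mem_cube ht)
            (K2_wmat_support hK hw hh0 hh.2.2 h0)
          have hgx : P.gl ≤ P.g (d i).1 :=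
            hg.le_of_abs_le fun j => (hx j).trans (by norm_num)
          rw [abs_div, abs_mul, abs_of_pos (hgl.trans_le hgx), mul_div_right_comm]
          gcongr
          exact abs_K2_le hK _
    _ = _ := by
        rw [Finset.mul_sum]
        exact Finset.sum_congr rfl fun i _ => by ring

end BadEvent

section Risk

variable {P : Pars} {n : ℕ} {t : Fin 2 → ℝ} {β b L A : ℝ}

lemma exp_neg_tauf (hΩ : 0 < P.Ωc) (hω : 0 < P.ω) (hr : 1 ≤ P.r) (hn : 0 < n) :
    exp (-P.Ωc * tauf P n ^ P.ω) = (n : ℝ) ^ (-(4 * P.r + 1)) := by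
  have hn1 : (1 : ℝ) ≤ n := by exact_mod_cast hn
  have hlog : 0 ≤ log n := log_nonneg hn1
  have h1 : tauf P n ^ P.ω = P.Ωc⁻¹ * (4 * P.r + 1) * log n := by
    rw [tauf, ← rpow_mul (by positivity), one_div, inv_mul_cancel₀ hω.ne', rpow_one]
  rw [h1, rpow_def_of_pos (by positivity)]
  congr 1
  field_simp

lemma complement_rate_le {Υ r : ℝ} (hΥ : 0 < Υ) (hn : 0 < n) :
    n * (2 * (Υ * (n : ℝ) ^ (-(4 * r + 1))))
        + (n + 2) * ((5 / ((n : ℝ)⁻¹) ^ 4 + 2) ^ 2 * (2 * exp (-((4 * r + 12) * log n))))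
      ≤ (2 * Υ + 294) * (n : ℝ) ^ (-(4 * r)) := by
  have hn1 : (1 : ℝ) ≤ n := by exact_mod_cast hn
  have hn0 : (0 : ℝ) < n := by linarith
  have hE : exp (-((4 * r + 12) * log n)) = (n : ℝ) ^ (-(4 * r)) * ((n : ℝ)⁻¹) ^ 12 := by
    rw [inv_pow, ← rpow_natCast, ← rpow_neg hn0.le, ← rpow_add hn0, rpow_def_of_pos hn0]
    congr 1
    push_cast
    ring
  have hT : n * (2 * (Υ * (n : ℝ) ^ (-(4 * r + 1)))) = 2 * Υ * (n : ℝ) ^ (-(4 * r)) := by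
    rw [show -(4 * r + 1) = -(4 * r) - 1 by ring, rpow_sub hn0, rpow_one]
    field_simp
  have hδ : 5 / ((n : ℝ)⁻¹) ^ 4 + 2 ≤ 7 * (n : ℝ) ^ 4 := by
    have : (1 : ℝ) ≤ (n : ℝ) ^ 4 := one_le_pow₀ hn1
    rw [inv_pow, div_inv_eq_mul]
    linarith
  rw [hT, hE, add_mul (2 * Υ) 294]
  refine add_le_add le_rfl ?_
  calc (n + 2 : ℝ) * ((5 / ((n : ℝ)⁻¹) ^ 4 + 2) ^ 2
        * (2 * ((n : ℝ) ^ (-(4 * r)) * ((n : ℝ)⁻¹) ^ 12)))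
      ≤ (3 * n) * ((7 * (n : ℝ) ^ 4) ^ 2 * (2 * ((n : ℝ) ^ (-(4 * r)) * ((n : ℝ)⁻¹) ^ 12))) := by
        gcongr
        linarith
    _ = 294 * (n : ℝ) ^ (-(4 * r)) * ((n : ℝ)⁻¹) ^ 3 := by
        field_simp
        norm_num
    _ ≤ 294 * (n : ℝ) ^ (-(4 * r)) * 1 := by
        gcongr
        exact pow_le_one₀ (by positivity) (inv_le_one_of_one_le₀ hn1)
    _ = _ := mul_one _

lemma model_of_holder {f p : ℝ → ℝ} (hg : DesignOK P.g P.gl) (hp : p ∈ NoiseClass P.Υ P.Ωc P.ω)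
    (hf : f ∈ HolderClass β L) (θ : Fin 2 → ℝ) : Model P.g p fun x => f (dot2 x θ) where
  g_nonneg := hg.1
  g_one := hg.2.1
  p_nonneg := hp.1
  p_one := hp.2.1
  p_symm := hp.2.2.1
  F_meas := by
    have : Continuous f := HolderClass.continuous hf
    unfold dot2
    exact Continuous.measurable (by fun_prop)

lemma exists_max_abs_on_cube {f : ℝ → ℝ} (hf : Continuous f) (θ : Fin 2 → ℝ) :
    ∃ x₀ : Fin 2 → ℝ, (∀ i, |x₀ i| ≤ 2) ∧
      ∀ x, (∀ i, |x i| ≤ 2) → |f (dot2 x θ)| ≤ |f (dot2 x₀ θ)| := by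
  have hc : Continuous fun x : Fin 2 → ℝ => |f (dot2 x θ)| := by
    unfold dot2
    fun_prop
  obtain ⟨x₀, hx₀, hmax⟩ := (isCompact_Icc (a := fun _ : Fin 2 => (-2 : ℝ))
    (b := fun _ => 2)).exists_isMaxOn ⟨0, fun _ => by simp, fun _ => by simp⟩ hc.continuousOn
  exact ⟨x₀, abs_le_of_mem_cube hx₀, fun x hx => hmax (mem_cube_of_abs_le hx)⟩

lemma Model.joint_envelope_moment {g : (Fin 2 → ℝ) → ℝ} {p : ℝ → ℝ} {F : (Fin 2 → ℝ) → ℝ}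
    (h : Model g p F) {q C D : ℝ} (hL : 0 ≤ L) (hD : 0 ≤ D) (hq : 1 ≤ q) (hC : 0 ≤ C)
    (hF : ∀ x, |F x| ≤ L)
    (hp : ∫⁻ e, ENNReal.ofReal (|e| ^ q) ∂noiseLaw p ≤ ENNReal.ofReal C) :
    ∫⁻ z, ENNReal.ofReal ((D * |z.2| + L) ^ q) ∂jointLaw g p F
      ≤ ENNReal.ofReal (2 ^ (q - 1) * (D ^ q * (2 ^ q * (L ^ q + C)) + L ^ q)) := by
  have := h.joint_prob
  calc _ ≤ ∫⁻ z, (ENNReal.ofReal (2 ^ (q - 1) * D ^ q) * ENNReal.ofReal (|z.2| ^ q)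
          + ENNReal.ofReal (2 ^ (q - 1) * L ^ q)) ∂jointLaw g p F := by
        refine lintegral_mono fun z => ?_
        rw [← ENNReal.ofReal_mul (by positivity), ← ENNReal.ofReal_add (by positivity)
          (by positivity)]
        have hsum : (D * |z.2| + L) ^ q ≤ 2 ^ (q - 1) * ((D * |z.2|) ^ q + L ^ q) := by
          exact_mod_cast NNReal.rpow_add_le_mul_rpow_add_rpow ⟨D * |z.2|, by positivity⟩ ⟨L, hL⟩ hq
        refine ENNReal.ofReal_le_ofReal (hsum.trans (le_of_eq ?_))
        rw [mul_rpow hD (abs_nonneg _)]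
        ring
    _ = ENNReal.ofReal (2 ^ (q - 1) * D ^ q) * (∫⁻ z, ENNReal.ofReal (|z.2| ^ q) ∂jointLaw g p F)
          + ENNReal.ofReal (2 ^ (q - 1) * L ^ q) := by
        rw [lintegral_add_right _ measurable_const, lintegral_const_mul _ (by fun_prop),
          lintegral_const, measure_univ, mul_one]
    _ ≤ ENNReal.ofReal (2 ^ (q - 1) * D ^ q) * ENNReal.ofReal (2 ^ q * (L ^ q + C))
          + ENNReal.ofReal (2 ^ (q - 1) * L ^ q) := by
        gcongr
        exact h.joint_moment hL (by linarith) hC hF hp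
    _ = _ := by
        rw [← ENNReal.ofReal_mul (by positivity), ← ENNReal.ofReal_add (by positivity)
          (by positivity)]
        congr 1
        ring

end Risk

section Risk

variable {P : Pars} {n : ℕ} {t : Fin 2 → ℝ} {β b L A : ℝ}

/-- The constant of the risk bound: `a` bounds the normalized loss on the good event, `D` is the
constant of the envelope of the estimator and `C` bounds the noise moment of order `2r`. -/
def riskConst (P : Pars) (L a D C : ℝ) : ℝ :=
  a ^ P.r + (2 ^ (2 * P.r - 1) * (D ^ (2 * P.r) * (2 ^ (2 * P.r) * (L ^ (2 * P.r) + C))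
    + L ^ (2 * P.r)) + (2 * P.Υ + 294))

lemma LargeSample.risk_le (hs : LargeSample P β L A n) (hA : 0 < A) (hK : KernelHyp P.K P.Q)
    (hmom : VanishingMoments P.K (mInt b)) (hβ : 0 < β) (hβb : β ≤ b) (hL : 0 < L)
    (hΥ : 0 < P.Υ) (hΩ : P.Ωc ∈ Set.Ioc (0 : ℝ) 1) (hω : 0 < P.ω) (hgl : 0 < P.gl)
    (hg : DesignOK P.g P.gl) (hr : 1 ≤ P.r)
    (ht : t ∈ Set.Icc (fun _ : Fin 2 => -(1/2 : ℝ)) (fun _ : Fin 2 => (1/2 : ℝ)))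
    {C : ℝ} (hC : 0 ≤ C) {p : ℝ → ℝ} (hp : p ∈ NoiseClass P.Υ P.Ωc P.ω)
    (hpC : ∫⁻ e, ENNReal.ofReal (|e| ^ (2 * P.r)) ∂noiseLaw p ≤ ENNReal.ofReal C)
    {f : ℝ → ℝ} (hf : f ∈ HolderClass β L) {θ : Fin 2 → ℝ} (hθ : θ ∈ S1)
    {sel : (Fin n → (Fin 2 → ℝ) × ℝ) → (Fin 2 → ℝ) × ℝ} (hsel : IsSelector P n t sel) :
    ∫ d, |selEst P n t sel d - f (dot2 t θ)| ^ P.r ∂(dataLaw n P.g p fun x => f (dot2 x θ))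
      ≤ riskConst P L
          (34 * (L * K1 P.K ^ 2 * 2 ^ β) + 36 * (Ksup P.K ^ 2 + (2 * L + 4 * A) * A + A))
          (2 * Ksup P.K ^ 2 / P.gl) C
        * (((n : ℝ)⁻¹ * log n) ^ (β / (2 * β + 1))) ^ P.r := by
  have hn := hs.n_pos
  have hn1 : (1 : ℝ) ≤ n := by exact_mod_cast hn
  have hn0 : (0 : ℝ) < n := by linarith
  have hlog := hs.log_ge
  have hm := model_of_holder hg hp hf θ
  have := hm.joint_prob
  have hfL := HolderClass.abs_le hf
  have hmin1 := inv_le_hmin hn hlog hω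
  have hh0 : 0 < frakh P.ω n := (inv_pos.2 hn0).trans_le (inv_le_frakh hn hlog hω)
  obtain ⟨x₀, hx₀, hmax⟩ := exists_max_abs_on_cube (HolderClass.continuous hf) θ
  have hgood := fun d hd => hs.selEst_le (t := t) (d := d) hA hK hmom hβ hβb hL hΩ hω hgl hr hf hθ
    hx₀ hd hsel
  set a := 34 * (L * K1 P.K ^ 2 * 2 ^ β) + 36 * (Ksup P.K ^ 2 + (2 * L + 4 * A) * A + A)
  set D := 2 * Ksup P.K ^ 2 / P.gl with hD
  set G := goodEvent P n t (fun x => f (dot2 x θ)) ((4 * P.r + 12) * log n)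
    (((n : ℝ)⁻¹) ^ 4) |f (dot2 x₀ θ)| L
  set μ := Measure.pi fun _ : Fin n => jointLaw P.g p fun x => f (dot2 x θ)
  set ρ := ((n : ℝ)⁻¹ * log n) ^ (β / (2 * β + 1))
  set M := 2 ^ (2 * P.r - 1) * (D ^ (2 * P.r) * (2 ^ (2 * P.r) * (L ^ (2 * P.r) + C))
    + L ^ (2 * P.r)) with hM
  have hD0 : 0 ≤ D := by positivity
  have ha0 : 0 ≤ a := by positivity
  have hM0 : 0 ≤ M := by positivity
  have hρ0 : 0 ≤ ρ := by positivity
  have hρn : (n : ℝ)⁻¹ ≤ ρ := by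
    have e1 : (n : ℝ)⁻¹ ≤ (n : ℝ)⁻¹ * log n := le_mul_of_one_le_right (by positivity) hlog
    calc (n : ℝ)⁻¹ = ((n : ℝ)⁻¹) ^ (1 : ℝ) := (rpow_one _).symm
      _ ≤ ((n : ℝ)⁻¹) ^ (β / (2 * β + 1)) := by
        refine rpow_le_rpow_of_exponent_ge (by positivity) (inv_le_one_of_one_le₀ hn1) ?_
        rw [div_le_one (by positivity)]
        linarith
      _ ≤ ρ := rpow_le_rpow (by positivity) e1 (by positivity)
  have hbad : μ Gᶜ ≤ ENNReal.ofReal ((2 * P.Υ + 294) * (n : ℝ) ^ (-(4 * P.r))) := by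
    refine (goodEvent_compl_le hΥ hΩ.1 hω hK hgl hg hm hp ht (by positivity) (by positivity)
      (abs_nonneg _) hL.le hmax (fun _ => hfL _) hn hmin1 hh0 hs.frakh_le
      (zero_lt_one.trans_le (one_le_tauf hΩ hω hr hlog))).trans (ENNReal.ofReal_le_ofReal ?_)
    rw [exp_neg_tauf hΩ.1 hω hr hn]
    exact complement_rate_le hΥ hn
  have hloss : ∀ d, |selEst P n t sel d - f (dot2 t θ)| ≤ ∑ i, (D * |(d i).2| + L) := by
    intro d
    have h1 := abs_selEst_le hK hgl hg ht hn hmin1 hsel d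
    rw [Finset.sum_add_distrib, Finset.sum_const, Finset.card_univ, Fintype.card_fin,
      nsmul_eq_mul]
    have h2 : L ≤ n * L := le_mul_of_one_le_left hL.le hn1
    have h3 := hfL (dot2 t θ)
    exact (abs_sub _ _).trans (by linarith)
  have hr0 : 0 ≤ P.r := by linarith
  have hκ : 0 ≤ 2 * P.Υ + 294 := by positivity
  have hS : μ (toMeasurable μ Gᶜ) ≤ ENNReal.ofReal ((2 * P.Υ + 294) * (n : ℝ) ^ (-(4 * P.r))) := by
    rw [measure_toMeasurable]
    exact hbad
  have ham : Measurable fun z : (Fin 2 → ℝ) × ℝ => D * |z.2| + L := by fun_prop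
  have hmoment := hm.joint_envelope_moment hL.le hD0 (by linarith) hC (fun _ => hfL _) hpC
  refine integral_le_of_lintegral_ofReal_le (fun _ => by positivity) (by
    rw [riskConst, ← hM]; positivity) ?_
  calc ∫⁻ d, ENNReal.ofReal (|selEst P n t sel d - f (dot2 t θ)| ^ P.r) ∂μ
      ≤ ∫⁻ d, (ENNReal.ofReal ((a * ρ) ^ P.r) + (toMeasurable μ Gᶜ).indicator
          (fun d => ENNReal.ofReal ((∑ i, (D * |(d i).2| + L)) ^ P.r)) d) ∂μ := by
        refine lintegral_mono fun d => ?_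
        by_cases hd : d ∈ G
        · refine le_add_right (ENNReal.ofReal_le_ofReal (rpow_le_rpow (abs_nonneg _) ?_ hr0))
          exact hgood d hd
        · rw [Set.indicator_of_mem (subset_toMeasurable μ _ hd)]
          exact le_add_left (ENNReal.ofReal_le_ofReal
            (rpow_le_rpow (abs_nonneg _) (hloss d) hr0))
    _ = ENNReal.ofReal ((a * ρ) ^ P.r) + ∫⁻ d in toMeasurable μ Gᶜ,
          ENNReal.ofReal ((∑ i, (D * |(d i).2| + L)) ^ P.r) ∂μ := by
        rw [lintegral_add_left measurable_const, lintegral_const, measure_univ, mul_one,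
          lintegral_indicator (measurableSet_toMeasurable _ _)]
    _ ≤ ENNReal.ofReal ((a * ρ) ^ P.r)
          + ENNReal.ofReal ((M + (2 * P.Υ + 294)) * (n : ℝ) ^ (-P.r)) := by
        gcongr
        exact setLIntegral_rpow_sum_le (a := fun z : (Fin 2 → ℝ) × ℝ => D * |z.2| + L) hn hr hM0
          hκ ham (fun _ => by positivity) hmoment hS
    _ ≤ _ := by
        rw [← ENNReal.ofReal_add (by positivity) (by positivity)]
        refine ENNReal.ofReal_le_ofReal ?_
        rw [riskConst, ← hM, add_mul (a ^ P.r), mul_rpow ha0 hρ0, rpow_neg hn0.le,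
          ← inv_rpow hn0.le]
        gcongr

end Risk

end SingleIndex

namespace SingleIndex

/-- Theorem 3, pointwise adaptation over Hölder classes: fix `b > 0`
and let the kernel satisfy additionally the vanishing-moment condition up to `m_b`.
For any `0 < β ≤ b`, `L > 0`, `r ≥ 1` and `t ∈ [-1/2,1/2]²` there is a constant
`κ₁ > 0`, independent of `n`, such that for all sufficiently large `n` (`n ≥ n₀ ∨ n₁`),
uniformly over `F ∈ 𝔽₂(β,L)` (i.e. `F(x) = f(xᵀθ*)`, `f ∈ H(β,L)`, `θ* ∈ S¹`), the
estimator produced by the selection rule satisfies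
`(E_F|F̂_{(θ̂,ĥ)}(t) - F(t)|^r)^{1/r} ≤ κ₁ ψ_n(β,L)`,
`ψ_n(β,L) = L^{1/(2β+1)} (n⁻¹ ln n)^{β/(2β+1)}`. -/
theorem pointwise_adaptation_upper
    (P : Pars) (b : ℝ) (hb : 0 < b)
    (hΥ : 0 < P.Υ) (hΩc : P.Ωc ∈ Set.Ioc (0 : ℝ) 1) (hω : 0 < P.ω)
    (hK : KernelHyp P.K P.Q) (hKmom : VanishingMoments P.K (mInt b))
    (hgl : P.gl ∈ Set.Ioo (0 : ℝ) 1) (hg : DesignOK P.g P.gl)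
    (hr : 1 ≤ P.r)
    (β L : ℝ) (hβ : 0 < β) (hβb : β ≤ b) (hL : 0 < L)
    (t : Fin 2 → ℝ)
    (ht : t ∈ Set.Icc (fun _ : Fin 2 => -(1/2 : ℝ)) (fun _ : Fin 2 => (1/2 : ℝ))) :
    ∃ κ₁ : ℝ, 0 < κ₁ ∧ ∃ N : ℕ, ∀ n : ℕ, N ≤ n →
      ∀ f ∈ HolderClass β L, ∀ θ ∈ S1, ∀ p ∈ NoiseClass P.Υ P.Ωc P.ω,
      ∀ sel : (Fin n → (Fin 2 → ℝ) × ℝ) → (Fin 2 → ℝ) × ℝ, IsSelector P n t sel →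
        (∫ d, |selEst P n t sel d - f (dot2 t θ)| ^ P.r
            ∂(dataLaw n P.g p fun x => f (dot2 x θ))) ^ (1 / P.r)
          ≤ κ₁ * L ^ (1 / (2 * β + 1)) *
              ((n : ℝ)⁻¹ * Real.log n) ^ (β / (2 * β + 1)) := by
  obtain ⟨A, hA, hev⟩ := eventually_largeSample hΩc hω hgl.1 hK.Q_pos hr hβ hL
  obtain ⟨N, hN⟩ := Filter.eventually_atTop.1 hev
  obtain ⟨C, hC, hmom⟩ := exists_noise_moment (q := 2 * P.r) hΥ hΩc.1 hω (by positivity)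
  have hgl0 := hgl.1
  set R := riskConst P L
    (34 * (L * K1 P.K ^ 2 * 2 ^ β) + 36 * (Ksup P.K ^ 2 + (2 * L + 4 * A) * A + A))
    (2 * Ksup P.K ^ 2 / P.gl) C with hRdef
  have hR : 0 < R := by
    rw [hRdef, riskConst]
    positivity
  refine ⟨R ^ (1 / P.r) / L ^ (1 / (2 * β + 1)), by positivity, N,
    fun n hn f hf θ hθ p hp sel hsel => ?_⟩
  have hs := hN n hn
  have hlog := hs.log_ge
  have hρ : 0 ≤ ((n : ℝ)⁻¹ * log n) ^ (β / (2 * β + 1)) := by positivity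
  rw [div_mul_cancel₀ _ (by positivity)]
  calc _ ≤ (R * (((n : ℝ)⁻¹ * log n) ^ (β / (2 * β + 1))) ^ P.r) ^ (1 / P.r) :=
        rpow_le_rpow (integral_nonneg fun _ => by positivity)
          (hs.risk_le hA hK hKmom hβ hβb hL hΥ hΩc hω hgl0 hg hr ht hC hp (hmom p hp) hf hθ hsel)
          (by positivity)
    _ = _ := by
        rw [mul_rpow hR.le (by positivity), ← rpow_mul hρ, mul_one_div_cancel (by positivity),
          rpow_one]

end SingleIndex
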